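/- arXiv:2005.00099 — 2 statements merged into one kernel-verified Lean document; each statement's English description precedes it below -/
import Mathlib

section
/- Let p be a real polynomial of degree ℓ that is non-negative and non-decreasing on [0,∞). Then there is a constant C > 0 (depending on p) such that for all n ≥ 2, | E[p(C([σ,τ]))] − E[p(C(η))] | ≤ C (log n)^ℓ / n, where σ, τ are independent uniform on S_n and η is uniform on the alternating group A_n. -/
/-- Number of cycles of a permutation of `Fin n`, counting fixed points as 1-cycles. -/
def numCycles {n : ℕ} (π : Equiv.Perm (Fin n)) : ℕ :=
  Multiset.card π.cycleType + (Finset.univ.filter fun i => π i = i).card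


namespace MVC

open Equiv Equiv.Perm


lemma numCycles_add_support {n : ℕ} (π : Perm (Fin n)) :
    numCycles π + π.support.card = Multiset.card π.cycleType + n := by
  unfold numCycles
  have h : (Finset.univ.filter fun i => π i = i) = π.supportᶜ := by
    ext i; simp
  rw [h, Finset.card_compl, Fintype.card_fin]
  have := Finset.card_le_univ π.support
  rw [Fintype.card_fin] at this
  omega

lemma numCycles_swap_mul {n : ℕ} (π : Perm (Fin n)) (i k : Fin n) (hik : i ≠ k) (hk : π k = k) :
    numCycles (swap i k * π) + 1 = numCycles π := by
  have h1 := numCycles_add_support π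
  have h2 := numCycles_add_support (swap i k * π)
  by_cases hi : π i = i
  · have hd : Disjoint (swap i k) π := by
      intro x
      by_cases hx : x = i
      · right; rw [hx, hi]
      · by_cases hx' : x = k
        · right; rw [hx', hk]
        · left; exact swap_apply_of_ne_of_ne hx hx'
    rw [hd.cycleType_mul, hd.card_support_mul, (isCycle_swap hik).cycleType, card_support_swap hik,
      Multiset.card_add] at h2
    simp only [Multiset.card_singleton] at h2
    omega
  · set c := π.cycleOf i with hc
    have hcyc : c.IsCycle := isCycle_cycleOf π hi
    have hcm : c ∈ π.cycleFactorsFinset := by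
      rw [hc, cycleOf_mem_cycleFactorsFinset_iff, mem_support]; exact hi
    set d := π * c⁻¹ with hd
    have hdisj : Disjoint d c := disjoint_mul_inv_of_mem_cycleFactorsFinset hcm
    have hπ : π = c * d := by
      rw [← hdisj.commute.eq, hd]; group
    have hkc : k ∉ c.support := by
      rw [mem_support, not_not]
      by_contra h
      have := (mem_support_cycleOf_iff' hi).1 (mem_support.2 h)
      have := (SameCycle.apply_eq_self_iff this).2 hk
      exact hi this
    have hdk : d k = k := by
      have : c⁻¹ k = k := by
        rw [inv_eq_iff_eq]; exact (not_not.1 (mem_support.not.1 hkc)).symm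
      rw [hd, Perm.mul_apply, this, hk]
    -- c' is a cycle
    obtain ⟨l, hl⟩ : ∃ l, toList π i = i :: l := by
      have hne : toList π i ≠ [] := by
        rw [Ne, toList_eq_nil_iff]; simpa using hi
      obtain ⟨a, l, hal⟩ := List.exists_cons_of_ne_nil hne
      refine ⟨l, ?_⟩
      have h0 : (toList π i)[0]? = some i := by
        have hlen : 0 < (toList π i).length := List.length_pos_of_ne_nil hne
        rw [List.getElem?_eq_getElem hlen, getElem_toList]
        simp
      rw [hal] at h0 ⊢
      simp at h0
      rw [h0]
    have hnod := nodup_toList π i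
    have hform := formPerm_toList π i
    rw [hl] at hnod hform
    have hknot : k ∉ i :: l := by
      rw [← hl, mem_toList_iff]
      intro ⟨h, _⟩
      exact hkc ((mem_support_cycleOf_iff' hi).2 h)
    have hnod' : (k :: i :: l).Nodup := List.nodup_cons.2 ⟨hknot, hnod⟩
    have hc' : swap i k * c = (k :: i :: l).formPerm := by
      rw [List.formPerm_cons_cons, hform, swap_comm]
    have hcyc' : (swap i k * c).IsCycle := by
      rw [hc']; exact List.isCycle_formPerm hnod' (by simp)
    have hsupp' : (swap i k * c).support = insert k c.support := by
      rw [hc', List.support_formPerm_of_nodup _ hnod' (by simp)]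
      have : c.support = (i :: l).toFinset := by
        rw [hc, ← hform, List.support_formPerm_of_nodup _ hnod]
        intro x hx
        rw [hx] at hform
        simp only [List.formPerm_singleton] at hform
        rw [← hform] at hc
        exact hcyc.ne_one hc
      rw [this, List.toFinset_cons]
    have hdisj' : Disjoint (swap i k * c) d := by
      rw [disjoint_iff_disjoint_support, hsupp', Finset.disjoint_insert_left]
      refine ⟨by simpa using hdk, ?_⟩
      exact (disjoint_iff_disjoint_support.1 hdisj.symm)
    have hρ : swap i k * π = (swap i k * c) * d := by rw [mul_assoc, ← hπ]
    rw [hρ] at h2 ⊢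
    rw [hdisj'.cycleType_mul, hdisj'.card_support_mul, hcyc'.cycleType, hsupp',
      Finset.card_insert_of_notMem hkc, Multiset.card_add] at h2
    rw [hπ] at h1
    rw [hdisj.symm.cycleType_mul, hdisj.symm.card_support_mul, hcyc.cycleType,
      Multiset.card_add] at h1
    simp only [Multiset.card_singleton] at h1 h2
    rw [← hπ] at h1
    omega

lemma numCycles_conj {n : ℕ} (τ π : Perm (Fin n)) :
    numCycles (τ * π * τ⁻¹) = numCycles π := by
  have h1 := numCycles_add_support π
  have h2 := numCycles_add_support (τ * π * τ⁻¹)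
  rw [cycleType_conj, card_support_conj] at h2
  omega

lemma numCycles_one {n : ℕ} : numCycles (1 : Perm (Fin n)) = n := by
  simp [numCycles]


end MVC

namespace MVC

open Equiv Equiv.Perm


noncomputable def u {n : ℕ} (g : Perm (Fin n)) : MonoidAlgebra ℝ (Perm (Fin n)) :=
  MonoidAlgebra.of ℝ _ g

lemma u_mul {n : ℕ} (g h : Perm (Fin n)) : u (g * h) = u g * u h := map_mul _ _ _
lemma u_one {n : ℕ} : u (1 : Perm (Fin n)) = 1 := map_one _

lemma u_coeff {n : ℕ} (g h : Perm (Fin n)) : (u g).coeff h = if g = h then 1 else 0 := by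
  simp only [u, MonoidAlgebra.of_apply]
  exact Finsupp.single_apply

def Sm (n m : ℕ) : Finset (Perm (Fin n)) :=
  Finset.univ.filter fun π => ∀ i : Fin n, m ≤ i.val → π i = i

lemma mem_Sm {n m : ℕ} {π : Perm (Fin n)} : π ∈ Sm n m ↔ ∀ i : Fin n, m ≤ i.val → π i = i := by
  simp [Sm]

noncomputable def Zp (n : ℕ) (x : ℝ) (m : ℕ) : MonoidAlgebra ℝ (Perm (Fin n)) :=
  ∑ π ∈ Sm n m, x ^ numCycles π • u π

noncomputable def JM {n : ℕ} (k : Fin n) : MonoidAlgebra ℝ (Perm (Fin n)) :=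
  ∑ i ∈ Finset.Iio k, u (swap i k)

lemma Zp_zero (n : ℕ) (x : ℝ) : Zp n x 0 = x ^ n • 1 := by
  have : Sm n 0 = {1} := by
    ext π; simp only [mem_Sm, Finset.mem_singleton, Nat.zero_le, forall_true_left]
    exact ⟨fun h => Equiv.ext h, fun h i => by rw [h]; rfl⟩
  rw [Zp, this, Finset.sum_singleton, numCycles_one, u_one]

lemma Zp_top (n : ℕ) (x : ℝ) : Zp n x n = ∑ π : Perm (Fin n), x ^ numCycles π • u π := by
  have : Sm n n = Finset.univ := by
    ext π; simp only [mem_Sm, Finset.mem_univ, iff_true]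
    intro i hi; exact absurd i.2 (by omega)
  rw [Zp, this]

lemma Zp_succ (n : ℕ) (x : ℝ) (k : Fin n) :
    x • Zp n x (k.val + 1) = (x • 1 + JM k) * Zp n x k.val := by
  have hR : (x • 1 + JM k) * Zp n x k.val =
      ∑ i ∈ Finset.Iic k, ∑ π ∈ Sm n k.val, (x * x ^ numCycles (swap i k * π)) •
        u (swap i k * π) := by
    rw [← Finset.Iio_insert, Finset.sum_insert (by simp), add_mul, JM, Finset.sum_mul]
    congr 1
    · rw [swap_self, smul_mul_assoc, one_mul, Zp, Finset.smul_sum]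
      refine Finset.sum_congr rfl fun π _ => ?_
      rw [show (Equiv.refl (Fin n) : Perm (Fin n)) = 1 from rfl, one_mul, smul_smul]
    · refine Finset.sum_congr rfl fun i hi => ?_
      rw [Zp, Finset.mul_sum]
      refine Finset.sum_congr rfl fun π hπ => ?_
      have hk : π k = k := mem_Sm.1 hπ k le_rfl
      rw [← numCycles_swap_mul π i k (Finset.mem_Iio.1 hi).ne hk, pow_succ', mul_smul_comm, u_mul]
  rw [hR, ← Finset.sum_product', Zp, Finset.smul_sum]
  symm
  refine Finset.sum_bij' (fun p _ => swap p.1 k * p.2) (fun π _ => (π k, swap (π k) k * π))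
    ?_ ?_ ?_ ?_ ?_
  · rintro ⟨i, π⟩ h
    simp only [Finset.mem_product, Finset.mem_Iic, mem_Sm] at h ⊢
    intro j hj
    have hjk : k < j := Fin.lt_def.2 hj
    rw [Perm.mul_apply, h.2 j (by omega), swap_apply_of_ne_of_ne]
    · exact (lt_of_le_of_lt h.1 hjk).ne'
    · exact hjk.ne'
  · intro π h
    simp only [Finset.mem_product, Finset.mem_Iic, mem_Sm] at h ⊢
    constructor
    · by_contra hlt
      push Not at hlt
      have h1 := h (π k) (Fin.lt_def.1 hlt)
      have := π.injective h1
      exact absurd this hlt.ne'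
    · intro j hj
      rw [Perm.mul_apply]
      rcases eq_or_lt_of_le hj with hj | hj
      · rw [← Fin.ext hj, swap_apply_left]
      · rw [h j hj, swap_apply_of_ne_of_ne]
        · intro hjk
          rw [← h j hj] at hjk
          have := π.injective hjk
          rw [this] at hj; exact lt_irrefl _ hj
        · rintro rfl; exact lt_irrefl _ hj
  · rintro ⟨i, π⟩ h
    simp only [Finset.mem_product, Finset.mem_Iic, mem_Sm] at h
    have hk := h.2 k le_rfl
    simp only [Perm.mul_apply, hk, swap_apply_right]
    rw [← mul_assoc, swap_mul_self, one_mul]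
  · intro π h
    simp only
    rw [← mul_assoc, swap_mul_self, one_mul]
  · rintro ⟨i, π⟩ h
    simp only
    rw [smul_smul]

lemma eig {n : ℕ} {x : ℝ} (hx : x ≠ 0) (y : MonoidAlgebra ℝ (Perm (Fin n))) (c : Fin n → ℝ)
    (h : ∀ k, JM k * y = c k • y) :
    (∑ π : Perm (Fin n), x ^ numCycles π • u π) * y = (∏ k, (x + c k)) • y := by
  have key : ∀ m ≤ n, x ^ m • (Zp n x m * y) =
      (x ^ n * ∏ k ∈ Finset.univ.filter (fun k : Fin n => k.val < m), (x + c k)) • y := by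
    intro m
    induction m with
    | zero => intro _; simp [Zp_zero]
    | succ m ih =>
      intro hm
      have ih := ih (by omega)
      let k : Fin n := ⟨m, hm⟩
      have hs := Zp_succ n x k
      have hf : Finset.univ.filter (fun j : Fin n => j.val < m + 1) =
          insert k (Finset.univ.filter (fun j : Fin n => j.val < m)) := by
        ext j; simp [k, Fin.ext_iff]; omega
      rw [hf, Finset.prod_insert (by simp [k])]
      calc x ^ (m+1) • (Zp n x (m+1) * y) = x ^ m • ((x • Zp n x (m+1)) * y) := by
            rw [smul_mul_assoc, smul_smul, pow_succ]
        _ = (x • 1 + JM k) * (x ^ m • (Zp n x m * y)) := by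
            rw [show m + 1 = k.val + 1 from rfl, hs, mul_smul_comm, mul_assoc]
        _ = _ := by
            rw [ih, mul_smul_comm, add_mul, h k, smul_mul_assoc, one_mul, ← add_smul, smul_smul]
            congr 1; ring
  have := key n le_rfl
  rw [Zp_top, mul_smul] at this
  have h2 := smul_right_injective _ (pow_ne_zero n hx) this
  rw [h2]
  congr 2
  ext k; simp

end MVC

namespace MVC

open Equiv Equiv.Perm


def Rset {n : ℕ} (row : Fin n → ℕ) : Finset (Perm (Fin n)) :=
  Finset.univ.filter fun w => ∀ i, row (w i) = row i

lemma mem_Rset {n : ℕ} {row : Fin n → ℕ} {w : Perm (Fin n)} :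
    w ∈ Rset row ↔ ∀ i, row (w i) = row i := by simp [Rset]

lemma row_swap {n : ℕ} {row : Fin n → ℕ} {a b : Fin n} (h : row a = row b) (i : Fin n) :
    row (swap a b i) = row i := by
  rw [swap_apply_def]; split_ifs with h1 h2
  · rw [h1, h]
  · rw [h2, h]
  · rfl

noncomputable def Esum {n : ℕ} (row : Fin n → ℕ) : MonoidAlgebra ℝ (Perm (Fin n)) :=
  ∑ w ∈ Rset row, u w

noncomputable def Nsum {n : ℕ} (col : Fin n → ℕ) : MonoidAlgebra ℝ (Perm (Fin n)) :=
  ∑ w ∈ Rset col, ((sign w : ℤ) : ℝ) • u w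

lemma E_swap {n : ℕ} {row : Fin n → ℕ} {a b : Fin n} (h : row a = row b) :
    u (swap a b) * Esum row = Esum row := by
  rw [Esum, Finset.mul_sum]
  refine Finset.sum_bij' (fun w _ => swap a b * w) (fun w _ => swap a b * w) ?_ ?_ ?_ ?_ ?_
  · intro w hw; rw [mem_Rset] at hw ⊢; intro i; rw [Perm.mul_apply, row_swap h, hw]
  · intro w hw; rw [mem_Rset] at hw ⊢; intro i; rw [Perm.mul_apply, row_swap h, hw]
  · intro w _; simp
  · intro w _; simp
  · intro w _; rw [u_mul]

lemma N_swap {n : ℕ} {col : Fin n → ℕ} {a b : Fin n} (h : col a = col b) (hab : a ≠ b) :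
    u (swap a b) * Nsum col = - Nsum col := by
  rw [Nsum, Finset.mul_sum, ← Finset.sum_neg_distrib]
  refine Finset.sum_bij' (fun w _ => swap a b * w) (fun w _ => swap a b * w) ?_ ?_ ?_ ?_ ?_
  · intro w hw; rw [mem_Rset] at hw ⊢; intro i; rw [Perm.mul_apply, row_swap h, hw]
  · intro w hw; rw [mem_Rset] at hw ⊢; intro i; rw [Perm.mul_apply, row_swap h, hw]
  · intro w _; simp
  · intro w _; simp
  · intro w _; rw [u_mul, Perm.sign_mul, sign_swap hab]; simp

lemma row_kill {n : ℕ} {row col : Fin n → ℕ} (k : Fin n) (r : ℕ) (hr : r < row k)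
    (H3 : ∀ (k : Fin n) (a b : ℕ), a ≤ row k → b ≤ col k → ∃ i, row i = a ∧ col i = b) :
    (∑ i ∈ Finset.univ.filter (fun i => row i = r), u (swap i k)) * (Esum row * Nsum col)
      = - (Esum row * Nsum col) := by
  have hex : ∀ j : Fin n, ∃ i, row j = row k → (row i = r ∧ col i = col j) := by
    intro j
    by_cases hj : row j = row k
    · obtain ⟨i, hi⟩ := H3 j r (col j) (by omega) le_rfl
      exact ⟨i, fun _ => hi⟩
    · exact ⟨j, fun h => absurd h hj⟩
  choose i0 hi0 using hex
  set B := Finset.univ.filter (fun i => row i = r) with hB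
  have memB : ∀ i, i ∈ B ↔ row i = r := by intro i; simp [hB]
  set a : Perm (Fin n) → Fin n := fun w => w (i0 (w⁻¹ k)) with ha
  have hinv : ∀ w ∈ Rset row, row (w⁻¹ k) = row k := by
    intro w hw
    have := mem_Rset.1 hw (w⁻¹ k)
    rw [← this]; simp
  have haB : ∀ w ∈ Rset row, a w ∈ B := by
    intro w hw
    rw [memB, ha]
    simp only
    rw [mem_Rset.1 hw]
    exact (hi0 _ (hinv w hw)).1
  have hconj : ∀ w ∈ Rset row, swap (a w) k * w = w * swap (i0 (w⁻¹ k)) (w⁻¹ k) := by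
    intro w _
    rw [ha, Equiv.mul_swap_eq_swap_mul]; simp
  have hN : ∀ w ∈ Rset row, u (swap (i0 (w⁻¹ k)) (w⁻¹ k)) * Nsum col = - Nsum col := by
    intro w hw
    obtain ⟨h1, h2⟩ := hi0 _ (hinv w hw)
    refine N_swap h2 ?_
    intro h
    have h3 := hinv w hw
    rw [h] at h1
    omega
  have hLHS : (∑ i ∈ B, u (swap i k)) * (Esum row * Nsum col) =
      ∑ w ∈ Rset row, ∑ i ∈ B, u (swap i k * w) * Nsum col := by
    rw [Esum, Finset.sum_mul, Finset.sum_comm]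
    refine Finset.sum_congr rfl fun i _ => ?_
    rw [Finset.sum_mul, Finset.mul_sum]
    refine Finset.sum_congr rfl fun w _ => ?_
    rw [u_mul, mul_assoc]
  have hsplit : ∀ w ∈ Rset row, ∑ i ∈ B, u (swap i k * w) * Nsum col =
      - (u w * Nsum col) + ∑ i ∈ B.erase (a w), u (swap i k * w) * Nsum col := by
    intro w hw
    rw [← Finset.add_sum_erase B _ (haB w hw), hconj w hw, u_mul, mul_assoc, hN w hw, mul_neg]
  rw [hLHS, Finset.sum_congr rfl hsplit, Finset.sum_add_distrib, Finset.sum_neg_distrib,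
    ← Finset.sum_mul, ← Esum, add_eq_left, Finset.sum_sigma']
  have hk : k ∉ B := by rw [memB]; omega
  refine Finset.sum_involution (fun p _ => ⟨swap p.2 (a p.1) * p.1, a p.1⟩) ?_ ?_ ?_ ?_
  · rintro ⟨w, i⟩ hp
    simp only [Finset.mem_sigma, Finset.mem_erase] at hp
    obtain ⟨hw, hia, hi⟩ := hp
    simp only
    have hak : a w ≠ k := fun h => hk (h ▸ haB w hw)
    have hik : i ≠ k := fun h => hk (h ▸ hi)
    have e1 : swap (a w) k * (swap i (a w) * w) = swap i k * w * swap (i0 (w⁻¹ k)) (w⁻¹ k) := by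
      rw [mul_assoc, ← hconj w hw, ← mul_assoc, ← mul_assoc]
      congr 1
      ext j
      simp only [Perm.mul_apply, swap_apply_def]
      grind
    rw [e1, u_mul (swap i k * w), mul_assoc, hN w hw, mul_neg, add_neg_cancel]
  · rintro ⟨w, i⟩ hp _ heq
    simp only [Finset.mem_sigma, Finset.mem_erase] at hp
    simp only [Sigma.mk.injEq, heq_eq_eq] at heq
    exact hp.2.1 heq.2.symm
  · rintro ⟨w, i⟩ hp
    simp only [Finset.mem_sigma, Finset.mem_erase] at hp ⊢
    obtain ⟨hw, hia, hi⟩ := hp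
    have hrow : row i = row (a w) := by rw [(memB i).1 hi, (memB _).1 (haB w hw)]
    have hak : a w ≠ k := fun h => hk (h ▸ haB w hw)
    have hik : i ≠ k := fun h => hk (h ▸ hi)
    have hinvk : (swap i (a w) * w)⁻¹ k = w⁻¹ k := by
      rw [mul_inv_rev, swap_inv, Perm.mul_apply, swap_apply_of_ne_of_ne hik.symm hak.symm]
    have ha' : a (swap i (a w) * w) = i := by
      show (swap i (a w) * w) (i0 ((swap i (a w) * w)⁻¹ k)) = i
      rw [hinvk, Perm.mul_apply]
      exact swap_apply_right _ _
    refine ⟨?_, ?_, haB w hw⟩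
    · rw [mem_Rset] at hw ⊢
      intro j; rw [Perm.mul_apply, row_swap hrow, hw]
    · rw [ha']; exact hia.symm
  · rintro ⟨w, i⟩ hp
    simp only [Finset.mem_sigma, Finset.mem_erase] at hp ⊢
    obtain ⟨hw, hia, hi⟩ := hp
    have hak : a w ≠ k := fun h => hk (h ▸ haB w hw)
    have hik : i ≠ k := fun h => hk (h ▸ hi)
    have hinvk : (swap i (a w) * w)⁻¹ k = w⁻¹ k := by
      rw [mul_inv_rev, swap_inv, Perm.mul_apply, swap_apply_of_ne_of_ne hik.symm hak.symm]
    have ha' : a (swap i (a w) * w) = i := by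
      show (swap i (a w) * w) (i0 ((swap i (a w) * w)⁻¹ k)) = i
      rw [hinvk, Perm.mul_apply]
      exact swap_apply_right _ _
    rw [ha', swap_comm (a w) i, ← mul_assoc, swap_mul_self, one_mul]

lemma JM_y {n : ℕ} {row col : Fin n → ℕ}
    (H1 : ∀ i j, row i = row j → col i = col j → i = j)
    (H2 : ∀ i k, i < k ↔ row i < row k ∨ (row i = row k ∧ col i < col k))
    (H3 : ∀ (k : Fin n) (a b : ℕ), a ≤ row k → b ≤ col k → ∃ i, row i = a ∧ col i = b)
    (k : Fin n) :
    JM k * (Esum row * Nsum col) = ((col k : ℝ) - row k) • (Esum row * Nsum col) := by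
  have hI : Finset.Iio k = (Finset.univ.filter fun i => row i = row k ∧ col i < col k) ∪
      (Finset.range (row k)).biUnion (fun r => Finset.univ.filter fun i => row i = r) := by
    ext i; simp [H2]; tauto
  rw [JM, hI, Finset.sum_union, Finset.sum_biUnion, add_mul, Finset.sum_mul, Finset.sum_mul]
  · have e1 : ∀ i ∈ Finset.univ.filter (fun i => row i = row k ∧ col i < col k),
        u (swap i k) * (Esum row * Nsum col) = Esum row * Nsum col := by
      intro i hi
      rw [← mul_assoc, E_swap (by simp at hi; exact hi.1)]
    rw [Finset.sum_congr rfl e1, Finset.sum_const]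
    have e2 : ∀ r ∈ Finset.range (row k),
        (∑ i ∈ Finset.univ.filter (fun i => row i = r), u (swap i k)) * (Esum row * Nsum col)
          = - (Esum row * Nsum col) := by
      intro r hr
      exact row_kill k r (Finset.mem_range.1 hr) H3
    rw [Finset.sum_congr rfl e2, Finset.sum_const, Finset.card_range]
    have hcard : (Finset.univ.filter (fun i => row i = row k ∧ col i < col k)).card = col k := by
      rw [← Finset.card_range (col k)]
      refine Finset.card_bij (fun i _ => col i) ?_ ?_ ?_
      · intro i hi; simp at hi ⊢; exact hi.2
      · intro i hi j hj h
        simp at hi hj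
        exact H1 i j (by rw [hi.1, hj.1]) h
      · intro b hb
        obtain ⟨i, hi⟩ := H3 k (row k) b le_rfl (by simp at hb; omega)
        refine ⟨i, ?_, hi.2⟩
        simp at hb ⊢; exact ⟨hi.1, by omega⟩
    rw [hcard, sub_smul, smul_neg, Nat.cast_smul_eq_nsmul, Nat.cast_smul_eq_nsmul, sub_eq_add_neg]
  · intro r _ s _ hrs
    rw [Function.onFun, Finset.disjoint_left]
    intro i hi hj
    simp at hi hj; exact hrs (hi.symm.trans hj)
  · rw [Finset.disjoint_left]
    intro i hi hj
    simp at hi hj; omega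

lemma y_coeff_one {n : ℕ} {row col : Fin n → ℕ}
    (H1 : ∀ i j, row i = row j → col i = col j → i = j) :
    (Esum row * Nsum col).coeff 1 = 1 := by
  rw [Esum, Nsum, Finset.sum_mul_sum]
  simp only [MonoidAlgebra.coeff_sum, Finsupp.coe_finsetSum, Finset.sum_apply, mul_smul_comm,
    MonoidAlgebra.coeff_smul_apply, ← u_mul, u_coeff]
  rw [Finset.sum_eq_single 1, Finset.sum_eq_single 1]
  · simp
  · intro b _ hb; simp [hb]
  · intro h; exact absurd (mem_Rset.2 (by simp)) h
  · intro w hw hw1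
    refine Finset.sum_eq_zero fun v hv => ?_
    rw [if_neg, smul_zero]
    intro hwv
    apply hw1
    have hv' : v = w⁻¹ := (eq_inv_of_mul_eq_one_right hwv)
    ext i
    congr 1
    refine H1 _ _ (mem_Rset.1 hw i) ?_
    have := mem_Rset.1 hv (w i)
    rw [hv'] at this
    simp at this
    exact this.symm
  · intro h; exact absurd (mem_Rset.2 (by simp)) h


end MVC

namespace MVC

open Equiv Equiv.Perm


lemma trace_eig {K V ι : Type*} [Field K] [AddCommGroup V] [Module K V] [FiniteDimensional K V]
    [Fintype ι] [Nonempty ι] (f : V →ₗ[K] V) (v : ι → V) (c : ι → K) (hc : Function.Injective c)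
    (hv : ∀ i, v i ≠ 0) (hf : ∀ i, f (v i) = c i • v i)
    (hcard : Module.finrank K V ≤ Fintype.card ι) :
    LinearMap.trace K V f = ∑ i, c i := by
  classical
  have hli : LinearIndependent K v := Module.End.eigenvectors_linearIndependent' f c hc v
    (fun i => ⟨Module.End.mem_eigenspace_iff.2 (hf i), hv i⟩)
  have h2 := hli.fintype_card_le_finrank
  have h3 : Fintype.card ι = Module.finrank K V := le_antisymm h2 hcard
  rw [LinearMap.trace_eq_matrix_trace K (basisOfLinearIndependentOfCardEqFinrank hli h3), Matrix.trace]
  refine Finset.sum_congr rfl fun i _ => ?_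
  rw [Matrix.diag_apply, LinearMap.toMatrix_apply]
  simp only [coe_basisOfLinearIndependentOfCardEqFinrank, hf, map_smul]
  have : v i = basisOfLinearIndependentOfCardEqFinrank hli h3 i := by simp
  rw [this, Module.Basis.repr_self]
  simp

abbrev Alg (n : ℕ) := MonoidAlgebra ℝ (Perm (Fin n))

noncomputable def clsMap (n : ℕ) :
    ((Fintype.card (Fin n)).Partition → ℝ) →ₗ[ℝ] Alg n where
  toFun φ := ∑ π : Perm (Fin n), φ π.partition • u π
  map_add' φ ψ := by simp [add_smul, Finset.sum_add_distrib]
  map_smul' c φ := by simp [mul_smul, Finset.smul_sum]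

lemma expand {n : ℕ} (b : Alg n) : b = ∑ π, b.coeff π • u π := by
  apply MonoidAlgebra.coeff_injective
  ext g
  simp [MonoidAlgebra.coeff_sum, u_coeff]

lemma coeff_conj {n : ℕ} (b : Alg n) (g h : Perm (Fin n)) :
    (u g * b * u g⁻¹).coeff h = b.coeff (g⁻¹ * h * g) := by
  simp only [u, MonoidAlgebra.of_apply]
  rw [MonoidAlgebra.coeff_mul_single_apply, MonoidAlgebra.coeff_single_mul_apply]
  simp [mul_assoc]

lemma mem_cls {n : ℕ} (b : Alg n) (hb : ∀ g, u g * b * u g⁻¹ = b) : b ∈ (clsMap n).range := by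
  classical
  have hc : ∀ π ρ : Perm (Fin n), π.partition = ρ.partition → b.coeff π = b.coeff ρ := by
    intro π ρ h
    obtain ⟨g, hg⟩ := isConj_iff.1 (partition_eq_of_isConj.2 h)
    rw [← hg]
    conv_rhs => rw [← hb g, coeff_conj]
    congr 1; group
  refine ⟨fun P => if h : ∃ π : Perm (Fin n), π.partition = P then b.coeff h.choose else 0, ?_⟩
  conv_rhs => rw [expand b]
  refine Finset.sum_congr rfl fun π _ => ?_
  have hex : ∃ ρ : Perm (Fin n), ρ.partition = π.partition := ⟨π, rfl⟩
  simp only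
  rw [dif_pos hex, hc _ π hex.choose_spec]

noncomputable def Zx (n : ℕ) (x : ℝ) : Alg n := ∑ π : Perm (Fin n), x ^ numCycles π • u π

lemma Zx_coeff (n : ℕ) (x : ℝ) (g : Perm (Fin n)) : (Zx n x).coeff g = x ^ numCycles g := by
  simp [Zx, MonoidAlgebra.coeff_sum, u_coeff]

lemma Zx_comm (n : ℕ) (x : ℝ) (g : Perm (Fin n)) : Zx n x * u g = u g * Zx n x := by
  have h : u g * Zx n x * u g⁻¹ = Zx n x := by
    apply MonoidAlgebra.coeff_injective
    ext h
    rw [coeff_conj, Zx_coeff, Zx_coeff]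
    congr 1
    have := numCycles_conj g⁻¹ h
    rwa [inv_inv] at this
  conv_lhs => rw [← h]
  rw [mul_assoc, ← u_mul]; simp [u_one]

noncomputable def avg {n : ℕ} (a : Alg n) : Alg n := ∑ τ : Perm (Fin n), u τ * a * u τ⁻¹

lemma avg_inv {n : ℕ} (a : Alg n) (g : Perm (Fin n)) : u g * avg a * u g⁻¹ = avg a := by
  rw [avg, Finset.mul_sum, Finset.sum_mul]
  refine Fintype.sum_equiv (Equiv.mulLeft g) _ _ fun τ => ?_
  simp only [Equiv.coe_mulLeft, mul_inv_rev, u_mul, mul_assoc]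

lemma avg_of_inv {n : ℕ} (a : Alg n) (h : ∀ g, u g * a * u g⁻¹ = a) :
    avg a = (n.factorial : ℝ) • a := by
  rw [avg, Finset.sum_congr rfl fun g _ => h g, Finset.sum_const, Finset.card_univ,
    Fintype.card_perm, Fintype.card_fin, Nat.cast_smul_eq_nsmul]

noncomputable def Qop (n : ℕ) (x : ℝ) : Alg n →ₗ[ℝ] Alg n where
  toFun a := avg (Zx n x * a)
  map_add' a b := by simp [avg, mul_add, add_mul, Finset.sum_add_distrib]
  map_smul' c a := by simp [avg, Finset.smul_sum]

lemma trace_Qop (n : ℕ) (x : ℝ) : LinearMap.trace ℝ _ (Qop n x) =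
    ∑ σ : Perm (Fin n), ∑ τ : Perm (Fin n), x ^ numCycles (σ * τ * σ⁻¹ * τ⁻¹) := by
  rw [LinearMap.trace_eq_matrix_trace ℝ (MonoidAlgebra.basis (Perm (Fin n)) ℝ), Matrix.trace,
    Finset.sum_comm]
  refine Finset.sum_congr rfl fun g _ => ?_
  rw [Matrix.diag_apply, LinearMap.toMatrix_apply]
  have hb : MonoidAlgebra.basis (Perm (Fin n)) ℝ g = u g := by
    simp [u]
  rw [hb]
  show (avg (Zx n x * u g)).coeff g = _
  rw [avg, MonoidAlgebra.coeff_sum, Finsupp.finsetSum_apply]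
  refine Fintype.sum_equiv (Equiv.inv _) _ _ fun τ => ?_
  rw [coeff_conj]
  simp only [u, MonoidAlgebra.of_apply]
  rw [MonoidAlgebra.coeff_mul_single_apply, Zx_coeff]
  simp [mul_assoc]

theorem trace_formula {n : ℕ} {x : ℝ} (hx : x ≠ 0) {ι : Type} [Fintype ι] [Nonempty ι]
    (row col : ι → Fin n → ℕ)
    (H1 : ∀ s i j, row s i = row s j → col s i = col s j → i = j)
    (H2 : ∀ s i k, i < k ↔ row s i < row s k ∨ (row s i = row s k ∧ col s i < col s k))
    (H3 : ∀ s (k : Fin n) (a b : ℕ), a ≤ row s k → b ≤ col s k →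
      ∃ i, row s i = a ∧ col s i = b)
    (hcard : Fintype.card ((Fintype.card (Fin n)).Partition) ≤ Fintype.card ι)
    (hinj : Function.Injective fun s => ∏ k, (x + ((col s k : ℝ) - row s k))) :
    ∑ σ : Perm (Fin n), ∑ τ : Perm (Fin n), x ^ numCycles (σ * τ * σ⁻¹ * τ⁻¹) =
      n.factorial * ∑ s, ∏ k, (x + ((col s k : ℝ) - row s k)) := by
  have : FiniteDimensional ℝ (Alg n) :=
    Module.Basis.finiteDimensional_of_finite (MonoidAlgebra.basis (Perm (Fin n)) ℝ)
  have hn : (n.factorial : ℝ) ≠ 0 := by exact_mod_cast n.factorial_ne_zero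
  have hmem : ∀ a, Qop n x a ∈ (clsMap n).range := fun a => mem_cls _ (avg_inv _)
  rw [← trace_Qop, ← LinearMap.trace_restrict_eq_of_forall_mem _ _ hmem, Finset.mul_sum]
  set y : ι → Alg n := fun s => Esum (row s) * Nsum (col s) with hy
  have hZy : ∀ s, Zx n x * y s = (∏ k, (x + ((col s k : ℝ) - row s k))) • y s := fun s =>
    eig hx (y s) _ (fun k => JM_y (H1 s) (H2 s) (H3 s) k)
  have hZa : ∀ s, Zx n x * avg (y s) = (∏ k, (x + ((col s k : ℝ) - row s k))) • avg (y s) := by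
    intro s
    rw [avg, Finset.mul_sum, Finset.smul_sum]
    refine Finset.sum_congr rfl fun τ _ => ?_
    rw [← mul_assoc, ← mul_assoc, Zx_comm, mul_assoc (u τ), hZy]
    simp
  refine trace_eig _ (fun s => ⟨avg (y s), mem_cls _ (avg_inv _)⟩) _ ?_ ?_ ?_ ?_
  · intro s t hst
    exact hinj (mul_left_cancel₀ hn hst)
  · intro s h0
    have h1 : avg (y s) = 0 := congrArg Subtype.val h0
    have h2 : (avg (y s)).coeff 1 = 0 := by rw [h1]; rfl
    rw [avg, MonoidAlgebra.coeff_sum, Finsupp.finsetSum_apply] at h2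
    simp only [coeff_conj, mul_one, inv_mul_cancel, hy, y_coeff_one (H1 s)] at h2
    simp [Fintype.card_perm] at h2
    exact n.factorial_ne_zero h2
  · intro s
    apply Subtype.ext
    show avg (Zx n x * avg (y s)) = _ • avg (y s)
    rw [avg_of_inv, hZa, smul_smul]
    intro g
    rw [hZa, mul_smul_comm, smul_mul_assoc, avg_inv]
  · refine (LinearMap.finrank_range_le _).trans ?_
    rw [Module.finrank_fintype_fun_eq_card]
    exact hcard


end MVC

namespace MVC

open Equiv Equiv.Perm


def Low (s : Finset (ℕ × ℕ)) : Prop :=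
  ∀ a b a' b', (a, b) ∈ s → a' ≤ a → b' ≤ b → (a', b') ∈ s

open Classical in
noncomputable def YD (n : ℕ) : Finset (Finset (ℕ × ℕ)) :=
  ((Finset.range n ×ˢ Finset.range n).powerset).filter fun s => s.card = n ∧ Low s

lemma mem_YD' {n : ℕ} {s : Finset (ℕ × ℕ)} : s ∈ YD n ↔
    s ⊆ Finset.range n ×ˢ Finset.range n ∧ s.card = n ∧ Low s := by
  simp [YD]

lemma low_bound {n : ℕ} {s : Finset (ℕ × ℕ)} (hc : s.card = n) (hl : Low s) :
    s ⊆ Finset.range n ×ˢ Finset.range n := by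
  rintro ⟨a, b⟩ h
  simp only [Finset.mem_product, Finset.mem_range]
  constructor
  · have : (Finset.range (a + 1)).image (fun i => (i, b)) ⊆ s := by
      intro c hc
      simp only [Finset.mem_image, Finset.mem_range] at hc
      obtain ⟨i, hi, rfl⟩ := hc
      exact hl a b i b h (by omega) le_rfl
    have := Finset.card_le_card this
    rw [Finset.card_image_of_injective _ (fun i j h => (Prod.mk.inj h).1), Finset.card_range] at this
    omega
  · have : (Finset.range (b + 1)).image (fun i => (a, i)) ⊆ s := by
      intro c hc
      simp only [Finset.mem_image, Finset.mem_range] at hc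
      obtain ⟨i, hi, rfl⟩ := hc
      exact hl a b a i h le_rfl (by omega)
    have := Finset.card_le_card this
    rw [Finset.card_image_of_injective _ (fun i j h => (Prod.mk.inj h).2), Finset.card_range] at this
    omega

lemma mem_YD {n : ℕ} {s : Finset (ℕ × ℕ)} : s ∈ YD n ↔ s.card = n ∧ Low s := by
  rw [mem_YD']; exact ⟨fun h => h.2, fun h => ⟨low_bound h.1 h.2, h⟩⟩

/-- partitions to diagrams -/
def pd (m : Multiset ℕ) (n : ℕ) : Finset (ℕ × ℕ) :=
  (Finset.range n ×ˢ Finset.range n).filter fun c => c.1 < (m.filter (c.2 < ·)).card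

lemma sum_filter_card (n : ℕ) (m : Multiset ℕ) (h : ∀ p ∈ m, p ≤ n) :
    ∑ j ∈ Finset.range n, (m.filter (j < ·)).card = m.sum := by
  induction m using Multiset.induction with
  | empty => simp
  | cons a m ih =>
    have ih := ih (fun p hp => h p (Multiset.mem_cons_of_mem hp))
    have ha := h a (Multiset.mem_cons_self a m)
    rw [Multiset.sum_cons, ← ih]
    have : ∀ j ∈ Finset.range n, ((a ::ₘ m).filter (j < ·)).card =
        (if j < a then 1 else 0) + (m.filter (j < ·)).card := by
      intro j _
      rw [Multiset.filter_cons]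
      split_ifs <;> simp [add_comm]
    rw [Finset.sum_congr rfl this, Finset.sum_add_distrib]
    congr 1
    rw [← Finset.card_filter]
    rw [show (Finset.range n).filter (fun j => j < a) = Finset.range a by
      ext j; simp; omega, Finset.card_range]

lemma card_le_sum (m : Multiset ℕ) (h : ∀ p ∈ m, 0 < p) : m.card ≤ m.sum := by
  induction m using Multiset.induction with
  | empty => simp
  | cons a m ih =>
    have ih := ih (fun p hp => h p (Multiset.mem_cons_of_mem hp))
    have ha := h a (Multiset.mem_cons_self a m)
    simp; omega

lemma filt_le {n : ℕ} (P : n.Partition) (j : ℕ) : (P.parts.filter (j < ·)).card ≤ n := by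
  refine (Multiset.card_le_card (Multiset.filter_le _ _)).trans ?_
  have := card_le_sum P.parts (fun p hp => P.parts_pos hp)
  rwa [P.parts_sum] at this

lemma part_le {n : ℕ} (P : n.Partition) (p : ℕ) (hp : p ∈ P.parts) : p ≤ n := by
  rw [← P.parts_sum]; exact Multiset.single_le_sum (by simp) _ hp

lemma pd_mem {n : ℕ} (P : n.Partition) : pd P.parts n ∈ YD n := by
  rw [mem_YD]
  constructor
  · have e : pd P.parts n = (Finset.range n).biUnion fun j =>
        (Finset.range ((P.parts.filter (j < ·)).card)).image fun i => (i, j) := by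
      ext ⟨a, b⟩
      simp only [pd, Finset.mem_filter, Finset.mem_product, Finset.mem_range, Finset.mem_biUnion,
        Finset.mem_image, Prod.mk.injEq]
      constructor
      · rintro ⟨⟨_, hb⟩, h⟩; exact ⟨b, hb, a, h, rfl, rfl⟩
      · rintro ⟨b', hb, a', h, rfl, rfl⟩; exact ⟨⟨lt_of_lt_of_le h (filt_le P _), hb⟩, h⟩
    rw [e, Finset.card_biUnion]
    · rw [Finset.sum_congr rfl fun j _ => by
        rw [Finset.card_image_of_injective _ (fun i j h => (Prod.mk.inj h).1), Finset.card_range],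
        sum_filter_card n _ (part_le P), P.parts_sum]
    · intro i _ j _ hij
      rw [Function.onFun, Finset.disjoint_left]
      intro c hc hd
      simp only [Finset.mem_image] at hc hd
      obtain ⟨_, _, rfl⟩ := hc
      obtain ⟨_, _, h⟩ := hd
      exact hij (Prod.mk.inj h).2.symm
  · intro a b a' b' h ha hb
    simp only [pd, Finset.mem_filter, Finset.mem_product, Finset.mem_range] at h ⊢
    refine ⟨⟨by omega, by omega⟩, ?_⟩
    have : (P.parts.filter (b < ·)).card ≤ (P.parts.filter (b' < ·)).card :=
      Multiset.card_le_card (Multiset.monotone_filter_right _ (fun x hx => by omega))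
    omega

lemma count_succ (m : Multiset ℕ) (p : ℕ) :
    m.count (p + 1) + (m.filter (p + 1 < ·)).card = (m.filter (p < ·)).card := by
  induction m using Multiset.induction with
  | empty => simp
  | cons a m ih =>
    rw [Multiset.count_cons, Multiset.filter_cons, Multiset.filter_cons]
    split_ifs <;> simp <;> omega

lemma pd_inj {n : ℕ} (P Q : n.Partition) (h : pd P.parts n = pd Q.parts n) : P = Q := by
  have hf : ∀ j, (P.parts.filter (j < ·)).card = (Q.parts.filter (j < ·)).card := by
    intro j
    by_cases hj : j < n
    · have key : ∀ i < n, i < (P.parts.filter (j < ·)).card ↔ i < (Q.parts.filter (j < ·)).card := by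
        intro i hi
        have := Finset.ext_iff.1 h (i, j)
        simpa [pd, hi, hj] using this
      have h1 := filt_le P j
      have h2 := filt_le Q j
      by_contra hne
      rcases lt_or_gt_of_ne hne with hlt | hlt
      · have := (key _ (lt_of_lt_of_le hlt h2)).2 hlt; omega
      · have := (key _ (lt_of_lt_of_le hlt h1)).1 hlt; omega
    · have e : ∀ R : n.Partition, R.parts.filter (j < ·) = 0 := by
        intro R
        rw [Multiset.filter_eq_nil]
        intro p hp; have := part_le R p hp; omega
      rw [e P, e Q]
  apply Nat.Partition.ext
  ext p
  cases p with
  | zero =>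
    rw [Multiset.count_eq_zero_of_notMem, Multiset.count_eq_zero_of_notMem]
    · intro h; exact absurd (Q.parts_pos h) (lt_irrefl _)
    · intro h; exact absurd (P.parts_pos h) (lt_irrefl _)
  | succ p =>
    have h1 := count_succ P.parts p
    have h2 := count_succ Q.parts p
    rw [hf p, hf (p+1)] at h1
    omega

lemma card_partition_le (n : ℕ) : Fintype.card n.Partition ≤ (YD n).card := by
  rw [← Finset.card_univ]
  exact Finset.card_le_card_of_injOn (fun P => pd P.parts n) (fun P _ => pd_mem P)
    (fun P _ Q _ h => pd_inj P Q h)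

open Polynomial in
noncomputable def cp (s : Finset (ℕ × ℕ)) : ℝ[X] := ∏ c ∈ s, (X + C ((c.2 : ℝ) - c.1))

lemma diag_card_eq {s t : Finset (ℕ × ℕ)} (h : cp s = cp t) (d : ℤ) :
    (s.filter fun c => (c.2 : ℤ) - c.1 = d).card = (t.filter fun c => (c.2 : ℤ) - c.1 = d).card := by
  have key : ∀ s : Finset (ℕ × ℕ), (s.filter fun c => (c.2 : ℤ) - c.1 = d).card =
      (cp s).roots.count (-(d : ℝ)) := by
    intro s
    have : cp s = (s.val.map fun c => (Polynomial.X - Polynomial.C (-((c.2 : ℝ) - c.1)))).prod := by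
      rw [cp, Finset.prod]
      congr 1
      refine Multiset.map_congr rfl fun c _ => ?_
      rw [map_neg, sub_neg_eq_add]
    rw [this]
    have h2 : (s.val.map fun c => (Polynomial.X - Polynomial.C (-((c.2 : ℝ) - c.1)))) =
      (s.val.map fun c : ℕ × ℕ => (-((c.2 : ℝ) - c.1))).map
        (fun a => Polynomial.X - Polynomial.C a) := by
      rw [Multiset.map_map]; rfl
    rw [h2, Polynomial.roots_multiset_prod_X_sub_C, Multiset.count_map, Finset.card, Finset.filter]
    simp only
    congr 1
    refine Multiset.filter_congr fun c _ => ?_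
    rw [neg_inj]
    constructor
    · intro h; rw [← h]; push_cast; ring
    · intro h
      have : ((c.2 : ℤ) - c.1 : ℝ) = d := by rw [h]; push_cast; ring
      exact_mod_cast this
  rw [key s, key t, h]

lemma cp_sub {s t : Finset (ℕ × ℕ)} (hs : Low s) (ht : Low t) (h : cp s = cp t) : s ⊆ t := by
  rintro ⟨i, j⟩ hij
  by_contra hnot
  have hd := diag_card_eq h ((j : ℤ) - i)
  have ht1 : (t.filter fun c => (c.2 : ℤ) - c.1 = (j : ℤ) - i).card ≤ i := by
    rw [← Finset.card_range i]
    refine Finset.card_le_card_of_injOn Prod.fst ?_ ?_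
    · rintro ⟨a, b⟩ hab
      simp at hab ⊢
      by_contra hlt
      exact hnot (ht a b i j hab.1 (by omega) (by omega))
    · rintro ⟨a, b⟩ hab ⟨a', b'⟩ hab' heq
      simp at hab hab' heq ⊢
      omega
  have ht2 : (t.filter fun c => (c.2 : ℤ) - c.1 = (j : ℤ) - i).card ≤ j := by
    rw [← Finset.card_range j]
    refine Finset.card_le_card_of_injOn Prod.snd ?_ ?_
    · rintro ⟨a, b⟩ hab
      simp at hab ⊢
      by_contra hlt
      exact hnot (ht a b i j hab.1 (by omega) (by omega))
    · rintro ⟨a, b⟩ hab ⟨a', b'⟩ hab' heq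
      simp at hab hab' heq ⊢
      omega
  have hs1 : min i j + 1 ≤ (s.filter fun c => (c.2 : ℤ) - c.1 = (j : ℤ) - i).card := by
    rw [← Finset.card_range (min i j + 1)]
    refine Finset.card_le_card_of_injOn (fun m => (i - m, j - m)) ?_ ?_
    · intro m hm
      simp at hm ⊢
      exact ⟨hs i j _ _ hij (by omega) (by omega), by omega⟩
    · intro m hm m' hm' heq
      simp at hm hm' heq
      omega
  omega

lemma cp_inj {s t : Finset (ℕ × ℕ)} (hs : Low s) (ht : Low t) (h : cp s = cp t) : s = t :=
  (cp_sub hs ht h).antisymm (cp_sub ht hs h.symm)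


end MVC

namespace MVC

open Equiv Equiv.Perm


lemma sum_pow_row (n : ℕ) {x : ℝ} (hx : x ≠ 0) :
    ∑ π : Perm (Fin n), x ^ numCycles π = ∏ k : Fin n, (x + (k.val : ℝ)) := by
  have hE : ∀ π : Perm (Fin n), u π * Esum (fun _ : Fin n => 0) = Esum (fun _ : Fin n => 0) := by
    intro π
    have : Rset (fun _ : Fin n => 0) = Finset.univ := by ext; simp [mem_Rset]
    rw [Esum, this, Finset.mul_sum]
    simp_rw [← u_mul]
    exact Equiv.sum_comp (Equiv.mulLeft π) (fun g => u g)
  have h := eig hx (Esum (fun _ : Fin n => 0)) (fun k => (k.val : ℝ)) (by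
    intro k
    rw [JM, Finset.sum_mul, Finset.sum_congr rfl fun i _ => hE _, Finset.sum_const, Fin.card_Iio]
    rw [Nat.cast_smul_eq_nsmul])
  rw [Finset.sum_mul, Finset.sum_congr rfl fun π _ => by rw [smul_mul_assoc, hE π],
    ← Finset.sum_smul] at h
  have hone : (Esum (fun _ : Fin n => 0)).coeff 1 = 1 := by
    simp [Esum, MonoidAlgebra.coeff_sum, u_coeff, mem_Rset, Finsupp.finset_sum_apply]
  have := congrArg (fun z => z.coeff 1) h
  simpa [hone] using this

lemma sum_pow_col (n : ℕ) {x : ℝ} (hx : x ≠ 0) :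
    ∑ π : Perm (Fin n), ((sign π : ℤ) : ℝ) * x ^ numCycles π = ∏ k : Fin n, (x + -(k.val : ℝ)) := by
  have hE : ∀ π : Perm (Fin n), u π * Nsum (fun _ : Fin n => 0) =
      ((sign π : ℤ) : ℝ) • Nsum (fun _ : Fin n => 0) := by
    intro π
    have : Rset (fun _ : Fin n => 0) = Finset.univ := by ext; simp [mem_Rset]
    rw [Nsum, this, Finset.mul_sum]
    rw [← Equiv.sum_comp (Equiv.mulLeft π) (fun g => ((sign g : ℤ) : ℝ) • u g), Finset.smul_sum]
    refine Finset.sum_congr rfl fun g _ => ?_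
    rw [mul_smul_comm, ← u_mul, smul_smul]
    congr 1
    rcases Int.units_eq_one_or (sign π) with h | h <;> simp [h]
  have h := eig hx (Nsum (fun _ : Fin n => 0)) (fun k => -(k.val : ℝ)) (by
    intro k
    have : ∀ i ∈ Finset.Iio k, u (swap i k) * Nsum (fun _ : Fin n => 0) = (-1 : ℝ) •
        Nsum (fun _ : Fin n => 0) := by
      intro i hi
      rw [hE, sign_swap (Finset.mem_Iio.1 hi).ne]; simp
    rw [JM, Finset.sum_mul, Finset.sum_congr rfl this, Finset.sum_const, Fin.card_Iio,
      ← Nat.cast_smul_eq_nsmul ℝ, smul_smul]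
    simp)
  rw [Finset.sum_mul, Finset.sum_congr rfl fun π _ => by rw [smul_mul_assoc, hE π, smul_smul],
    ← Finset.sum_smul] at h
  have hone : (Nsum (fun _ : Fin n => 0)).coeff 1 = 1 := by
    simp [Nsum, MonoidAlgebra.coeff_sum, u_coeff, mem_Rset, Finsupp.finset_sum_apply]
  have := congrArg (fun z => z.coeff 1) h
  simpa [hone, mul_comm] using this

def rowD (n : ℕ) : Finset (ℕ × ℕ) := (Finset.range n).image fun j => (0, j)
def colD (n : ℕ) : Finset (ℕ × ℕ) := (Finset.range n).image fun j => (j, 0)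

lemma mem_rowD {n : ℕ} {c : ℕ × ℕ} : c ∈ rowD n ↔ c.1 = 0 ∧ c.2 < n := by
  rcases c with ⟨a, b⟩; simp [rowD]; omega
lemma mem_colD {n : ℕ} {c : ℕ × ℕ} : c ∈ colD n ↔ c.2 = 0 ∧ c.1 < n := by
  rcases c with ⟨a, b⟩; simp [colD]; omega

lemma rowD_mem (n : ℕ) : rowD n ∈ YD n := by
  rw [mem_YD]
  refine ⟨by rw [rowD, Finset.card_image_of_injective _ (fun i j h => (Prod.mk.inj h).2)]; simp, ?_⟩
  intro a b a' b' h ha hb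
  rw [mem_rowD] at *; simp at *; omega
lemma colD_mem (n : ℕ) : colD n ∈ YD n := by
  rw [mem_YD]
  refine ⟨by rw [colD, Finset.card_image_of_injective _ (fun i j h => (Prod.mk.inj h).1)]; simp, ?_⟩
  intro a b a' b' h ha hb
  rw [mem_colD] at *; simp at *; omega

open Polynomial in
lemma poly_ext_ne {p q : ℝ[X]} (t : Finset ℝ) (h : ∀ x, x ∉ t → p.eval x = q.eval x) : p = q := by
  apply Polynomial.eq_of_infinite_eval_eq
  refine Set.Infinite.mono (s := (↑t : Set ℝ)ᶜ) ?_ t.finite_toSet.infinite_compl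
  intro x hx; exact h x (by simpa using hx)

open Polynomial in
lemma cp_rowD (n : ℕ) : cp (rowD n) = ∑ π : Perm (Fin n), X ^ numCycles π := by
  refine poly_ext_ne {0} fun x hx => ?_
  rw [eval_finset_sum]
  simp only [eval_pow, eval_X]
  rw [sum_pow_row n (by simpa using hx), cp, rowD,
    Finset.prod_image (fun i _ j _ h => (Prod.mk.inj h).2), eval_prod, Finset.prod_range]
  simp

open Polynomial in
lemma cp_colD (n : ℕ) : cp (colD n) =
    ∑ π : Perm (Fin n), C ((sign π : ℤ) : ℝ) * X ^ numCycles π := by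
  refine poly_ext_ne {0} fun x hx => ?_
  rw [eval_finset_sum]
  simp only [eval_pow, eval_X, eval_mul, eval_C]
  rw [sum_pow_col n (by simpa using hx), cp, colD,
    Finset.prod_image (fun i _ j _ h => (Prod.mk.inj h).1), eval_prod, Finset.prod_range]
  simp

lemma exists_enum {n : ℕ} {s : Finset (ℕ × ℕ)} (hs : s ∈ YD n) :
    ∃ row col : Fin n → ℕ, (∀ i j, row i = row j → col i = col j → i = j) ∧
      (∀ i k, i < k ↔ row i < row k ∨ (row i = row k ∧ col i < col k)) ∧
      (∀ k a b, a ≤ row k → b ≤ col k → ∃ i, row i = a ∧ col i = b) ∧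
      ∀ x : ℝ, ∏ k, (x + ((col k : ℝ) - row k)) = (cp s).eval x := by
  rw [mem_YD] at hs
  obtain ⟨hc, hl⟩ := hs
  let S : Finset (ℕ ×ₗ ℕ) := s.map toLex.toEmbedding
  have hS : S.card = n := by simp [S, hc]
  let e := S.orderEmbOfFin hS
  have hmem : ∀ k, ofLex (e k) ∈ s := by
    intro k
    have := S.orderEmbOfFin_mem hS k
    simp only [S, Finset.mem_map] at this
    obtain ⟨c, hc, h⟩ := this
    change ofLex (S.orderEmbOfFin hS k) ∈ s
    rw [← h]; exact hc
  have hsurj : ∀ c ∈ s, ∃ k, ofLex (e k) = c := by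
    intro c hc
    have : toLex c ∈ Set.range (S.orderEmbOfFin hS) := by
      rw [Finset.range_orderEmbOfFin]; simp [S, hc]
    obtain ⟨k, hk⟩ := this
    exact ⟨k, by change ofLex (S.orderEmbOfFin hS k) = c; rw [hk]; rfl⟩
  have hinj : ∀ i j, ofLex (e i) = ofLex (e j) → i = j := by
    intro i j h
    exact e.injective (ofLex.injective h)
  refine ⟨fun k => (ofLex (e k)).1, fun k => (ofLex (e k)).2, ?_, ?_, ?_, ?_⟩
  · intro i j h1 h2; exact hinj i j (Prod.ext h1 h2)
  · intro i k
    rw [← e.lt_iff_lt, Prod.Lex.lt_iff]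
  · intro k a b ha hb
    obtain ⟨i, hi⟩ := hsurj (a, b) (hl _ _ a b (hmem k) ha hb)
    exact ⟨i, by simp only [hi], by simp only [hi]⟩
  · intro x
    rw [cp, Polynomial.eval_prod]
    refine Finset.prod_bij (fun k _ => ofLex (e k)) (fun k _ => hmem k) (fun i _ j _ h => hinj i j h)
      (fun c hc => ?_) (fun k _ => by simp)
    obtain ⟨k, hk⟩ := hsurj c hc
    exact ⟨k, Finset.mem_univ _, hk⟩

open Polynomial in
theorem comm_formula (n : ℕ) : ∑ σ : Perm (Fin n), ∑ τ : Perm (Fin n),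
    (X : ℝ[X]) ^ numCycles (σ * τ * σ⁻¹ * τ⁻¹) = C (n.factorial : ℝ) * ∑ s ∈ YD n, cp s := by
  classical
  refine poly_ext_ne ({0} ∪ (YD n).biUnion fun s => (YD n).biUnion fun t =>
    (cp s - cp t).roots.toFinset) fun x hx => ?_
  simp only [Finset.mem_union, Finset.mem_singleton, Finset.mem_biUnion, not_or, not_exists,
    not_and] at hx
  obtain ⟨hx0, hx⟩ := hx
  have : ∀ s : ↥(YD n), _ := fun s => exists_enum s.2
  choose row col H1 H2 H3 H4 using this
  haveI : Nonempty ↥(YD n) := ⟨⟨rowD n, rowD_mem n⟩⟩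
  have := trace_formula hx0 row col H1 H2 H3 (by
    rw [Fintype.card_coe]; convert card_partition_le n using 2 <;> simp) (by
    rintro ⟨s, hs⟩ ⟨t, ht⟩ h
    simp only [H4] at h
    rw [Subtype.mk.injEq]
    refine cp_inj (mem_YD.1 hs).2 (mem_YD.1 ht).2 ?_
    by_contra hne
    refine hx s hs t ht ?_
    rw [Multiset.mem_toFinset, mem_roots (sub_ne_zero.2 hne)]
    simp [IsRoot, h])
  simp only [H4] at this
  simp only [eval_finset_sum, eval_mul, eval_C, eval_pow, eval_X]
  rw [this, Finset.sum_coe_sort (YD n) (fun s => (cp s).eval x)]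


end MVC

namespace MVC

open Equiv Equiv.Perm


lemma fact_mul_le (a b : ℕ) : (a + 1).factorial * (b + 1).factorial ≤ (a + b + 1).factorial := by
  induction b with
  | zero => simp
  | succ b ih =>
    rw [Nat.factorial_succ (b + 1), show a + (b + 1) + 1 = (a + b + 1) + 1 by ring,
      Nat.factorial_succ (a + b + 1)]
    calc (a + 1).factorial * ((b + 1 + 1) * (b + 1).factorial)
        = (b + 1 + 1) * ((a + 1).factorial * (b + 1).factorial) := by ring
      _ ≤ _ := Nat.mul_le_mul (by omega) ih

lemma sum_fact_le (N : ℕ) :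
    ∑ c ∈ Finset.HasAntidiagonal.antidiagonal N, c.1.factorial * c.2.factorial ≤ 4 * N.factorial := by
  rw [Finset.Nat.sum_antidiagonal_eq_sum_range_succ (fun a b => a.factorial * b.factorial)]
  cases N with
  | zero => simp
  | succ M =>
    rw [Finset.sum_range_succ, Finset.sum_range_succ']
    have : ∑ k ∈ Finset.range M, (k + 1).factorial * (M + 1 - (k + 1)).factorial ≤
        ∑ k ∈ Finset.range M, M.factorial := by
      refine Finset.sum_le_sum fun k hk => ?_
      rw [Finset.mem_range] at hk
      have := fact_mul_le k (M - k - 1)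
      rwa [show k + (M - k - 1) + 1 = M by omega, show M - k - 1 + 1 = M + 1 - (k + 1) by omega]
        at this
    rw [Finset.sum_const, Finset.card_range, smul_eq_mul] at this
    have h2 : M * M.factorial ≤ (M + 1).factorial := by
      rw [Nat.factorial_succ]; exact Nat.mul_le_mul (by omega) le_rfl
    simp only [Nat.factorial_zero, tsub_zero, tsub_self, mul_one, one_mul]
    omega

lemma tuple_bound (K N : ℕ) :
    ∑ l ∈ Finset.finsuppAntidiag (Finset.range K) N, ∏ i ∈ Finset.range K, (l i).factorial
      ≤ 4 ^ K * N.factorial := by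
  have h := PowerSeries.coeff_prod (R := ℕ) (fun _ : ℕ => PowerSeries.mk fun m => m.factorial) N
    (Finset.range K)
  simp only [PowerSeries.coeff_mk] at h
  rw [← h, Finset.prod_const, Finset.card_range]
  clear h
  induction K generalizing N with
  | zero =>
    rw [pow_zero, pow_zero, one_mul, PowerSeries.coeff_one]
    split_ifs
    · exact Nat.factorial_pos _
    · exact Nat.zero_le _
  | succ K ih =>
    rw [pow_succ, PowerSeries.coeff_mul]
    simp only [PowerSeries.coeff_mk]
    calc _ ≤ ∑ p ∈ Finset.HasAntidiagonal.antidiagonal N, 4 ^ K * (p.1.factorial * p.2.factorial) := by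
          refine Finset.sum_le_sum fun p _ => ?_
          rw [← mul_assoc]
          exact Nat.mul_le_mul (ih p.1) le_rfl
      _ ≤ 4 ^ K * (4 * N.factorial) := by
          rw [← Finset.mul_sum]; exact Nat.mul_le_mul le_rfl (sum_fact_le N)
      _ = _ := by ring

open Polynomial in
lemma coeff_prod_bound {ι : Type*} (t : Finset ι) (a : ι → ℝ) (ha : ∀ b ∈ t, a b ≠ 0) (m : ℕ) :
    |(∏ b ∈ t, (X + C (a b))).coeff m| ≤ (∏ b ∈ t, |a b|) * (∑ b ∈ t, 1 / |a b|) ^ m := by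
  classical
  induction t using Finset.induction_on generalizing m with
  | empty =>
    cases m with
    | zero => simp
    | succ m => simp [coeff_one]
  | insert b t hb ih =>
    have ih := fun m => ih (fun b hb => ha b (Finset.mem_insert_of_mem hb)) m
    have hab := ha b (Finset.mem_insert_self b t)
    have hab' : 0 < |a b| := abs_pos.2 hab
    rw [Finset.prod_insert hb, Finset.prod_insert hb, Finset.sum_insert hb]
    set Q := ∏ b ∈ t, (X + C (a b))
    set P := ∏ b ∈ t, |a b|
    set T := ∑ b ∈ t, 1 / |a b|
    have hP : 0 ≤ P := Finset.prod_nonneg fun _ _ => abs_nonneg _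
    have hT : 0 ≤ T := Finset.sum_nonneg fun _ _ => by positivity
    cases m with
    | zero =>
      rw [add_mul, coeff_add, coeff_C_mul, coeff_X_mul_zero, zero_add, abs_mul, pow_zero, mul_one]
      have := ih 0
      rw [pow_zero, mul_one] at this
      gcongr
    | succ m =>
      rw [add_mul, coeff_add, coeff_C_mul, coeff_X_mul]
      calc |Q.coeff m + a b * Q.coeff (m + 1)| ≤ |Q.coeff m| + |a b| * |Q.coeff (m + 1)| := by
            rw [← abs_mul]; exact abs_add_le _ _
        _ ≤ P * T ^ m + |a b| * (P * T ^ (m + 1)) := by gcongr <;> exact ih _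
        _ = |a b| * P * (T ^ m * (1 / |a b| + T)) := by field_simp; ring
        _ ≤ |a b| * P * ((1 / |a b| + T) ^ m * (1 / |a b| + T)) := by
            have : T ≤ 1 / |a b| + T := by linarith [show 0 < 1 / |a b| by positivity]
            gcongr
        _ = _ := by rw [pow_succ]

lemma newton (p : Polynomial ℝ) : ∃ b : ℕ → ℝ, ∀ k : ℕ, p.eval (k : ℝ) =
    ∑ j ∈ Finset.range (p.natDegree + 1), b j * (k.choose j : ℝ) := by
  refine ⟨fun j => (fwdDiff (1:ℝ))^[j] (fun x => p.eval x) 0, fun k => ?_⟩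
  have h := shift_eq_sum_fwdDiff_iter (1:ℝ) (fun x => p.eval x) k 0
  simp only [zero_add, nsmul_eq_mul, mul_one] at h
  rw [h]
  set N := max k p.natDegree
  have e1 : ∑ j ∈ Finset.range (k + 1), (k.choose j : ℝ) * (fwdDiff (1:ℝ))^[j] (fun x => p.eval x) 0
    = ∑ j ∈ Finset.range (N + 1), (k.choose j : ℝ) * (fwdDiff (1:ℝ))^[j] (fun x => p.eval x) 0 := by
    refine Finset.sum_subset (Finset.range_mono (by omega)) fun j _ hj => ?_
    rw [Finset.mem_range] at hj
    rw [Nat.choose_eq_zero_of_lt (by omega)]; simp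
  rw [e1]
  symm
  rw [Finset.sum_congr rfl fun j _ => mul_comm _ _]
  refine Finset.sum_subset (Finset.range_mono (by omega)) fun j _ hj => ?_
  rw [Finset.mem_range] at hj
  rw [Polynomial.fwdDiff_iter_eq_zero_of_degree_lt (by omega)]; simp


end MVC

namespace MVC

open Equiv Equiv.Perm


/-- cells off the subdiagonal -/
def off (s : Finset (ℕ × ℕ)) : Finset (ℕ × ℕ) := s.filter fun c => c.1 ≠ c.2 + 1
def dd (s : Finset (ℕ × ℕ)) : ℕ := (s.filter fun c => c.1 = c.2 + 1).card
def gk (c : ℕ × ℕ) : ℕ := if c.1 ≤ c.2 then 2 * c.1 else 2 * c.2 + 1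
def vv (c : ℕ × ℕ) : ℕ := if c.1 ≤ c.2 then c.2 - c.1 + 1 else c.1 - c.2 - 1
def xx (s : Finset (ℕ × ℕ)) (k : ℕ) : ℕ := ((off s).filter fun c => gk c = k).card

lemma vv_abs {c : ℕ × ℕ} (_h : c.1 ≠ c.2 + 1) : |1 + ((c.2 : ℝ) - c.1)| = vv c := by
  unfold vv
  split_ifs with h1
  · rw [abs_of_nonneg]
    · push_cast [Nat.cast_sub h1]; ring
    · have : (c.1 : ℝ) ≤ c.2 := by exact_mod_cast h1
      linarith
  · have h2 : c.2 + 1 ≤ c.1 := by omega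
    rw [abs_of_nonpos]
    · rw [Nat.sub_sub, Nat.cast_sub h2]; push_cast; ring
    · have : (c.2 : ℝ) + 1 ≤ c.1 := by exact_mod_cast h2
      linarith

lemma vv_pos {c : ℕ × ℕ} (h : c.1 ≠ c.2 + 1) : 1 ≤ vv c := by
  unfold vv; split_ifs <;> omega

lemma dd_iff {s : Finset (ℕ × ℕ)} (hs : Low s) (j : ℕ) : (j + 1, j) ∈ s ↔ j + 1 ≤ dd s := by
  constructor
  · intro h
    rw [← Finset.card_range (j + 1)]
    refine Finset.card_le_card_of_injOn (fun m => (m + 1, m)) ?_ ?_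
    · intro m hm
      simp at hm ⊢
      exact hs _ _ _ _ h (by omega) (by omega)
    · intro m _ m' _ h
      simpa using h
  · intro h
    by_contra hn
    have : dd s ≤ j := by
      rw [← Finset.card_range j]
      refine Finset.card_le_card_of_injOn Prod.snd ?_ ?_
      · rintro ⟨a, b⟩ hab
        simp at hab ⊢
        by_contra hlt
        exact hn (hs a b _ _ hab.1 (by omega) (by omega))
      · rintro ⟨a, b⟩ hab ⟨a', b'⟩ hab' heq
        simp at hab hab' heq ⊢
        omega
    omega

lemma gk_lt {s : Finset (ℕ × ℕ)} (hs : Low s) {c : ℕ × ℕ} (hc : c ∈ off s) :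
    gk c < 2 * dd s + 1 := by
  rcases c with ⟨i, j⟩
  simp only [off, Finset.mem_filter] at hc
  unfold gk
  simp only
  split_ifs with h
  · cases i with
    | zero => omega
    | succ i =>
      have := (dd_iff hs i).1 (hs _ _ _ _ hc.1 (by omega) (by omega))
      omega
  · have := (dd_iff hs j).1 (hs _ _ _ _ hc.1 (by omega) (by omega))
    omega

lemma down_eq (A : Finset ℕ) (h1 : ∀ m ∈ A, 1 ≤ m) (h2 : ∀ m ∈ A, ∀ m', 1 ≤ m' → m' ≤ m → m' ∈ A) :
    A = Finset.Icc 1 A.card := by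
  refine Finset.eq_of_subset_of_card_le ?_ (by simp)
  intro m hm
  rw [Finset.mem_Icc]
  refine ⟨h1 m hm, ?_⟩
  have : Finset.Icc 1 m ⊆ A := by
    intro m' hm'; rw [Finset.mem_Icc] at hm'; exact h2 m hm m' hm'.1 hm'.2
  simpa using Finset.card_le_card this

lemma vv_inj {s : Finset (ℕ × ℕ)} (k : ℕ) :
    Set.InjOn vv ((off s).filter fun c => gk c = k : Finset (ℕ × ℕ)) := by
  rintro ⟨a, b⟩ h ⟨a', b'⟩ h' he
  simp only [off, Finset.coe_filter, Finset.mem_filter, Set.mem_ofPred_eq] at h h'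
  have h1 := h.2
  have h2 := h'.2
  have h3 := h.1.2
  have h4 := h'.1.2
  unfold gk at h1 h2
  unfold vv at he
  simp only at h1 h2 h3 h4 he
  rw [Prod.mk.injEq]
  split_ifs at h1 h2 he <;> omega

lemma fiber_image {s : Finset (ℕ × ℕ)} (hs : Low s) (k : ℕ) :
    ((off s).filter fun c => gk c = k).image vv = Finset.Icc 1 (xx s k) := by
  have := down_eq (((off s).filter fun c => gk c = k).image vv) ?_ ?_
  · rwa [Finset.card_image_of_injOn (vv_inj k)] at this
  · intro m hm
    simp only [off, Finset.mem_image, Finset.mem_filter] at hm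
    obtain ⟨c, hc, rfl⟩ := hm
    exact vv_pos hc.1.2
  · intro m hm m' h1 h2
    simp only [off, Finset.mem_image, Finset.mem_filter] at hm ⊢
    obtain ⟨⟨i, j⟩, ⟨⟨hc1, hc2⟩, hc3⟩, rfl⟩ := hm
    simp only at hc2
    by_cases h : i ≤ j
    · have e : vv (i, j) = j - i + 1 := by unfold vv; simp [h]
      rw [e] at h2
      refine ⟨(i, i + m' - 1), ⟨⟨hs _ _ _ _ hc1 le_rfl (by omega), by simp only; omega⟩, ?_⟩, ?_⟩
      · unfold gk at hc3 ⊢; simp only at hc3 ⊢; rw [if_pos h] at hc3; rw [if_pos (by omega)]; omega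
      · unfold vv; simp only; rw [if_pos (by omega)]; omega
    · have e : vv (i, j) = i - j - 1 := by unfold vv; simp [h]
      rw [e] at h2
      refine ⟨(j + m' + 1, j), ⟨⟨hs _ _ _ _ hc1 (by omega) le_rfl, by simp only; omega⟩, ?_⟩, ?_⟩
      · unfold gk at hc3 ⊢; simp only at hc3 ⊢; rw [if_neg h] at hc3; rw [if_neg (by omega)]; omega
      · unfold vv; simp only; rw [if_neg (by omega)]; omega

lemma mem_iff_xx {s : Finset (ℕ × ℕ)} (hs : Low s) {c : ℕ × ℕ} (h : c.1 ≠ c.2 + 1) :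
    c ∈ s ↔ vv c ≤ xx s (gk c) := by
  constructor
  · intro hc
    have : vv c ∈ ((off s).filter fun c' => gk c' = gk c).image vv :=
      Finset.mem_image_of_mem _ (by simp [off, hc, h])
    rw [fiber_image hs, Finset.mem_Icc] at this
    exact this.2
  · intro hc
    have : vv c ∈ ((off s).filter fun c' => gk c' = gk c).image vv := by
      rw [fiber_image hs, Finset.mem_Icc]; exact ⟨vv_pos h, hc⟩
    simp only [off, Finset.mem_image, Finset.mem_filter] at this
    obtain ⟨⟨a, b⟩, ⟨⟨h1, h2⟩, h3⟩, h4⟩ := this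
    have : (a, b) = c := by
      rcases c with ⟨a', b'⟩
      unfold gk at h3
      unfold vv at h4
      simp only at h h2 h3 h4
      rw [Prod.mk.injEq]
      split_ifs at h3 h4 <;> omega
    rwa [← this]

lemma det_of {s t : Finset (ℕ × ℕ)} (hs : Low s) (ht : Low t) (hd : dd s = dd t)
    (hx : ∀ k, xx s k = xx t k) : s = t := by
  ext ⟨i, j⟩
  by_cases h : i = j + 1
  · subst h; rw [dd_iff hs, dd_iff ht, hd]
  · rw [mem_iff_xx hs (by simpa using h), mem_iff_xx ht (by simpa using h), hx]

lemma xx_zero {s : Finset (ℕ × ℕ)} (hs : Low s) {ℓ : ℕ} (hd : dd s ≤ ℓ) {k : ℕ}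
    (hk : 2 * ℓ + 1 ≤ k) : xx s k = 0 := by
  rw [xx, Finset.card_eq_zero, Finset.filter_eq_empty_iff]
  intro c hc h
  have := gk_lt hs hc
  omega

def WW (s : Finset (ℕ × ℕ)) : ℕ := ∏ c ∈ off s, vv c

lemma WW_eq {s : Finset (ℕ × ℕ)} (hs : Low s) {ℓ : ℕ} (hd : dd s ≤ ℓ) :
    WW s = ∏ k ∈ Finset.range (2 * ℓ + 1), (xx s k).factorial := by
  rw [WW, ← Finset.prod_fiberwise_of_maps_to (g := gk) (t := Finset.range (2 * ℓ + 1))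
    (fun c hc => by have := gk_lt hs hc; rw [Finset.mem_range]; omega)]
  refine Finset.prod_congr rfl fun k _ => ?_
  rw [← Finset.prod_Ico_id_eq_factorial, Finset.Ico_add_one_right_eq_Icc, ← fiber_image hs, Finset.prod_image (vv_inj k)]

lemma TT_le {n : ℕ} {s : Finset (ℕ × ℕ)} (hn : 1 ≤ n) (hc : s.card = n) (hs : Low s)
    {ℓ : ℕ} (hd : dd s ≤ ℓ) :
    ∑ c ∈ off s, 1 / (vv c : ℝ) ≤ (2 * ℓ + 1) * (1 + Real.log n) := by
  rw [← Finset.sum_fiberwise_of_maps_to (g := gk) (t := Finset.range (2 * ℓ + 1))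
    (fun c hc => by have := gk_lt hs hc; rw [Finset.mem_range]; omega)]
  have : ∀ k ∈ Finset.range (2 * ℓ + 1), ∑ c ∈ (off s).filter (fun c => gk c = k), 1 / (vv c : ℝ)
      ≤ 1 + Real.log n := by
    intro k _
    rw [← Finset.sum_image (s := (off s).filter (fun c => gk c = k)) (g := vv)
      (f := fun m : ℕ => 1 / (m : ℝ)) (vv_inj k), fiber_image hs]
    have hxn : xx s k ≤ n := by
      rw [← hc]; exact Finset.card_le_card ((Finset.filter_subset _ _).trans (Finset.filter_subset _ _))
    refine le_trans ?_ (harmonic_le_one_add_log n)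
    rw [harmonic_eq_sum_Icc]
    push_cast
    simp only [one_div]
    exact Finset.sum_le_sum_of_subset_of_nonneg (Finset.Icc_subset_Icc le_rfl hxn)
      (fun _ _ _ => by positivity)
  refine (Finset.sum_le_sum this).trans ?_
  rw [Finset.sum_const, Finset.card_range, nsmul_eq_mul]
  push_cast
  exact le_rfl

lemma sum_xx {n : ℕ} {s : Finset (ℕ × ℕ)} (hc : s.card = n) (hs : Low s) {ℓ : ℕ} (hd : dd s ≤ ℓ) :
    ∑ k ∈ Finset.range (2 * ℓ + 1), xx s k + dd s = n := by
  have h1 : (off s).card = ∑ k ∈ Finset.range (2 * ℓ + 1), xx s k :=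
    Finset.card_eq_sum_card_fiberwise
      (fun c hc => by
        have := gk_lt hs hc; simp only [Finset.coe_range, Set.mem_Iio]; omega)
  have h2 := Finset.card_filter_add_card_filter_not (s := s) (fun c => c.1 = c.2 + 1)
  rw [← h1, ← hc, ← h2, add_comm]
  rfl

noncomputable def phi (ℓ : ℕ) (s : Finset (ℕ × ℕ)) : ℕ →₀ ℕ :=
  Finsupp.onFinset (Finset.range (2 * ℓ + 1)) (fun k => if k < 2 * ℓ + 1 then xx s k else 0)
    (fun k hk => by
      rw [Finset.mem_range]; by_contra h; simp [h] at hk)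

lemma phi_apply (ℓ : ℕ) (s : Finset (ℕ × ℕ)) (k : ℕ) :
    phi ℓ s k = if k < 2 * ℓ + 1 then xx s k else 0 := rfl

lemma sum_WW_d (n ℓ d : ℕ) (hd : d ≤ ℓ) :
    ∑ s ∈ (YD n).filter (fun s => dd s = d), WW s ≤ 4 ^ (2 * ℓ + 1) * (n - d).factorial := by
  refine le_trans ?_ (tuple_bound (2 * ℓ + 1) (n - d))
  have hinj : Set.InjOn (phi ℓ) ((YD n).filter (fun s => dd s = d) : Finset _) := by
    intro s hs t ht h
    simp only [Finset.coe_filter, Set.mem_ofPred_eq, mem_YD] at hs ht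
    refine det_of hs.1.2 ht.1.2 (hs.2.trans ht.2.symm) fun k => ?_
    by_cases hk : k < 2 * ℓ + 1
    · have := DFunLike.congr_fun h k
      simpa [phi_apply, hk] using this
    · rw [xx_zero hs.1.2 (hs.2.le.trans hd) (by omega), xx_zero ht.1.2 (ht.2.le.trans hd) (by omega)]
  have : ∀ s ∈ (YD n).filter (fun s => dd s = d), WW s =
      ∏ k ∈ Finset.range (2 * ℓ + 1), (phi ℓ s k).factorial := by
    intro s hs
    simp only [Finset.mem_filter, mem_YD] at hs
    rw [WW_eq hs.1.2 (hs.2.le.trans hd)]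
    refine Finset.prod_congr rfl fun k hk => ?_
    rw [phi_apply, if_pos (Finset.mem_range.1 hk)]
  classical
  rw [Finset.sum_congr rfl this, ← Finset.sum_image (g := phi ℓ)
    (f := fun l => ∏ k ∈ Finset.range (2 * ℓ + 1), (l k).factorial) hinj]
  refine Finset.sum_le_sum_of_subset ?_
  intro l hl
  simp only [Finset.mem_image, Finset.mem_filter, mem_YD] at hl
  obtain ⟨s, hs, rfl⟩ := hl
  rw [Finset.mem_finsuppAntidiag]
  constructor
  · have := sum_xx hs.1.1 hs.1.2 (hs.2.le.trans hd)
    have hsum : ∑ k ∈ Finset.range (2 * ℓ + 1), phi ℓ s k =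
        ∑ k ∈ Finset.range (2 * ℓ + 1), xx s k := Finset.sum_congr rfl fun k hk => by
      rw [phi_apply, if_pos (Finset.mem_range.1 hk)]
    have hd2 := hs.2
    refine hsum.trans ?_
    rw [hd2] at this
    exact Nat.eq_sub_of_add_eq this
  · exact Finsupp.support_onFinset_subset

lemma sum_WW (n ℓ : ℕ) :
    ∑ s ∈ (YD n).filter (fun s => 1 ≤ dd s ∧ dd s ≤ ℓ), WW s
      ≤ ℓ * (4 ^ (2 * ℓ + 1) * (n - 1).factorial) := by
  rw [← Finset.sum_fiberwise_of_maps_to (g := dd) (t := Finset.Icc 1 ℓ)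
    (fun s hs => by rw [Finset.mem_Icc]; exact (Finset.mem_filter.1 hs).2)]
  calc _ ≤ ∑ d ∈ Finset.Icc 1 ℓ, 4 ^ (2 * ℓ + 1) * (n - 1).factorial := by
        refine Finset.sum_le_sum fun d hd => ?_
        rw [Finset.mem_Icc] at hd
        refine le_trans ?_ ((sum_WW_d n ℓ d hd.2).trans
          (Nat.mul_le_mul le_rfl (Nat.factorial_le (by omega))))
        refine Finset.sum_le_sum_of_subset ?_
        intro s hs
        simp only [Finset.mem_filter] at hs ⊢
        exact ⟨hs.1.1, hs.2⟩
    _ = _ := by simp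

lemma dd_zero {n : ℕ} {s : Finset (ℕ × ℕ)} (hs : s ∈ YD n) (h : dd s = 0) : s = rowD n := by
  have hs' := mem_YD.1 hs
  refine Finset.eq_of_subset_of_card_le ?_ ?_
  · rintro ⟨a, b⟩ hab
    have hb := low_bound hs'.1 hs'.2 hab
    simp only [Finset.mem_product, Finset.mem_range] at hb
    rw [mem_rowD]
    refine ⟨?_, hb.2⟩
    by_contra ha
    simp only at ha
    have := (dd_iff hs'.2 0).1 (hs'.2 a b _ _ hab (by omega) (by omega))
    omega
  · rw [hs'.1, (mem_YD.1 (rowD_mem n)).1]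

open Polynomial in
lemma taylor_cp (s : Finset (ℕ × ℕ)) : taylor 1 (cp s) =
    X ^ dd s * ∏ c ∈ off s, (X + C (1 + ((c.2 : ℝ) - c.1))) := by
  have h1 : taylor 1 (cp s) = ∏ c ∈ s, (X + C (1 + ((c.2 : ℝ) - c.1))) := by
    rw [taylor_apply, cp, Polynomial.prod_comp]
    refine Finset.prod_congr rfl fun c _ => ?_
    rw [add_comp, X_comp, C_comp, C_add, add_assoc]
  rw [h1, ← Finset.prod_filter_mul_prod_filter_not s (fun c => c.1 = c.2 + 1)]
  congr 1
  rw [dd, ← Finset.prod_const]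
  refine Finset.prod_congr rfl fun c hc => ?_
  rw [(Finset.mem_filter.1 hc).2]
  have : 1 + ((c.2 : ℝ) - ((c.2 + 1 : ℕ) : ℝ)) = 0 := by push_cast; ring
  rw [this]; simp

open Polynomial in
lemma coeff_taylor_bound {n : ℕ} {s : Finset (ℕ × ℕ)} (hn : 1 ≤ n) (hs : s ∈ YD n) {ℓ j : ℕ}
    (hj : j ≤ ℓ) :
    |(taylor 1 (cp s)).coeff j| ≤ if dd s ≤ ℓ then
      (WW s : ℝ) * ((2 * ℓ + 1) * (1 + Real.log n)) ^ ℓ else 0 := by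
  rw [mem_YD] at hs
  have hlog : 0 ≤ Real.log n := Real.log_natCast_nonneg n
  have hL : (1 : ℝ) ≤ (2 * ℓ + 1) * (1 + Real.log n) := by
    have : (0 : ℝ) ≤ ℓ := Nat.cast_nonneg _
    nlinarith
  rw [taylor_cp, coeff_X_pow_mul']
  by_cases hd : dd s ≤ ℓ
  · rw [if_pos hd]
    split_ifs with h
    · have hne : ∀ c ∈ off s, (1 + ((c.2 : ℝ) - c.1)) ≠ 0 := by
        intro c hc h0
        have h1 := (Finset.mem_filter.1 hc).2
        have h2 := vv_abs h1
        have h3 := vv_pos h1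
        rw [h0, abs_zero] at h2
        have : vv c = 0 := by exact_mod_cast h2.symm
        omega
      refine (coeff_prod_bound (off s) (fun c => 1 + ((c.2 : ℝ) - c.1)) hne _).trans ?_
      have hv : ∀ c ∈ off s, |1 + ((c.2 : ℝ) - c.1)| = vv c := fun c hc =>
        vv_abs (Finset.mem_filter.1 hc).2
      have hv1 : ∏ c ∈ off s, |1 + ((c.2 : ℝ) - c.1)| = ∏ c ∈ off s, (vv c : ℝ) :=
        Finset.prod_congr rfl hv
      have hv2 : ∑ c ∈ off s, 1 / |1 + ((c.2 : ℝ) - c.1)| = ∑ c ∈ off s, 1 / (vv c : ℝ) :=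
        Finset.sum_congr rfl fun c hc => by rw [hv c hc]
      rw [hv1, hv2, WW]
      push_cast
      have hT := TT_le hn hs.1 hs.2 hd
      have hT0 : 0 ≤ ∑ c ∈ off s, 1 / (vv c : ℝ) := Finset.sum_nonneg fun _ _ => by positivity
      refine mul_le_mul_of_nonneg_left ?_ (Finset.prod_nonneg fun _ _ => by positivity)
      exact (pow_le_pow_left₀ hT0 hT _).trans (pow_le_pow_right₀ hL (by omega))
    · rw [abs_zero]; positivity
  · rw [if_neg hd, if_neg (by omega), abs_zero]


end MVC

namespace MVC

open Equiv Equiv.Perm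


open Polynomial in
noncomputable def DD (ℓ : ℕ) (b : ℕ → ℝ) : ℝ[X] →ₗ[ℝ] ℝ :=
  ∑ j ∈ Finset.range (ℓ + 1), b j • (lcoeff ℝ j ∘ₗ taylor 1)

open Polynomial in
lemma DD_apply (ℓ : ℕ) (b : ℕ → ℝ) (q : ℝ[X]) :
    DD ℓ b q = ∑ j ∈ Finset.range (ℓ + 1), b j * (taylor 1 q).coeff j := by
  simp [DD]

open Polynomial in
lemma DD_X_pow {p : ℝ[X]} {ℓ : ℕ} {b : ℕ → ℝ} (hb : ∀ k : ℕ, p.eval (k : ℝ) =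
    ∑ j ∈ Finset.range (ℓ + 1), b j * (k.choose j : ℝ)) (k : ℕ) :
    DD ℓ b (X ^ k) = p.eval (k : ℝ) := by
  rw [DD_apply, hb]
  refine Finset.sum_congr rfl fun j _ => ?_
  rw [taylor_X_pow, coeff_X_add_C_pow]; simp

lemma DD_bound {n : ℕ} (hn : 1 ≤ n) (ℓ : ℕ) (b : ℕ → ℝ) {s : Finset (ℕ × ℕ)} (hs : s ∈ YD n) :
    |DD ℓ b (cp s)| ≤ if dd s ≤ ℓ then (∑ j ∈ Finset.range (ℓ + 1), |b j|) *
      ((WW s : ℝ) * ((2 * ℓ + 1) * (1 + Real.log n)) ^ ℓ) else 0 := by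
  rw [DD_apply]
  refine (Finset.abs_sum_le_sum_abs _ _).trans ?_
  have : ∀ j ∈ Finset.range (ℓ + 1), |b j * (Polynomial.taylor 1 (cp s)).coeff j| ≤
      |b j| * (if dd s ≤ ℓ then
      (WW s : ℝ) * ((2 * ℓ + 1) * (1 + Real.log n)) ^ ℓ else 0) := by
    intro j hj
    rw [abs_mul]
    exact mul_le_mul_of_nonneg_left
      (coeff_taylor_bound hn hs (by rw [Finset.mem_range] at hj; omega)) (abs_nonneg _)
  refine (Finset.sum_le_sum this).trans ?_
  rw [← Finset.sum_mul]
  split_ifs <;> simp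

lemma alt_sum {n : ℕ} (f : Perm (Fin n) → ℝ) :
    2 * ∑ η : alternatingGroup (Fin n), f η = ∑ π : Perm (Fin n), (f π + ((sign π : ℤ) : ℝ) * f π) := by
  classical
  have h1 : ∑ η : alternatingGroup (Fin n), f η =
      ∑ π ∈ Finset.univ.filter (fun π : Perm (Fin n) => π ∈ alternatingGroup (Fin n)), f π := by
    rw [Finset.sum_subtype (p := fun π => π ∈ alternatingGroup (Fin n))]
    intro x; simp
  rw [h1, Finset.sum_filter, Finset.mul_sum]
  refine Finset.sum_congr rfl fun π _ => ?_
  rw [mem_alternatingGroup]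
  rcases Int.units_eq_one_or (sign π) with h | h
  · simp [h, two_mul]
  · have : (-1 : ℤˣ) ≠ 1 := by decide
    simp [h, this]

lemma diff_formula {p : Polynomial ℝ} {ℓ : ℕ} {b : ℕ → ℝ} (hb : ∀ k : ℕ, p.eval (k : ℝ) =
    ∑ j ∈ Finset.range (ℓ + 1), b j * (k.choose j : ℝ)) {n : ℕ} (hn : 2 ≤ n) :
    (∑ σ : Perm (Fin n), ∑ τ : Perm (Fin n),
            p.eval (numCycles (σ * τ * σ⁻¹ * τ⁻¹) : ℝ)) / (n.factorial : ℝ) ^ 2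
          - (∑ η : alternatingGroup (Fin n),
              p.eval (numCycles (η : Perm (Fin n)) : ℝ))
            / (Nat.card (alternatingGroup (Fin n)) : ℝ)
    = (∑ s ∈ (YD n).filter (fun s => s ≠ rowD n ∧ s ≠ colD n), DD ℓ b (cp s)) / n.factorial := by
  classical
  have hf : (n.factorial : ℝ) ≠ 0 := by exact_mod_cast Nat.factorial_ne_zero n
  have hA : ∑ σ : Perm (Fin n), ∑ τ : Perm (Fin n),
      p.eval (numCycles (σ * τ * σ⁻¹ * τ⁻¹) : ℝ) = n.factorial * ∑ s ∈ YD n, DD ℓ b (cp s) := by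
    have := congrArg (DD ℓ b) (comm_formula n)
    rw [← Polynomial.smul_eq_C_mul, map_smul, map_sum, map_sum, smul_eq_mul] at this
    rw [← this]
    refine Finset.sum_congr rfl fun σ _ => ?_
    rw [map_sum]
    exact Finset.sum_congr rfl fun τ _ => (DD_X_pow hb _).symm
  have hR : DD ℓ b (cp (rowD n)) = ∑ π : Perm (Fin n), p.eval (numCycles π : ℝ) := by
    rw [cp_rowD, map_sum]
    exact Finset.sum_congr rfl fun τ _ => (DD_X_pow hb _)
  have hC : DD ℓ b (cp (colD n)) =
      ∑ π : Perm (Fin n), ((sign π : ℤ) : ℝ) * p.eval (numCycles π : ℝ) := by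
    rw [cp_colD, map_sum]
    refine Finset.sum_congr rfl fun τ _ => ?_
    rw [← Polynomial.smul_eq_C_mul, map_smul, DD_X_pow hb, smul_eq_mul]
  have hB := alt_sum (n := n) (fun π => p.eval (numCycles π : ℝ))
  rw [Finset.sum_add_distrib, ← hR, ← hC] at hB
  have hcard : 2 * (Nat.card (alternatingGroup (Fin n)) : ℝ) = n.factorial := by
    haveI : Nontrivial (Fin n) := Fin.nontrivial_iff_two_le.2 hn
    have := two_mul_nat_card_alternatingGroup (α := Fin n)
    rw [Nat.card_perm, Nat.card_fin] at this
    exact_mod_cast this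
  have hne : rowD n ≠ colD n := by
    intro h
    have h1 : ((0, 1) : ℕ × ℕ) ∈ rowD n := by rw [mem_rowD]; simp; omega
    rw [h, mem_colD] at h1
    simp at h1
  have hS : ∑ s ∈ YD n, DD ℓ b (cp s) = DD ℓ b (cp (rowD n)) + DD ℓ b (cp (colD n)) +
      ∑ s ∈ (YD n).filter (fun s => s ≠ rowD n ∧ s ≠ colD n), DD ℓ b (cp s) := by
    have e : (YD n).filter (fun s => s ≠ rowD n ∧ s ≠ colD n) =
        ((YD n).erase (rowD n)).erase (colD n) := by
      ext s; simp only [Finset.mem_filter, Finset.mem_erase]; tauto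
    rw [e, add_assoc, Finset.add_sum_erase _ (fun s => DD ℓ b (cp s))
      (Finset.mem_erase.2 ⟨hne.symm, colD_mem n⟩),
      Finset.add_sum_erase _ (fun s => DD ℓ b (cp s)) (rowD_mem n)]
  have hc0 : (Nat.card (alternatingGroup (Fin n)) : ℝ) ≠ 0 := by
    intro h; rw [h, mul_zero] at hcard; exact hf hcard.symm
  have hB2 : (∑ η : alternatingGroup (Fin n), p.eval (numCycles (η : Perm (Fin n)) : ℝ))
            / (Nat.card (alternatingGroup (Fin n)) : ℝ) =
      (DD ℓ b (cp (rowD n)) + DD ℓ b (cp (colD n))) / n.factorial := by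
    rw [← hB, ← hcard, mul_div_mul_left _ _ two_ne_zero]
  rw [hA, hB2, hS]
  field_simp
  ring

lemma final_bound (ℓ : ℕ) (b : ℕ → ℝ) : ∃ K > (0 : ℝ), ∀ n : ℕ, 2 ≤ n →
    |(∑ s ∈ (YD n).filter (fun s => s ≠ rowD n ∧ s ≠ colD n), DD ℓ b (cp s)) / n.factorial|
      ≤ K * (Real.log n) ^ ℓ / n := by
  set B := ∑ j ∈ Finset.range (ℓ + 1), |b j|
  have hB : 0 ≤ B := Finset.sum_nonneg fun _ _ => abs_nonneg _
  have hl2 : 0 < Real.log 2 := Real.log_pos (by norm_num)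
  set M : ℝ := (2 * ℓ + 1) * (1 / Real.log 2 + 1)
  have hM : 0 ≤ M := by positivity
  refine ⟨B * M ^ ℓ * (ℓ * 4 ^ (2 * ℓ + 1)) + 1, by positivity, fun n hn => ?_⟩
  have hn0 : (0 : ℝ) < n := by exact_mod_cast (by omega : 0 < n)
  have hlog : 0 ≤ Real.log n := Real.log_natCast_nonneg n
  have hlog2 : Real.log 2 ≤ Real.log n :=
    Real.log_le_log (by norm_num) (by exact_mod_cast hn)
  have hL : (2 * ℓ + 1) * (1 + Real.log n) ≤ M * Real.log n := by
    have : 1 ≤ 1 / Real.log 2 * Real.log n := by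
      rw [one_div_mul_eq_div, le_div_iff₀ hl2]; linarith
    rw [mul_assoc]
    refine mul_le_mul_of_nonneg_left ?_ (by positivity)
    linarith
  have hLp : ((2 * ℓ + 1) * (1 + Real.log n)) ^ ℓ ≤ M ^ ℓ * Real.log n ^ ℓ := by
    rw [← mul_pow]; exact pow_le_pow_left₀ (by positivity) hL _
  have h1 : |∑ s ∈ (YD n).filter (fun s => s ≠ rowD n ∧ s ≠ colD n), DD ℓ b (cp s)| ≤
      B * (M ^ ℓ * Real.log n ^ ℓ) * (ℓ * (4 ^ (2 * ℓ + 1) * (n - 1).factorial)) := by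
    refine (Finset.abs_sum_le_sum_abs _ _).trans ?_
    calc _ ≤ ∑ s ∈ (YD n).filter (fun s => s ≠ rowD n ∧ s ≠ colD n),
          (if 1 ≤ dd s ∧ dd s ≤ ℓ then B * (M ^ ℓ * Real.log n ^ ℓ) * (WW s : ℝ) else 0) := by
          refine Finset.sum_le_sum fun s hs => ?_
          simp only [Finset.mem_filter] at hs
          refine (DD_bound (by omega) ℓ b hs.1).trans ?_
          have hd : 1 ≤ dd s := by
            by_contra h
            exact hs.2.1 (dd_zero hs.1 (by omega))
          by_cases h : dd s ≤ ℓ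
          · rw [if_pos h, if_pos ⟨hd, h⟩, mul_assoc, mul_comm (WW s : ℝ)]
            gcongr
          · rw [if_neg h, if_neg (fun h' => h h'.2)]
      _ ≤ ∑ s ∈ YD n,
          (if 1 ≤ dd s ∧ dd s ≤ ℓ then B * (M ^ ℓ * Real.log n ^ ℓ) * (WW s : ℝ) else 0) := by
          refine Finset.sum_le_sum_of_subset_of_nonneg (Finset.filter_subset _ _) fun s _ _ => ?_
          split_ifs <;> positivity
      _ = B * (M ^ ℓ * Real.log n ^ ℓ) *
          ((∑ s ∈ (YD n).filter (fun s => 1 ≤ dd s ∧ dd s ≤ ℓ), WW s : ℕ) : ℝ) := by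
          rw [← Finset.sum_filter, ← Finset.mul_sum]; push_cast; rfl
      _ ≤ _ := by
          refine mul_le_mul_of_nonneg_left ?_ (by positivity)
          exact_mod_cast sum_WW n ℓ
  have hfac : (n.factorial : ℝ) = n * (n - 1).factorial := by
    exact_mod_cast (Nat.mul_factorial_pred (by omega)).symm
  have hf1 : (0 : ℝ) < (n - 1).factorial := by exact_mod_cast Nat.factorial_pos _
  rw [abs_div, abs_of_pos (by rw [hfac]; positivity : (0 : ℝ) < n.factorial), hfac]
  rw [div_le_div_iff₀ (by positivity) hn0]
  have h2 : 0 ≤ Real.log n ^ ℓ * (n * (n - 1).factorial) := by positivity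
  have h3 := mul_le_mul_of_nonneg_right h1 hn0.le
  nlinarith


end MVC

/-- Moments of the vertex count: for a non-negative non-decreasing polynomial `p` of
degree `ℓ`, `E[p(C([σ,τ]))] = E[p(C(η))] + O(log(n)^ℓ / n)`, where `η` is uniform on
the alternating group `A_n`. -/
theorem moments_of_vertex_count (p : Polynomial ℝ) (ℓ : ℕ) (hdeg : p.natDegree = ℓ)
    (hpos : ∀ x : ℝ, 0 ≤ x → 0 ≤ p.eval x)
    (hmono : ∀ x y : ℝ, 0 ≤ x → x ≤ y → p.eval x ≤ p.eval y) :
    ∃ C > (0 : ℝ), ∀ n ≥ 2,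
      |(∑ σ : Equiv.Perm (Fin n), ∑ τ : Equiv.Perm (Fin n),
            p.eval (numCycles (σ * τ * σ⁻¹ * τ⁻¹) : ℝ)) / (n.factorial : ℝ) ^ 2
          - (∑ η : alternatingGroup (Fin n),
              p.eval (numCycles (η : Equiv.Perm (Fin n)) : ℝ))
            / (Nat.card (alternatingGroup (Fin n)) : ℝ)|
        ≤ C * (Real.log n) ^ ℓ / n := by
  obtain ⟨b, hb⟩ := MVC.newton p
  rw [hdeg] at hb
  obtain ⟨K, hK, h⟩ := MVC.final_bound ℓ b
  refine ⟨K, hK, fun n hn => ?_⟩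
  rw [MVC.diff_formula hb hn]
  exact h n hn
end

section
/- Let s_n(σ,τ) denote the number of cycles of length at least 2 of the commutator [σ,τ], for σ, τ independent uniform random elements of S_n. Then E[s_n] − log(n) converges to γ − 1 as n → ∞; i.e. E[s_n] = log(n) + γ − 1 + o(1). (Geometrically, s_n is the number of cone points of the random square-tiled surface S(σ,τ).) -/
/-- `s_n(σ,τ)`: the number of cycles of length at least 2 of the commutator `[σ,τ]`,
i.e. the number of cone points of the square-tiled surface `S(σ,τ)`. -/
def numBigCycles {n : ℕ} (π : Equiv.Perm (Fin n)) : ℕ :=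
  Multiset.card π.cycleType

section Part1
open Finset

structure WD (G : Type) [Group G] [Fintype G] [DecidableEq G] where
  N : ℕ
  d : Fin N → ℕ
  pos : ∀ i, 0 < d i
  ρ : ∀ i, G →* Matrix (Fin (d i)) (Fin (d i)) ℂ
  span : ∀ A : (∀ i, Matrix (Fin (d i)) (Fin (d i)) ℂ), ∃ x : G → ℂ, ∀ i, ∑ g, x g • ρ i g = A i
  plan : ∀ g : G, ∑ i, (d i : ℂ) * (ρ i g).trace = if g = 1 then (Fintype.card G : ℂ) else 0

lemma trace_mulLeft_group {G : Type} [Group G] [Fintype G] [DecidableEq G] (g : G) :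
    LinearMap.trace ℂ (MonoidAlgebra ℂ G) (LinearMap.mulLeft ℂ (MonoidAlgebra.single g (1:ℂ)))
      = if g = 1 then (Fintype.card G : ℂ) else 0 := by
  rw [LinearMap.trace_eq_matrix_trace ℂ (Module.Basis.ofRepr (MonoidAlgebra.coeffLinearEquiv ℂ))]
  simp only [Matrix.trace, Matrix.diag, LinearMap.toMatrix_apply]
  have : ∀ x : G, (MonoidAlgebra.coeffLinearEquiv ℂ : MonoidAlgebra ℂ G ≃ₗ[ℂ] G →₀ ℂ).symm (Finsupp.single x 1) = MonoidAlgebra.single x 1 := fun _ => rfl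
  have h2 : ∀ x : MonoidAlgebra ℂ G, (MonoidAlgebra.coeffLinearEquiv ℂ : MonoidAlgebra ℂ G ≃ₗ[ℂ] G →₀ ℂ) x = x.coeff := fun _ => rfl
  simp [this, h2, MonoidAlgebra.single_mul_single, Finsupp.single_apply]

lemma trace_mulLeft_pi {N : ℕ} (d : Fin N → ℕ) (A : (∀ i, Matrix (Fin (d i)) (Fin (d i)) ℂ)) :
    LinearMap.trace ℂ _ (LinearMap.mulLeft ℂ A) = ∑ i, (d i : ℂ) * (A i).trace := by
  classical
  rw [LinearMap.trace_eq_matrix_trace ℂ (Pi.basis (fun i => Matrix.stdBasis ℂ (Fin (d i)) (Fin (d i))))]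
  simp only [Matrix.trace, Matrix.diag, LinearMap.toMatrix_apply]
  rw [Fintype.sum_sigma]
  refine Finset.sum_congr rfl fun i _ => ?_
  rw [Fintype.sum_prod_type]
  have h2 : ∀ (x : Matrix (Fin (d i)) (Fin (d i)) ℂ) a b, (Matrix.stdBasis ℂ (Fin (d i)) (Fin (d i))).repr x (a, b) = x a b := fun x a b => by
    simp [Matrix.stdBasis]
  simp [Pi.basis_apply, Matrix.stdBasis_eq_single, h2, mul_sum]

lemma exists_WD (G : Type) [Group G] [Fintype G] [DecidableEq G] : Nonempty (WD G) := by
  have : NeZero (Nat.card G : ℂ) := ⟨by simp⟩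
  obtain ⟨N, d, hd, ⟨φ⟩⟩ := IsSemisimpleRing.exists_algEquiv_pi_matrix_of_isAlgClosed ℂ (MonoidAlgebra ℂ G)
  refine ⟨⟨N, d, fun i => Nat.pos_of_ne_zero (hd i).out,
    fun i => (Pi.evalMonoidHom (fun i => Matrix (Fin (d i)) (Fin (d i)) ℂ) i).comp ((MonoidHomClass.toMonoidHom φ).comp (MonoidAlgebra.of ℂ G)), ?_, ?_⟩⟩
  · intro A
    refine ⟨fun g => (φ.symm A).coeff g, fun i => ?_⟩
    have h : φ.symm A = ∑ g, (φ.symm A).coeff g • MonoidAlgebra.of ℂ G g := by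
      conv_lhs => rw [← MonoidAlgebra.sum_coeff_single (φ.symm A)]
      rw [Finsupp.sum_fintype _ _ (by simp)]
      simp [MonoidAlgebra.smul_single]
    have h3 := congrArg (fun y => φ y i) h
    simp only [map_sum, map_smul, AlgEquiv.apply_symm_apply, Finset.sum_apply, Pi.smul_apply] at h3
    rw [h3]; rfl
  · intro g
    rw [← trace_mulLeft_group, ← LinearMap.trace_conj' _ φ.toLinearEquiv]
    have : φ.toLinearEquiv.conj (LinearMap.mulLeft ℂ (MonoidAlgebra.single g (1:ℂ))) = LinearMap.mulLeft ℂ (φ (MonoidAlgebra.single g (1:ℂ))) := by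
      refine LinearMap.ext fun x => ?_
      simp [LinearEquiv.conj_apply]
    rw [this, trace_mulLeft_pi]
    rfl

namespace WD
variable {G : Type} [Group G] [Fintype G] [DecidableEq G] (W : WD G)

def chi (i : Fin W.N) (g : G) : ℂ := (W.ρ i g).trace

lemma span1 (i : Fin W.N) (A : Matrix (Fin (W.d i)) (Fin (W.d i)) ℂ) : ∃ x : G → ℂ, ∑ g, x g • W.ρ i g = A := by
  obtain ⟨x, hx⟩ := W.span (Function.update 0 i A)
  exact ⟨x, by simpa using hx i⟩

lemma chi_inj {i j : Fin W.N} (h : ∀ g, W.chi i g = W.chi j g) : i = j := by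
  by_contra hne
  obtain ⟨x, hx⟩ := W.span (Function.update 0 i 1)
  have h1 := congrArg Matrix.trace (hx i)
  have h2 := congrArg Matrix.trace (hx j)
  rw [Function.update_of_ne (Ne.symm hne)] at h2
  simp only [Matrix.trace_sum, Matrix.trace_smul, Function.update_self, Matrix.trace_one, Fintype.card_fin, Pi.zero_apply, Matrix.trace_zero] at h1 h2
  have : ∀ g, (W.ρ i g).trace = (W.ρ j g).trace := h
  simp only [this] at h1
  rw [h2] at h1
  have := W.pos i
  norm_cast at h1
  omega

lemma scalar_of_comm (i : Fin W.N) (A : Matrix (Fin (W.d i)) (Fin (W.d i)) ℂ) (h : ∀ g, W.ρ i g * A = A * W.ρ i g) :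
    A = (A.trace / W.d i) • (1 : Matrix (Fin (W.d i)) (Fin (W.d i)) ℂ) := by
  have hc : ∀ B, Commute B A := by
    intro B
    obtain ⟨x, hx⟩ := W.span1 i B
    rw [← hx]
    refine Commute.sum_left _ _ _ fun g _ => Commute.smul_left (h g) _
  obtain ⟨c, hc⟩ := Matrix.mem_range_scalar_of_commute_single (M := A) (fun a b _ => hc _)
  have hp : (W.d i : ℂ) ≠ 0 := by exact_mod_cast (W.pos i).ne'
  rw [← hc]
  simp [Matrix.trace, Matrix.smul_one_eq_diagonal, hp]

lemma schur (i : Fin W.N) (A : Matrix (Fin (W.d i)) (Fin (W.d i)) ℂ) :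
    ∑ g, W.ρ i g * A * W.ρ i g⁻¹ = ((Fintype.card G : ℂ) * A.trace / W.d i) • 1 := by
  have h := W.scalar_of_comm i (∑ g, W.ρ i g * A * W.ρ i g⁻¹) (by
    intro h
    rw [mul_sum, sum_mul]
    refine Fintype.sum_equiv (Equiv.mulLeft h) _ _ fun g => ?_
    simp only [Equiv.coe_mulLeft, mul_inv_rev, map_mul, ← mul_assoc]
    rw [mul_assoc _ (W.ρ i h⁻¹) (W.ρ i h), ← map_mul (W.ρ i) h⁻¹ h]
    simp)
  rw [h]
  congr 2
  rw [Matrix.trace_sum]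
  have : ∀ g, (W.ρ i g * A * W.ρ i g⁻¹).trace = A.trace := by
    intro g
    rw [Matrix.trace_mul_comm, ← mul_assoc, ← map_mul]; simp
  simp [this]

lemma single_sandwich {m : ℕ} (M M' : Matrix (Fin m) (Fin m) ℂ) (a b c e : Fin m) :
    ((M * Matrix.single b c (1:ℂ) * M' : Matrix (Fin m) (Fin m) ℂ)) a e = M a b * M' c e := by
  rw [Matrix.mul_apply, Finset.sum_eq_single c]
  · simp
  · intro x _ hx
    rw [Matrix.mul_single_apply_of_ne _ _ _ _ _ hx]; simp
  · simp

lemma schur2_aux {m : ℕ} {ι : Type} [Fintype ι] (R R' : ι → Matrix (Fin m) (Fin m) ℂ) (q : ℂ)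
    (h0 : ∀ A : Matrix (Fin m) (Fin m) ℂ, ∑ g, R g * A * R' g = (q * A.trace) • (1 : Matrix (Fin m) (Fin m) ℂ)) :
    ∑ g, (R' g).trace • R g = q • (1 : Matrix (Fin m) (Fin m) ℂ) := by
  ext a b
  have key2 : ∀ c, ∑ g, R' g c c * R g a b = if a = c ∧ b = c then q else 0 := by
    intro c
    have h := congrFun (congrFun (h0 (Matrix.single b c 1)) a) c
    simp only [Matrix.sum_apply, single_sandwich] at h
    simp only [mul_comm (R' _ _ _)]
    rw [h]
    by_cases h1 : b = c
    · subst h1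
      by_cases h2 : a = b
      · subst h2; simp
      · simp [h2]
    · simp [h1]
  simp only [Matrix.sum_apply, Matrix.smul_apply, smul_eq_mul, Matrix.trace, Matrix.diag, sum_mul]
  rw [sum_comm]
  simp only [key2, Matrix.one_apply]
  by_cases hab : a = b
  · subst hab; simp
  · simp only [hab, if_false, mul_zero]
    refine sum_eq_zero fun c _ => if_neg fun h => hab (h.1.trans h.2.symm)

lemma schur2 (i : Fin W.N) : ∑ g, W.chi i g⁻¹ • W.ρ i g = ((Fintype.card G : ℂ) / W.d i) • 1 := by
  refine schur2_aux (fun g => W.ρ i g) (fun g => W.ρ i g⁻¹) _ fun A => ?_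
  rw [W.schur]; congr 1; ring

lemma comm_sum (i : Fin W.N) : ∑ σ : G, ∑ τ : G, W.ρ i (σ * τ * σ⁻¹ * τ⁻¹) = ((Fintype.card G : ℂ) ^ 2 / (W.d i) ^ 2) • 1 := by
  have : ∀ σ : G, ∑ τ : G, W.ρ i (σ * τ * σ⁻¹ * τ⁻¹) = ((Fintype.card G : ℂ) / W.d i) • (W.chi i σ⁻¹ • W.ρ i σ) := by
    intro σ
    have h := W.schur i (W.ρ i σ⁻¹)
    have h2 : ∑ τ : G, W.ρ i (σ * τ * σ⁻¹ * τ⁻¹) = W.ρ i σ * ∑ g, W.ρ i g * W.ρ i σ⁻¹ * W.ρ i g⁻¹ := by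
      rw [mul_sum]; simp only [map_mul, mul_assoc]
    rw [h2, h]
    simp only [chi, Matrix.mul_smul, mul_one, smul_smul]
    congr 1; ring
  simp only [this]
  rw [← smul_sum, W.schur2, smul_smul]
  congr 1; ring

/-- Fourier coefficient -/
noncomputable def coef (f : G → ℝ) (i : Fin W.N) : ℂ := (∑ h, (f h : ℂ) * W.chi i h) / Fintype.card G

lemma delta (u h : G) : (if u = h then (1:ℂ) else 0) = (∑ i, (W.d i : ℂ) * W.chi i (h⁻¹ * u)) / Fintype.card G := by
  have hG : (Fintype.card G : ℂ) ≠ 0 := by exact_mod_cast Fintype.card_ne_zero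
  have := W.plan (h⁻¹ * u)
  unfold chi
  rw [this]
  by_cases hu : u = h
  · subst hu; simp
  · rw [if_neg hu, if_neg, zero_div]
    intro h'; exact hu (inv_mul_eq_one.1 h').symm

lemma sum_commutator (f : G → ℝ) (hf : ∀ g, f g⁻¹ = f g) :
    (∑ σ : G, ∑ τ : G, (f (σ * τ * σ⁻¹ * τ⁻¹) : ℂ)) / (Fintype.card G : ℂ) ^ 2 = ∑ i, W.coef f i / W.d i := by
  have hG : (Fintype.card G : ℂ) ≠ 0 := by exact_mod_cast Fintype.card_ne_zero
  have h1 : ∀ u : G, (f u : ℂ) = ∑ h, (f h : ℂ) * ((∑ i, (W.d i : ℂ) * W.chi i (h⁻¹ * u)) / Fintype.card G) := by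
    intro u
    simp only [← W.delta]
    simp
  have h2 : ∀ (i) (h : G), ∑ σ : G, ∑ τ : G, W.chi i (h⁻¹ * (σ * τ * σ⁻¹ * τ⁻¹)) = W.chi i h⁻¹ * ((Fintype.card G : ℂ) ^ 2 / (W.d i) ^ 2) := by
    intro i h
    have : ∑ σ : G, ∑ τ : G, W.chi i (h⁻¹ * (σ * τ * σ⁻¹ * τ⁻¹)) = (W.ρ i h⁻¹ * ∑ σ : G, ∑ τ : G, W.ρ i (σ * τ * σ⁻¹ * τ⁻¹)).trace := by
      simp only [mul_sum, Matrix.trace_sum, ← map_mul, chi]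
    rw [this, comm_sum]
    simp [chi, mul_comm]
  have h3 : ∑ σ : G, ∑ τ : G, (f (σ * τ * σ⁻¹ * τ⁻¹) : ℂ) =
      ∑ i, ∑ h, (f h : ℂ) * (W.d i) / Fintype.card G * ∑ σ : G, ∑ τ : G, W.chi i (h⁻¹ * (σ * τ * σ⁻¹ * τ⁻¹)) := by
    have h4 : ∀ u : G, (f u : ℂ) = ∑ i, ∑ h, (f h : ℂ) * (W.d i) / Fintype.card G * W.chi i (h⁻¹ * u) := by
      intro u
      rw [h1 u, sum_comm]
      refine sum_congr rfl fun h _ => ?_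
      rw [sum_div, mul_sum]
      refine sum_congr rfl fun i _ => by ring
    rw [← Fintype.sum_prod_type' (f := fun σ τ : G => (f (σ * τ * σ⁻¹ * τ⁻¹) : ℂ))]
    rw [sum_congr rfl fun (p : G × G) _ => h4 (p.1 * p.2 * p.1⁻¹ * p.2⁻¹), sum_comm]
    refine sum_congr rfl fun i _ => ?_
    rw [sum_comm]
    refine sum_congr rfl fun h _ => ?_
    rw [← Fintype.sum_prod_type' (f := fun σ τ : G => W.chi i (h⁻¹ * (σ * τ * σ⁻¹ * τ⁻¹))), mul_sum]
  rw [h3, sum_div]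
  refine sum_congr rfl fun i _ => ?_
  simp only [h2, coef]
  have hd : (W.d i : ℂ) ≠ 0 := by exact_mod_cast (W.pos i).ne'
  rw [← Equiv.sum_comp (Equiv.inv G) (fun h => (f h : ℂ) * W.chi i h)]
  simp only [Equiv.inv_apply, hf, sum_div]
  refine sum_congr rfl fun h _ => ?_
  field_simp

lemma chi_mul (i : Fin W.N) (a b : G) : W.chi i a * W.chi i b = (W.d i : ℂ) / Fintype.card G * ∑ τ : G, W.chi i (a * (τ * b * τ⁻¹)) := by
  have hG : (Fintype.card G : ℂ) ≠ 0 := by exact_mod_cast Fintype.card_ne_zero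
  have hd : (W.d i : ℂ) ≠ 0 := by exact_mod_cast (W.pos i).ne'
  have : ∑ τ : G, W.chi i (a * (τ * b * τ⁻¹)) = (W.ρ i a * ∑ g, W.ρ i g * W.ρ i b * W.ρ i g⁻¹).trace := by
    simp only [mul_sum, Matrix.trace_sum, ← map_mul, chi]
  rw [this, schur]
  simp [chi]
  field_simp

lemma chi_conj (i : Fin W.N) (a g : G) : W.chi i (g * a * g⁻¹) = W.chi i a := by
  unfold chi
  rw [map_mul, Matrix.trace_mul_comm, ← map_mul]; simp [mul_assoc]

lemma parseval (f f' : G → ℝ) (hf' : ∀ g τ, f' (τ * g * τ⁻¹) = f' g) (hi : ∀ g, f' g⁻¹ = f' g) :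
    ∑ i, W.coef f i * W.coef f' i = (((∑ g, f g * f' g) / Fintype.card G : ℝ) : ℂ) := by
  have hG : (Fintype.card G : ℂ) ≠ 0 := by exact_mod_cast Fintype.card_ne_zero
  have hcol : ∀ a b : G, ∑ i, W.chi i a * W.chi i b = ∑ τ : G, if τ * b * τ⁻¹ = a⁻¹ then (1:ℂ) else 0 := by
    intro a b
    simp only [chi_mul, W.delta, inv_inv, mul_sum, sum_div]
    rw [sum_comm]
    refine sum_congr rfl fun τ _ => sum_congr rfl fun i _ => by ring
  have h1 : ∑ i, W.coef f i * W.coef f' i = (∑ a, ∑ b, (f a : ℂ) * f' b * ∑ i, W.chi i a * W.chi i b) / (Fintype.card G : ℂ) ^ 2 := by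
    simp only [coef, div_mul_div_comm, ← sum_div, ← pow_two]
    congr 1
    simp only [sum_mul_sum]
    simp only [mul_sum]
    rw [sum_comm]
    refine sum_congr rfl fun a _ => ?_
    rw [sum_comm]
    refine sum_congr rfl fun b _ => sum_congr rfl fun i _ => by ring
  rw [h1]
  have h2 : ∀ a : G, ∑ b, (f a : ℂ) * f' b * ∑ i, W.chi i a * W.chi i b = (Fintype.card G : ℂ) * (f a * f' a) := by
    intro a
    simp only [hcol, mul_sum]
    rw [sum_comm]
    have : ∀ τ : G, ∑ b, (f a : ℂ) * f' b * (if τ * b * τ⁻¹ = a⁻¹ then (1:ℂ) else 0) = f a * f' a := by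
      intro τ
      rw [sum_eq_single (τ⁻¹ * a⁻¹ * τ)]
      · have : f' (τ⁻¹ * a⁻¹ * τ) = f' a := by
          have := hf' a⁻¹ τ⁻¹
          rw [inv_inv] at this
          rw [this, hi]
        rw [this, if_pos (by group), mul_one]
      · intro b _ hb
        rw [if_neg, mul_zero]
        intro h
        apply hb
        rw [← h]; group
      · simp
    rw [sum_congr rfl fun τ _ => this τ]
    simp
  simp only [h2, ← mul_sum]
  push_cast
  field_simp

end WD

lemma matrix_idem_trace {m : ℕ} (e : Matrix (Fin m) (Fin m) ℂ) (he : e * e = e) : ∃ r : ℕ, e.trace = r ∧ (r = 0 → e = 0) := by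
  have h : IsIdempotentElem (Matrix.toLin' e) := by
    unfold IsIdempotentElem
    rw [Module.End.mul_eq_comp, ← Matrix.toLin'_mul, he]
  refine ⟨_, by rw [← Matrix.trace_toLin'_eq]; exact (LinearMap.IsIdempotentElem.isProj_range _ h).trace, ?_⟩
  intro h0
  have := (LinearMap.IsIdempotentElem.isProj_range _ h).trace
  rw [h0] at this
  have := LinearMap.IsIdempotentElem.eq_zero_of_trace_eq_zero h (by simpa using this)
  simpa using this

end Part1

section Part2
open Finset

noncomputable def avgM {K : Type} [Group K] [Fintype K] {m : ℕ} (R : K →* Matrix (Fin m) (Fin m) ℂ) : Matrix (Fin m) (Fin m) ℂ :=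
  (Fintype.card K : ℂ)⁻¹ • ∑ h, R h

lemma avgM_left {K : Type} [Group K] [Fintype K] {m : ℕ} (R : K →* Matrix (Fin m) (Fin m) ℂ) (g : K) :
    R g * avgM R = avgM R := by
  unfold avgM
  rw [mul_smul_comm, mul_sum]
  congr 1
  exact Fintype.sum_equiv (Equiv.mulLeft g) _ _ fun h => by simp

lemma avgM_right {K : Type} [Group K] [Fintype K] {m : ℕ} (R : K →* Matrix (Fin m) (Fin m) ℂ) (g : K) :
    avgM R * R g = avgM R := by
  unfold avgM
  rw [smul_mul_assoc, sum_mul]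
  congr 1
  exact Fintype.sum_equiv (Equiv.mulRight g) _ _ fun h => by simp

lemma avgM_idem {K : Type} [Group K] [Fintype K] {m : ℕ} (R : K →* Matrix (Fin m) (Fin m) ℂ) :
    avgM R * avgM R = avgM R := by
  have hG : (Fintype.card K : ℂ) ≠ 0 := by exact_mod_cast Fintype.card_ne_zero
  have : avgM R * avgM R = (Fintype.card K : ℂ)⁻¹ • ∑ h, R h * avgM R := by
    conv_lhs => arg 1; rw [avgM]
    rw [smul_mul_assoc, sum_mul]
  rw [this]
  simp only [avgM_left, sum_const, card_univ, ← Nat.cast_smul_eq_nsmul ℂ, smul_smul]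
  rw [inv_mul_cancel₀ hG, one_smul]

lemma avgM_vec {K : Type} [Group K] [Fintype K] {m : ℕ} (R : K →* Matrix (Fin m) (Fin m) ℂ) (v : Fin m → ℂ) (hv : v ≠ 0)
    (h : ∀ g, (R g).mulVec v = v) : avgM R ≠ 0 := by
  intro h0
  have hG : (Fintype.card K : ℂ) ≠ 0 := by exact_mod_cast Fintype.card_ne_zero
  have h1 : (avgM R).mulVec v = v := by
    unfold avgM
    rw [Matrix.smul_mulVec, Matrix.sum_mulVec]
    simp only [h, sum_const, card_univ, ← Nat.cast_smul_eq_nsmul ℂ, smul_smul]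
    rw [inv_mul_cancel₀ hG, one_smul]
  rw [h0, Matrix.zero_mulVec] at h1
  exact hv h1.symm

namespace WD
variable {G : Type} [Group G] [Fintype G] [DecidableEq G] (W : WD G)

/-- twisted restriction -/
noncomputable def twR {K : Type} [Group K] (φ : K →* G) (ε : K →* ℂ) (i : Fin W.N) : K →* Matrix (Fin (W.d i)) (Fin (W.d i)) ℂ where
  toFun h := ε h • W.ρ i (φ h)
  map_one' := by simp
  map_mul' a b := by rw [map_mul, map_mul, map_mul, smul_mul_smul_comm]

lemma plan_avg {K : Type} [Group K] [Fintype K] (φ : K →* G) (hφ : Function.Injective φ) (ε : K →* ℂ) :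
    ∑ i, (W.d i : ℂ) * (avgM (W.twR φ ε i)).trace = (Fintype.card G : ℂ) / Fintype.card K := by
  have : ∀ i, (W.d i : ℂ) * (avgM (W.twR φ ε i)).trace = (Fintype.card K : ℂ)⁻¹ * ∑ h, ε h * ((W.d i : ℂ) * (W.ρ i (φ h)).trace) := by
    intro i
    simp only [avgM, twR, Matrix.trace_smul, Matrix.trace_sum, MonoidHom.coe_mk, OneHom.coe_mk, smul_eq_mul, mul_sum]
    refine sum_congr rfl fun h _ => by ring
  simp only [this]
  rw [← mul_sum, sum_comm]
  simp only [← mul_sum, W.plan]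
  rw [sum_eq_single 1]
  · simp; ring
  · intro b _ hb
    rw [if_neg, mul_zero]
    intro h; exact hb (hφ (by simpa using h))
  · simp

lemma card_le_of_avg {K : Type} [Group K] [Fintype K] (φ : K →* G) (hφ : Function.Injective φ) (ε : K →* ℂ)
    (S : Finset (Fin W.N)) (D : ℕ) (hD : ∀ i ∈ S, D ≤ W.d i) (hS : ∀ i ∈ S, avgM (W.twR φ ε i) ≠ 0) :
    (S.card * D : ℝ) ≤ (Fintype.card G : ℝ) / Fintype.card K := by
  choose r hr hr0 using fun i => matrix_idem_trace _ (avgM_idem (W.twR φ ε i))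
  have h := W.plan_avg φ hφ ε
  simp only [hr] at h
  have h' : ∑ i, (W.d i : ℝ) * r i = (Fintype.card G : ℝ) / Fintype.card K := by
    apply Complex.ofReal_injective; push_cast; exact h
  rw [← h']
  calc (S.card * D : ℝ) = ∑ i ∈ S, (D : ℝ) := by simp
    _ ≤ ∑ i ∈ S, (W.d i : ℝ) * r i := by
      refine sum_le_sum fun i hi => ?_
      have h1 := hD i hi
      have h2 : 1 ≤ r i := Nat.one_le_iff_ne_zero.2 fun h => hS i hi (hr0 i h)
      have : D ≤ W.d i * r i := by nlinarith
      exact_mod_cast this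
    _ ≤ _ := sum_le_sum_of_subset_of_nonneg (subset_univ _) fun i _ _ => by positivity

lemma exists_triv : ∃ i : Fin W.N, W.d i = 1 ∧ ∀ g, W.chi i g = 1 := by
  choose r hr hr0 using fun i => matrix_idem_trace _ (avgM_idem (W.twR (MonoidHom.id G) 1 i))
  have h := W.plan_avg (MonoidHom.id G) (fun _ _ h => h) 1
  have hG : (Fintype.card G : ℂ) ≠ 0 := by exact_mod_cast Fintype.card_ne_zero
  simp only [hr, div_self hG] at h
  have h' : ∑ i, W.d i * r i = 1 := by exact_mod_cast h
  obtain ⟨i, hi⟩ : ∃ i, r i ≠ 0 := by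
    by_contra hc
    push Not at hc
    simp [hc] at h'
  have h1 : W.d i * r i ≤ 1 := by
    rw [← h']; exact single_le_sum (f := fun i => W.d i * r i) (fun _ _ => Nat.zero_le _) (mem_univ i)
  have hp := W.pos i
  have hd : W.d i = 1 := by
    by_contra hne
    have : 2 ≤ W.d i := by omega
    have : 1 ≤ r i := by omega
    nlinarith
  refine ⟨i, hd, fun g => ?_⟩
  have hr1 : r i = 1 := by rw [hd] at h1; omega
  set e := avgM (W.twR (MonoidHom.id G) 1 i) with he
  have e0 : ∀ g, W.twR (MonoidHom.id G) 1 i g = W.ρ i g := fun g => by simp [twR]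
  have e1 : ∀ g, W.ρ i g * e = e := fun g => by rw [← e0]; exact avgM_left (W.twR (MonoidHom.id G) 1 i) g
  have e2 : ∀ g, e * W.ρ i g = e := fun g => by rw [← e0]; exact avgM_right (W.twR (MonoidHom.id G) 1 i) g
  have e3 := W.scalar_of_comm i e (fun g => by rw [e1, e2])
  have hdc : ((1:ℕ):ℂ) / (W.d i : ℂ) = 1 := by rw [hd]; simp
  rw [hr i, hr1, hdc, one_smul] at e3
  have := e1 g
  rw [e3, mul_one] at this
  rw [chi, this]; simp [hd]

lemma coef_triv (f : G → ℝ) {i : Fin W.N} (hi : ∀ g, W.chi i g = 1) : W.coef f i = (((∑ g, f g) / Fintype.card G : ℝ) : ℂ) := by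
  simp [coef, hi]

lemma d_eq_one_of_scalar (i : Fin W.N) (h : ∀ g, ∃ z : ℂ, W.ρ i g = z • 1) : W.d i = 1 := by
  by_contra hne
  have hp := W.pos i
  choose z hz using h
  let a : Fin (W.d i) := ⟨0, hp⟩
  let b : Fin (W.d i) := ⟨1, by omega⟩
  have hab : a ≠ b := by simp [a, b]
  obtain ⟨x, hx⟩ := W.span1 i (Matrix.single a b 1)
  simp only [hz, smul_smul, ← sum_smul] at hx
  have := congrFun (congrFun hx a) b
  simp [hab] at this
end WD

end Part2

section Part3
open Finset Equiv
set_option linter.unusedSectionVars false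

section EC
variable {α X : Type} [Fintype α] [DecidableEq α] [Fintype X] [DecidableEq X]

/-- embeddings intertwining -/
noncomputable def ES (c : Perm α) (π : Perm X) : Finset (α ↪ X) := univ.filter fun h => ∀ a, π (h a) = h (c a)

lemma mem_ES {c : Perm α} {π : Perm X} {h : α ↪ X} : h ∈ ES c π ↔ ∀ a, π (h a) = h (c a) := by
  simp [ES]

lemma perm_inl {r : ℕ} (c : Perm α) (p : Perm (α ⊕ Fin r)) (h : ∀ a, p (Sum.inl a) = Sum.inl (c a)) :
    ∃ s : Perm (Fin r), p = sumCongr c s := by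
  have h1 : p ∈ Set.range (Perm.sumCongrHom α (Fin r)) := by
    have := Perm.mem_sumCongrHom_range_of_perm_mapsTo_inl (σ := p) (by
      rintro _ ⟨a, rfl⟩; exact ⟨c a, (h a).symm⟩)
    exact this
  obtain ⟨⟨c', s⟩, hs⟩ := h1
  refine ⟨s, ?_⟩
  have : c' = c := by
    ext a
    have := h a
    rw [← hs] at this
    simpa using congrArg id this
  rw [← hs, this]; rfl

/-- base permutation -/
def JJ {r : ℕ} (e : α ⊕ Fin r ≃ X) (c : Perm α) (s : Perm (Fin r)) : Perm X := e.permCongr (sumCongr c s)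

lemma JJ_inl {r : ℕ} (e : α ⊕ Fin r ≃ X) (c : Perm α) (s : Perm (Fin r)) (a : α) :
    JJ e c s (e (Sum.inl a)) = e (Sum.inl (c a)) := by simp [JJ]

lemma JJ_inj {r : ℕ} (e : α ⊕ Fin r ≃ X) (c : Perm α) : Function.Injective (JJ e c) := by
  intro s s' h
  have := (e.permCongr).injective h
  refine Equiv.ext fun x => ?_
  have := congrArg (fun p => p (Sum.inr x)) this
  simpa using congrArg id this

lemma JJ_exists {r : ℕ} (e : α ⊕ Fin r ≃ X) (c : Perm α) (p : Perm X) (h : ∀ a, p (e (Sum.inl a)) = e (Sum.inl (c a))) :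
    ∃ s, p = JJ e c s := by
  obtain ⟨s, hs⟩ := perm_inl (r := r) c (e.symm.permCongr p) (by intro a; simp [h])
  refine ⟨s, ?_⟩
  rw [JJ, ← hs]
  ext x; simp

lemma card_ext {r : ℕ} (e : α ⊕ Fin r ≃ X) (h : α ↪ X) :
    (univ.filter fun g : Perm X => ∀ a, g (e (Sum.inl a)) = h a).card = r.factorial := by
  classical
  obtain ⟨g0, hg0⟩ : ∃ g0 : Perm X, ∀ a, g0 (e (Sum.inl a)) = h a := by
    have hi : Function.Injective fun a => e (Sum.inl a : α ⊕ Fin r) := fun a b hab => by simpa using hab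
    let q := (Equiv.ofInjective _ hi).symm.trans (Equiv.ofInjective _ h.injective)
    refine ⟨Equiv.extendSubtype (p := fun x => x ∈ Set.range fun a => e (Sum.inl a : α ⊕ Fin r)) (q := fun x => x ∈ Set.range h) q, fun a => ?_⟩
    rw [Equiv.extendSubtype_apply_of_mem _ _ ⟨a, rfl⟩]
    simp only [q, Equiv.trans_apply]
    rw [show (⟨e (Sum.inl a), ⟨a, rfl⟩⟩ : Set.range fun a => e (Sum.inl a : α ⊕ Fin r)) = Equiv.ofInjective _ hi a from rfl, Equiv.symm_apply_apply]
    rfl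
  have : r.factorial = (univ : Finset (Perm (Fin r))).card := by
    rw [card_univ, Fintype.card_perm, Fintype.card_fin]
  rw [this]
  symm
  refine card_bij (fun s _ => g0 * JJ e 1 s) ?_ ?_ ?_
  · intro s _
    simp [JJ_inl, hg0]
  · intro s _ s' _ hs
    exact JJ_inj e 1 (mul_left_cancel hs)
  · intro g hg
    simp only [mem_filter, mem_univ, true_and] at hg
    obtain ⟨s, hs⟩ := JJ_exists e 1 (g0⁻¹ * g) (by
      intro a
      rw [Perm.mul_apply, hg, ← hg0]; simp)
    exact ⟨s, mem_univ _, by rw [← hs]; group⟩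

lemma card_pairs {r : ℕ} (e : α ⊕ Fin r ≃ X) (c : Perm α) (π : Perm X) :
    (univ.filter fun p : Perm X × Perm (Fin r) => p.1 * JJ e c p.2 * p.1⁻¹ = π).card = r.factorial * (ES c π).card := by
  have h1 : (univ.filter fun p : Perm X × Perm (Fin r) => p.1 * JJ e c p.2 * p.1⁻¹ = π).card
      = (univ.filter fun g : Perm X => ∀ a, π (g (e (Sum.inl a))) = g (e (Sum.inl (c a)))).card := by
    refine card_bij (fun p _ => p.1) ?_ ?_ ?_
    · rintro ⟨g, s⟩ h
      simp only [mem_filter, mem_univ, true_and] at h ⊢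
      intro a
      rw [← h]; simp [JJ_inl]
    · rintro ⟨g, s⟩ h ⟨g', s'⟩ h' hg
      simp only [mem_filter, mem_univ, true_and] at h h' hg
      subst hg
      rw [← h'] at h
      have := JJ_inj e c (mul_left_cancel (mul_right_cancel h))
      rw [this]
    · intro g hg
      simp only [mem_filter, mem_univ, true_and] at hg
      obtain ⟨s, hs⟩ := JJ_exists e c (g⁻¹ * π * g) (by intro a; simp [hg])
      refine ⟨(g, s), ?_, rfl⟩
      simp only [mem_filter, mem_univ, true_and]
      rw [← hs]; group
  rw [h1]
  let φ : Perm X → (α ↪ X) := fun g => ⟨fun a => g (e (Sum.inl a)), fun a b hab => by simpa using hab⟩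
  rw [card_eq_sum_card_fiberwise (f := φ) (t := ES c π)]
  · rw [sum_congr rfl (g := fun _ => r.factorial)]
    · simp [mul_comm]
    · intro h hh
      rw [← card_ext e h]
      congr 1
      ext g
      simp only [mem_filter, mem_univ, true_and, ES] at hh ⊢
      constructor
      · rintro ⟨_, h2⟩ a
        rw [← h2]; rfl
      · intro h2
        refine ⟨fun a => by rw [h2, h2, hh], ?_⟩
        ext a; exact h2 a
  · intro g hg
    simp only [coe_filter, mem_univ, true_and, Set.mem_ofPred_eq] at hg
    simp only [ES, coe_filter, mem_univ, true_and, Set.mem_ofPred_eq]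
    exact hg

lemma sum_conj_JJ {V : Type} [AddCommMonoid V] {r : ℕ} (e : α ⊕ Fin r ≃ X) (c : Perm α) (F : Perm X → V) :
    ∑ g : Perm X, ∑ s : Perm (Fin r), F (g * JJ e c s * g⁻¹) = r.factorial • ∑ π, (ES c π).card • F π := by
  rw [← Fintype.sum_prod_type' (f := fun g s => F (g * JJ e c s * g⁻¹))]
  rw [← sum_fiberwise univ (fun p : Perm X × Perm (Fin r) => p.1 * JJ e c p.2 * p.1⁻¹), smul_sum]
  refine sum_congr rfl fun π _ => ?_
  rw [sum_congr rfl (g := fun _ => F π)]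
  · rw [sum_const, card_pairs, mul_smul]
  · intro p hp
    simp only [mem_filter, mem_univ, true_and] at hp
    rw [hp]

lemma sum_ES (c : Perm α) (h : Fintype.card α ≤ Fintype.card X) : ∑ π : Perm X, (ES c π).card = (Fintype.card X).factorial := by
  obtain ⟨r, hr⟩ := Nat.exists_eq_add_of_le h
  have e : α ⊕ Fin r ≃ X := Fintype.equivOfCardEq (by simp [hr])
  have := sum_conj_JJ e c (fun _ => 1)
  simp only [sum_const, card_univ, Fintype.card_perm, Fintype.card_fin, smul_eq_mul, mul_one] at this
  have hp := r.factorial_pos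
  rw [mul_comm] at this
  exact (Nat.eq_of_mul_eq_mul_left hp this).symm

lemma sum_ES_le (c : Perm α) : ∑ π : Perm X, (ES c π).card ≤ (Fintype.card X).factorial := by
  by_cases h : Fintype.card α ≤ Fintype.card X
  · exact (sum_ES c h).le
  · have : IsEmpty (α ↪ X) := ⟨fun f => h (Fintype.card_le_of_embedding f)⟩
    have h0 : ∀ π : Perm X, (ES c π) = ∅ := fun π => Finset.eq_empty_of_isEmpty _
    simp [h0]

lemma coef_ES (W : WD (Perm X)) {r : ℕ} (e : α ⊕ Fin r ≃ X) (c : Perm α) (i : Fin W.N) :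
    W.coef (fun π => ((ES c π).card : ℝ)) i = (r.factorial : ℂ)⁻¹ * ∑ s : Perm (Fin r), W.chi i (JJ e c s) := by
  have := sum_conj_JJ e c (W.chi i)
  simp only [W.chi_conj, sum_const, card_univ, nsmul_eq_mul] at this
  have hr : (r.factorial : ℂ) ≠ 0 := by exact_mod_cast r.factorial_ne_zero
  have hG : (Fintype.card (Perm X) : ℂ) ≠ 0 := by exact_mod_cast Fintype.card_ne_zero
  unfold WD.coef
  push_cast
  field_simp
  rw [this, mul_comm]
end EC

end Part3

section Part4
open Finset Equiv
set_option linter.unusedSectionVars false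

section B
variable {X : Type} [Fintype X] [DecidableEq X]

noncomputable def per (π : Perm X) (x : X) : ℕ := Function.minimalPeriod π x

lemma pow_fix_iff (π : Perm X) (x : X) (j : ℕ) : (π ^ j) x = x ↔ per π x ∣ j := by
  rw [per, ← Function.isPeriodicPt_iff_minimalPeriod_dvd, Function.IsPeriodicPt, Function.IsFixedPt, Perm.iterate_eq_pow]

lemma per_eq {π π' : Perm X} {x y : X} (h : ∀ j : ℕ, (π ^ j) x = x ↔ (π' ^ j) y = y) : per π x = per π' y := by
  apply Nat.dvd_antisymm
  · rw [← pow_fix_iff, h, pow_fix_iff]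
  · rw [← pow_fix_iff, ← h, pow_fix_iff]

lemma per_pos (π : Perm X) (x : X) : 0 < per π x := by
  apply Nat.pos_of_ne_zero
  intro h
  have := (pow_fix_iff π x (orderOf π)).1 (by rw [pow_orderOf_eq_one]; rfl)
  rw [h, zero_dvd_iff] at this
  exact (orderOf_pos π).ne' this

noncomputable def Bk (k : ℕ) (π : Perm X) : ℕ := (univ.filter fun x => per π x = k).card

lemma Bk_conj (k : ℕ) (π τ : Perm X) : Bk k (τ * π * τ⁻¹) = Bk k π := by
  unfold Bk
  symm
  have key : ∀ x, per (τ * π * τ⁻¹) (τ x) = per π x := fun x => per_eq fun j => by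
    rw [conj_pow]; simp
  refine card_bij (fun x _ => τ x) ?_ ?_ ?_
  · intro x hx; simpa [key] using hx
  · intro x _ y _ h; exact τ.injective h
  · intro y hy
    refine ⟨τ⁻¹ y, ?_, by simp⟩
    have h1 := key (τ⁻¹ y)
    rw [show τ (τ⁻¹ y) = y by simp] at h1
    simp only [mem_filter, mem_univ, true_and] at hy ⊢
    rw [← h1, hy]

lemma Bk_inv (k : ℕ) (π : Perm X) : Bk k π⁻¹ = Bk k π := by
  unfold Bk
  congr 1; ext x
  have : per π⁻¹ x = per π x := per_eq fun j => by rw [inv_pow, Perm.inv_eq_iff_eq, eq_comm]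
  simp [this]

/-- the cyclic embedding based at a point -/
noncomputable def orb (k : ℕ) [NeZero k] (π : Perm X) (x : X) (a : ZMod k) : X := (π ^ a.val) x

lemma pow_mod_per (π : Perm X) (x : X) (j : ℕ) : (π ^ (j % per π x)) x = (π ^ j) x := by
  have := Function.iterate_mod_minimalPeriod_eq (f := π) (x := x) (n := j)
  rwa [Perm.iterate_eq_pow, Perm.iterate_eq_pow] at this

lemma orb_step (k : ℕ) [NeZero k] (π : Perm X) (x : X) (h : per π x = k) (a : ZMod k) : π (orb k π x a) = orb k π x (a + 1) := by
  unfold orb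
  have h1 : (a + 1).val = (a.val + 1) % k := by
    rw [ZMod.val_add, ZMod.val_one_eq_one_mod]; simp
  rw [h1]
  have h2 := pow_mod_per π x (a.val + 1)
  rw [h] at h2
  rw [h2]
  rw [pow_succ', Perm.mul_apply]

lemma orb_inj (k : ℕ) [NeZero k] (π : Perm X) (x : X) (h : per π x = k) : Function.Injective (orb k π x) := by
  intro a b hab
  have := Function.iterate_injOn_Iio_minimalPeriod (f := π) (x := x) (x₁ := a.val) (x₂ := b.val)
    (by rw [show Function.minimalPeriod π x = k from h]; exact ZMod.val_lt a)
    (by rw [show Function.minimalPeriod π x = k from h]; exact ZMod.val_lt b)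
    (by simp only [Perm.iterate_eq_pow]; exact hab)
  exact ZMod.val_injective k this

lemma ES_pow {k : ℕ} [NeZero k] {π : Perm X} {h : ZMod k ↪ X} (hh : ∀ a, π (h a) = h (a + 1)) (j : ℕ) (a : ZMod k) :
    (π ^ j) (h a) = h (a + j) := by
  induction j with
  | zero => simp
  | succ j ih => rw [pow_succ', Perm.mul_apply, ih, hh]; push_cast; rw [add_assoc]

lemma Bk_eq_ES (k : ℕ) [NeZero k] (π : Perm X) : Bk k π = (ES (Equiv.addRight (1 : ZMod k)) π).card := by
  unfold Bk
  symm
  refine card_bij (fun h _ => h 0) ?_ ?_ ?_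
  · intro h hh
    rw [mem_ES] at hh
    simp only [mem_filter, mem_univ, true_and]
    apply Nat.dvd_antisymm
    · rw [← pow_fix_iff, ES_pow hh]; simp
    · have := (pow_fix_iff π (h 0) (per π (h 0))).2 dvd_rfl
      rw [ES_pow hh] at this
      have := h.injective this
      rw [zero_add] at this
      exact (ZMod.natCast_eq_zero_iff _ _).1 this
  · intro h hh h' hh' h0
    rw [mem_ES] at hh hh'
    ext a
    have e1 := ES_pow hh a.val 0
    have e2 := ES_pow hh' a.val 0
    simp only [ZMod.natCast_val, ZMod.cast_id', id_eq, zero_add] at e1 e2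
    rw [← e1, ← e2, h0]
  · intro x hx
    simp only [mem_filter, mem_univ, true_and] at hx
    refine ⟨⟨orb k π x, orb_inj k π x hx⟩, ?_, by simp [orb]⟩
    rw [mem_ES]
    exact orb_step k π x hx

lemma sum_Bk (k : ℕ) (hk : 0 < k) (h : k ≤ Fintype.card X) : ∑ π : Perm X, Bk k π = (Fintype.card X).factorial := by
  have : NeZero k := ⟨hk.ne'⟩
  simp only [Bk_eq_ES]
  exact sum_ES _ (by simpa [ZMod.card] using h)

lemma sum_Bk_le (k : ℕ) (hk : 0 < k) : ∑ π : Perm X, Bk k π ≤ (Fintype.card X).factorial := by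
  have : NeZero k := ⟨hk.ne'⟩
  simp only [Bk_eq_ES]
  exact sum_ES_le _

lemma per_same {π : Perm X} {x y : X} (h : π.SameCycle x y) : per π x = per π y := by
  obtain ⟨i, _, rfl⟩ := h.exists_pow_eq'
  refine per_eq fun j => ?_
  rw [← Perm.mul_apply, ← pow_add, add_comm, pow_add, Perm.mul_apply]
  exact (Equiv.apply_eq_iff_eq _).symm

lemma Bk_mul_le (k l : ℕ) [NeZero k] [NeZero l] (π : Perm X) :
    Bk k π * Bk l π ≤ (ES (sumCongr (Equiv.addRight (1 : ZMod k)) (Equiv.addRight (1 : ZMod l))) π).card + (if k = l then k else 0) * Bk k π := by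
  classical
  have : Bk k π * Bk l π = ((univ.filter fun x => per π x = k) ×ˢ (univ.filter fun x => per π x = l)).card := by
    rw [card_product]; rfl
  rw [this, ← card_filter_add_card_filter_not (fun p => ¬ π.SameCycle p.1 p.2)]
  apply add_le_add
  · refine card_le_card_of_surjOn (fun h => (h (Sum.inl 0), h (Sum.inr 0))) ?_
    rintro ⟨x, y⟩ hp
    simp only [coe_filter, mem_product, mem_filter, mem_univ, true_and, Set.mem_ofPred_eq] at hp
    obtain ⟨⟨h1, h2⟩, h3⟩ := hp
    refine ⟨⟨Sum.elim (orb k π x) (orb l π y), ?_⟩, ?_, ?_⟩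
    · refine (orb_inj k π x h1).sumElim (orb_inj l π y h2) ?_
      intro a b hab
      apply h3
      have e1 : π.SameCycle x (orb k π x a) := Perm.sameCycle_pow_right.2 (Perm.SameCycle.refl _ _)
      have e2 : π.SameCycle y (orb l π y b) := Perm.sameCycle_pow_right.2 (Perm.SameCycle.refl _ _)
      rw [← hab] at e2
      exact e1.trans e2.symm
    · rw [mem_coe, mem_ES]
      rintro (a | b)
      · exact orb_step k π x h1 a
      · exact orb_step l π y h2 b
    · simp [orb]
  · by_cases hkl : k = l
    · subst hkl
      rw [if_pos rfl]
      calc _ ≤ (((range k) ×ˢ (univ.filter fun x => per π x = k)).image fun p => (p.2, (π ^ p.1) p.2)).card := by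
            refine card_le_card ?_
            rintro ⟨x, y⟩ hp
            simp only [mem_product, mem_filter, mem_univ, true_and, not_not] at hp
            obtain ⟨⟨h1, h2⟩, h3⟩ := hp
            obtain ⟨i, _, rfl⟩ := h3.exists_pow_eq'
            simp only [mem_image, mem_product, mem_filter, mem_univ, true_and, mem_range, Prod.exists]
            refine ⟨i % k, x, ⟨Nat.mod_lt _ (NeZero.pos k), h1⟩, ?_⟩
            have := pow_mod_per π x i
            rw [h1] at this
            rw [this]
        _ ≤ _ := card_image_le
        _ = _ := by rw [card_product, card_range]; rfl
    · rw [card_eq_zero.2, if_neg hkl]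
      · simp
      · rw [filter_eq_empty_iff]
        rintro ⟨x, y⟩ hp
        simp only [mem_product, mem_filter, mem_univ, true_and, not_not] at hp ⊢
        intro h
        exact hkl (hp.1.symm.trans ((per_same h).trans hp.2))

lemma sum_Bk_mul_le (k l : ℕ) (hk : 0 < k) (hl : 0 < l) :
    ∑ π : Perm X, Bk k π * Bk l π ≤ (1 + if k = l then k else 0) * (Fintype.card X).factorial := by
  have : NeZero k := ⟨hk.ne'⟩
  have : NeZero l := ⟨hl.ne'⟩
  calc _ ≤ _ := sum_le_sum fun π _ => Bk_mul_le k l π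
    _ ≤ _ := by
      rw [sum_add_distrib, ← mul_sum, add_mul, one_mul]
      exact add_le_add (sum_ES_le _) (Nat.mul_le_mul_left _ (sum_Bk_le k hk))

lemma per_cycleOf (π : Perm X) (x : X) (hx : π x ≠ x) : (π.cycleOf x).support.card = per π x := by
  have hc := Perm.isCycle_cycleOf π hx
  rw [← hc.orderOf]
  have key : ∀ j : ℕ, orderOf (π.cycleOf x) ∣ j ↔ per π x ∣ j := by
    intro j
    rw [orderOf_dvd_iff_pow_eq_one, ← pow_fix_iff, hc.pow_eq_one_iff' (x := x) (by simpa using hx), Perm.cycleOf_pow_apply_self]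
  exact Nat.dvd_antisymm ((key _).2 dvd_rfl) ((key _).1 dvd_rfl)

lemma per_le (π : Perm X) (x : X) : per π x ≤ Fintype.card X := by
  have : NeZero (per π x) := ⟨(per_pos π x).ne'⟩
  have := Fintype.card_le_of_injective _ (orb_inj (per π x) π x rfl)
  rwa [ZMod.card] at this

lemma one_lt_per (π : Perm X) (x : X) : 2 ≤ per π x ↔ π x ≠ x := by
  have h1 := pow_fix_iff π x 1
  rw [pow_one, Nat.dvd_one] at h1
  have := per_pos π x
  rw [Ne, h1]; omega

lemma card_cycleType (π : Perm X) : (Multiset.card π.cycleType : ℝ) = ∑ k ∈ Icc 2 (Fintype.card X), (Bk k π : ℝ) / k := by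
  have h1 : (Multiset.card π.cycleType : ℝ) = ∑ x ∈ π.support, (1 : ℝ) / per π x := by
    rw [← sum_fiberwise_of_maps_to (t := π.cycleFactorsFinset) (g := fun x => π.cycleOf x)
      (fun x hx => Perm.cycleOf_mem_cycleFactorsFinset_iff.2 hx)]
    rw [sum_congr rfl (g := fun _ => (1:ℝ))]
    · simp [Perm.cycleType_def]
    · intro c hc
      have hcyc := (Perm.mem_cycleFactorsFinset_iff.1 hc).1
      have hs : (π.support.filter fun x => π.cycleOf x = c) = c.support := by
        ext x
        simp only [mem_filter]
        constructor
        · rintro ⟨h1, rfl⟩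
          simpa using h1
        · intro h
          exact ⟨Perm.mem_cycleFactorsFinset_support_le hc h, (Perm.cycle_is_cycleOf h hc).symm⟩
      rw [sum_congr rfl (g := fun _ => (1:ℝ) / c.support.card), hs, sum_const]
      · have : (c.support.card : ℝ) ≠ 0 := by
          have := hcyc.two_le_card_support
          exact_mod_cast (by omega)
        rw [nsmul_eq_mul]; field_simp
      · intro x hx
        simp only [mem_filter] at hx
        rw [← hx.2, per_cycleOf _ _ (by simpa using hx.1)]
  rw [h1, ← sum_fiberwise_of_maps_to (t := Icc 2 (Fintype.card X)) (g := fun x => per π x)]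
  · refine sum_congr rfl fun k hk => ?_
    rw [sum_congr rfl (g := fun _ => (1:ℝ) / k), sum_const, nsmul_eq_mul, Bk]
    · rw [mul_one_div]
      congr 3
      ext x
      simp only [mem_filter, mem_univ, true_and, Perm.mem_support, and_iff_right_iff_imp]
      intro h
      rw [mem_Icc] at hk
      rw [← one_lt_per, h]; exact hk.1
    · intro x hx
      rw [(mem_filter.1 hx).2]
  · intro x hx
    rw [mem_Icc, one_lt_per]
    exact ⟨by simpa using hx, per_le _ _⟩
end B

end Part4

section Part5
open Finset Equiv
set_option linter.unusedSectionVars false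

lemma sum_moebius_div (m : ℕ) : ∑ d ∈ m.divisors, (ArithmeticFunction.moebius d : ℂ) = if m = 1 then 1 else 0 := by
  have h := congrArg (fun f => f m) (ArithmeticFunction.coe_zeta_mul_moebius)
  simp only [ArithmeticFunction.coe_zeta_mul_apply, ArithmeticFunction.one_apply] at h
  have := congrArg (Int.cast : ℤ → ℂ) h
  push_cast at this
  exact this

lemma moebius_coprime (k : ℕ) (hk : 0 < k) (f : ℕ → ℂ) :
    ∑ j ∈ (Icc 1 k).filter (fun j => Nat.Coprime j k), f j =
      ∑ d ∈ k.divisors, (ArithmeticFunction.moebius d : ℂ) * ∑ j ∈ (Icc 1 k).filter (fun j => d ∣ j), f j := by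
  simp only [mul_sum, sum_filter]
  rw [sum_comm]
  refine sum_congr rfl fun j hj => ?_
  rw [mem_Icc] at hj
  have hg : 0 < Nat.gcd j k := Nat.gcd_pos_of_pos_left _ (by omega)
  have h2 : k.divisors.filter (fun d => d ∣ j) = (Nat.gcd j k).divisors := by
    ext d
    simp only [mem_filter, Nat.mem_divisors, Nat.dvd_gcd_iff]
    constructor
    · rintro ⟨⟨h1, _⟩, h3⟩; exact ⟨⟨h3, h1⟩, hg.ne'⟩
    · rintro ⟨⟨h1, h2⟩, _⟩; exact ⟨⟨h2, hk.ne'⟩, h1⟩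
  simp only [mul_ite, mul_zero]
  rw [← sum_filter, h2, ← sum_mul, sum_moebius_div]
  unfold Nat.Coprime
  split_ifs <;> simp

lemma power_idem {m : ℕ} (N : Matrix (Fin m) (Fin m) ℂ) (q : ℕ) (hq : 0 < q) (hN : N ^ (q + 1) = N) :
    ∃ r : ℚ, (∑ l ∈ range q, N ^ (l + 1)).trace = (r : ℂ) := by
  set E := ∑ l ∈ range q, N ^ (l + 1) with hE
  have h1 : N * E = E := by
    have e1 : N * E = ∑ l ∈ range q, N ^ (l + 1 + 1) := by
      rw [hE, mul_sum]; simp only [pow_succ' N (_ + 1)]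
    have e2 := sum_range_succ (fun l => N ^ (l + 1)) q
    rw [sum_range_succ', hN, zero_add, pow_one] at e2
    rw [e1, hE]
    exact add_right_cancel e2
  have h2 : ∀ l, N ^ l * E = E := by
    intro l
    induction l with
    | zero => simp
    | succ l ih => rw [pow_succ, mul_assoc, h1, ih]
  have h3 : E * E = (q : ℂ) • E := by
    conv_lhs => arg 1; rw [hE]
    rw [sum_mul]
    simp only [h2, sum_const, card_range, Nat.cast_smul_eq_nsmul]
  have hq' : (q : ℂ) ≠ 0 := by exact_mod_cast hq.ne'
  obtain ⟨r, hr, _⟩ := matrix_idem_trace ((q : ℂ)⁻¹ • E) (by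
    rw [smul_mul_smul_comm, h3, smul_smul]; congr 1; field_simp)
  rw [Matrix.trace_smul, smul_eq_mul] at hr
  refine ⟨q * r, ?_⟩
  push_cast
  rw [← hr]; field_simp

lemma trace_integral {m : ℕ} (M : Matrix (Fin m) (Fin m) ℂ) (k : ℕ) (hk : 0 < k) (hM : M ^ (k + 1) = M) : IsIntegral ℤ M.trace := by
  rw [Matrix.trace_eq_sum_roots_charpoly]
  apply IsIntegral.multiset_sum
  intro x hx
  have hr := Polynomial.isRoot_of_mem_roots hx
  rw [← Matrix.charpoly_toLin', ← Module.End.hasEigenvalue_iff_isRoot_charpoly] at hr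
  obtain ⟨v, hv⟩ := hr.exists_hasEigenvector
  have h1 := hv.pow_apply (k + 1)
  rw [← Matrix.toLin'_pow, hM, hv.apply_eq_smul] at h1
  have h2 : x ^ (k + 1) = x := (smul_left_injective ℂ hv.2 h1).symm
  refine ⟨Polynomial.X ^ (k + 1) - Polynomial.X, ?_, ?_⟩
  · exact Polynomial.monic_X_pow_sub (by
      rw [Polynomial.degree_X]; exact_mod_cast (by omega : 1 < k + 1))
  · simp [h2]

lemma trace_int {m : ℕ} (M : Matrix (Fin m) (Fin m) ℂ) (k : ℕ) (hk : 0 < k) (hM : M ^ (k + 1) = M)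
    (hc : ∀ j, 0 < j → Nat.Coprime j k → (M ^ j).trace = M.trace) : ∃ z : ℤ, M.trace = z := by
  have hrat : ∃ r : ℚ, M.trace = (r : ℂ) := by
    have h1 := moebius_coprime k hk (fun j => (M ^ j).trace)
    have h2 : ∑ j ∈ (Icc 1 k).filter (fun j => Nat.Coprime j k), (M ^ j).trace = (((Icc 1 k).filter (fun j => Nat.Coprime j k)).card : ℂ) * M.trace := by
      rw [sum_congr rfl (g := fun _ => M.trace)]
      · simp
      · intro j hj
        rw [mem_filter, mem_Icc] at hj
        exact hc j hj.1.1 hj.2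
    have h3 : ∀ d ∈ k.divisors, ∃ r : ℚ, ∑ j ∈ (Icc 1 k).filter (fun j => d ∣ j), (M ^ j).trace = (r : ℂ) := by
      intro d hd
      obtain ⟨⟨q, rfl⟩, _⟩ := Nat.mem_divisors.1 hd
      have hd0 : 0 < d := Nat.pos_of_mul_pos_right hk
      have hq0 : 0 < q := Nat.pos_of_mul_pos_left hk
      obtain ⟨r, hr⟩ := power_idem (M ^ d) q hq0 (by
        rw [← pow_mul, mul_add, mul_one]
        obtain ⟨d', rfl⟩ : ∃ d', d = d' + 1 := ⟨d - 1, by omega⟩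
        rw [show (d' + 1) * q + (d' + 1) = ((d' + 1) * q + 1) + d' by ring, pow_add, hM, ← pow_succ'])
      refine ⟨r, ?_⟩
      rw [← hr, Matrix.trace_sum]
      symm
      refine sum_bij (fun l _ => d * (l + 1)) ?_ ?_ ?_ ?_
      · intro l hl
        rw [mem_range] at hl
        simp only [mem_filter, mem_Icc, dvd_mul_right, and_true]
        exact ⟨Nat.mul_pos hd0 (by omega), Nat.mul_le_mul_left _ hl⟩
      · intro a _ b _ hab
        have := Nat.eq_of_mul_eq_mul_left hd0 hab
        omega
      · intro j hj
        simp only [mem_filter, mem_Icc] at hj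
        obtain ⟨⟨h1, h2⟩, ⟨l, rfl⟩⟩ := hj
        have hl0 : 0 < l := Nat.pos_of_mul_pos_left h1
        have := Nat.le_of_mul_le_mul_left h2 hd0
        exact ⟨l - 1, by rw [mem_range]; omega, by rw [Nat.sub_add_cancel hl0]⟩
      · intro l _
        rw [pow_mul]
    choose! r hr using h3
    rw [h2, sum_congr rfl fun d hd => by rw [hr d hd]] at h1
    have hne : (((Icc 1 k).filter (fun j => Nat.Coprime j k)).card : ℂ) ≠ 0 := by
      have : 1 ∈ (Icc 1 k).filter (fun j => Nat.Coprime j k) := by simp; omega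
      exact_mod_cast (card_pos.2 ⟨_, this⟩).ne'
    refine ⟨(∑ d ∈ k.divisors, (ArithmeticFunction.moebius d : ℚ) * r d) / ((Icc 1 k).filter (fun j => Nat.Coprime j k)).card, ?_⟩
    push_cast
    rw [← h1]; field_simp
  obtain ⟨r, hr⟩ := hrat
  have hi := trace_integral M k hk hM
  rw [hr, show (r : ℂ) = algebraMap ℚ ℂ r by simp, isIntegral_algebraMap_iff (algebraMap ℚ ℂ).injective] at hi
  obtain ⟨z, hz⟩ := IsIntegrallyClosed.isIntegral_iff.1 hi
  exact ⟨z, by rw [hr, ← hz]; simp⟩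

section
variable {α X : Type} [Fintype α] [DecidableEq α] [Fintype X] [DecidableEq X]

lemma JJ_mul {r : ℕ} (e : α ⊕ Fin r ≃ X) (c c' : Perm α) (s s' : Perm (Fin r)) : JJ e c s * JJ e c' s' = JJ e (c * c') (s * s') := by
  ext x
  simp only [JJ, Perm.mul_apply, permCongr_apply, symm_apply_apply]
  rcases e.symm x with a | b <;> simp

lemma JJ_one {r : ℕ} (e : α ⊕ Fin r ≃ X) : JJ e 1 1 = 1 := by
  ext x
  simp only [JJ, permCongr_apply]
  obtain ⟨y, rfl⟩ := e.surjective x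
  rcases y with a | b <;> simp

/-- inclusion of the complementary symmetric group -/
def JR {r : ℕ} (e : α ⊕ Fin r ≃ X) : Perm (Fin r) →* Perm X where
  toFun s := JJ e 1 s
  map_one' := JJ_one e
  map_mul' a b := by rw [JJ_mul, one_mul]

def JL {r : ℕ} (e : α ⊕ Fin r ≃ X) : Perm α →* Perm X where
  toFun c := JJ e c 1
  map_one' := JJ_one e
  map_mul' a b := by rw [JJ_mul, one_mul]

lemma JJ_eq {r : ℕ} (e : α ⊕ Fin r ≃ X) (c : Perm α) (s : Perm (Fin r)) : JJ e c s = JL e c * JR e s := by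
  change _ = JJ e c 1 * JJ e 1 s
  rw [JJ_mul, one_mul, mul_one]

lemma JJ_eq' {r : ℕ} (e : α ⊕ Fin r ≃ X) (c : Perm α) (s : Perm (Fin r)) : JJ e c s = JR e s * JL e c := by
  change _ = JJ e 1 s * JJ e c 1
  rw [JJ_mul, one_mul, mul_one]

variable (W : WD (Perm X)) {r : ℕ} (e : α ⊕ Fin r ≃ X)

noncomputable def PP (i : Fin W.N) : Matrix (Fin (W.d i)) (Fin (W.d i)) ℂ := avgM ((W.ρ i).comp (JR e))

lemma PP_comm (i : Fin W.N) (c : Perm α) : W.ρ i (JL e c) * PP W e i = PP W e i * W.ρ i (JL e c) := by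
  unfold PP avgM
  rw [mul_smul_comm, smul_mul_assoc, mul_sum, sum_mul]
  congr 1
  refine sum_congr rfl fun s _ => ?_
  rw [MonoidHom.comp_apply, ← map_mul, ← map_mul, ← JJ_eq, ← JJ_eq']

lemma coef_ES_PP (c : Perm α) (i : Fin W.N) : W.coef (fun π => ((ES c π).card : ℝ)) i = (W.ρ i (JL e c) * PP W e i).trace := by
  rw [coef_ES W e c i]
  unfold PP avgM
  rw [mul_smul_comm, Matrix.trace_smul, Matrix.mul_sum, Matrix.trace_sum, Fintype.card_perm, Fintype.card_fin, smul_eq_mul]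
  congr 1
  refine sum_congr rfl fun s _ => ?_
  rw [MonoidHom.comp_apply, ← map_mul, ← JJ_eq]; rfl

lemma QQ_pow (c : Perm α) (i : Fin W.N) (j : ℕ) : (W.ρ i (JL e c) * PP W e i) ^ (j + 1) = W.ρ i (JL e (c ^ (j + 1))) * PP W e i := by
  have hP : PP W e i * PP W e i = PP W e i := avgM_idem _
  induction j with
  | zero => simp
  | succ j ih =>
    rw [pow_succ, ih, pow_succ c (j + 1), map_mul, map_mul, mul_assoc, ← mul_assoc (PP W e i), ← PP_comm, mul_assoc (W.ρ i (JL e c)), hP, mul_assoc]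

lemma QQ_conj (c g : Perm α) (i : Fin W.N) : (W.ρ i (JL e (g * c * g⁻¹)) * PP W e i).trace = (W.ρ i (JL e c) * PP W e i).trace := by
  rw [map_mul, map_mul, map_mul, map_mul, mul_assoc, PP_comm, ← mul_assoc, Matrix.trace_mul_comm, ← mul_assoc, ← mul_assoc, ← map_mul, ← map_mul]
  simp

lemma addRight_pow (k : ℕ) (j : ℕ) : (Equiv.addRight (1 : ZMod k)) ^ j = Equiv.addRight (j : ZMod k) := by
  induction j with
  | zero => ext x; simp
  | succ j ih => rw [pow_succ, ih]; ext x; simp only [Perm.mul_apply, coe_addRight]; push_cast; ring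

lemma addRight_conj (k j : ℕ) (hj : Nat.Coprime j k) : ∃ g : Perm (ZMod k), g * Equiv.addRight (1 : ZMod k) * g⁻¹ = (Equiv.addRight (1 : ZMod k)) ^ j := by
  refine ⟨Units.mulLeft (ZMod.unitOfCoprime j hj), ?_⟩
  rw [addRight_pow, mul_inv_eq_iff_eq_mul]
  ext x
  simp [mul_add]

lemma coef_Bk_int (k : ℕ) (hk : 0 < k) (i : Fin W.N) : ∃ z : ℤ, W.coef (fun π => (Bk k π : ℝ)) i = z := by
  have : NeZero k := ⟨hk.ne'⟩
  by_cases hkn : k ≤ Fintype.card X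
  · obtain ⟨r, hr⟩ := Nat.exists_eq_add_of_le hkn
    have e : ZMod k ⊕ Fin r ≃ X := Fintype.equivOfCardEq (by simp [hr, ZMod.card])
    simp only [Bk_eq_ES]
    rw [coef_ES_PP W e]
    refine trace_int _ k hk ?_ ?_
    · rw [QQ_pow, pow_succ, show (Equiv.addRight (1 : ZMod k)) ^ k = 1 by rw [addRight_pow]; ext x; simp, one_mul]
    · intro j hj hc
      obtain ⟨g, hg⟩ := addRight_conj k j hc
      obtain ⟨j', rfl⟩ : ∃ j', j = j' + 1 := ⟨j - 1, by omega⟩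
      rw [QQ_pow, ← hg, QQ_conj]
  · refine ⟨0, ?_⟩
    have : ∀ π : Perm X, Bk k π = 0 := fun π => by
      rw [Bk, card_eq_zero, filter_eq_empty_iff]
      intro x _ h
      exact hkn (h ▸ per_le π x)
    simp [WD.coef, this]
end

end Part5

section Part6
open Finset Equiv
set_option linter.unusedSectionVars false

section
variable {X : Type} [Fintype X] [DecidableEq X] {V : Type} [AddCommGroup V] [Module ℂ V] [FiniteDimensional ℂ V]

lemma exists_perm_embed {α : Type} (f h : α ↪ X) : ∃ g : Perm X, ∀ a, g (f a) = h a := by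
  classical
  let q := (Equiv.ofInjective _ f.injective).symm.trans (Equiv.ofInjective _ h.injective)
  refine ⟨Equiv.extendSubtype (p := fun x => x ∈ Set.range f) (q := fun x => x ∈ Set.range h) q, fun a => ?_⟩
  rw [Equiv.extendSubtype_apply_of_mem _ _ ⟨a, rfl⟩]
  simp only [q, Equiv.trans_apply]
  rw [show (⟨f a, ⟨a, rfl⟩⟩ : Set.range f) = Equiv.ofInjective _ f.injective a from rfl, Equiv.symm_apply_apply]
  rfl

/-- family of disjoint transpositions -/
def trp {ι : Type} (p : ι × Bool ↪ X) (a : ι) : Perm X := swap (p (a, false)) (p (a, true))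

lemma trp_commute {ι : Type} (p : ι × Bool ↪ X) (a b : ι) : Commute (trp p a) (trp p b) := by
  by_cases h : a = b
  · rw [h]
  · apply Perm.Disjoint.commute
    unfold trp
    rw [Perm.disjoint_iff_disjoint_support, Perm.support_swap (by simp), Perm.support_swap (by simp)]
    rw [Finset.disjoint_left]
    intro x hx hx'
    simp only [mem_insert, mem_singleton] at hx hx'
    rcases hx with rfl | rfl <;> rcases hx' with h' | h' <;> simp [h] at h'

lemma trp_conj {ι κ : Type} (p : ι × Bool ↪ X) (q : κ × Bool ↪ X) (j : κ → ι) (g : Perm X) (hg : ∀ a, g (q a) = p (j a.1, a.2)) (b : κ) :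
    trp p (j b) * g = g * trp q b := by
  have h1 : g (q (b, false)) = p (j b, false) := hg (b, false)
  have h2 : g (q (b, true)) = p (j b, true) := hg (b, true)
  unfold trp
  rw [← h1, ← h2, Equiv.swap_apply_apply, inv_mul_cancel_right]

variable (R : Perm X →* Module.End ℂ V)

lemma swap_act_sq (t : Perm X) (ht : t * t = 1) (v : V) : R t (R t v) = v := by
  rw [← Module.End.mul_apply, ← map_mul, ht, map_one]; rfl

lemma trp_sq {ι : Type} (p : ι × Bool ↪ X) (a : ι) : trp p a * trp p a = 1 := swap_mul_self _ _

lemma joint_ext {ι : Type} [Fintype ι] [DecidableEq ι] (p : ι × Bool ↪ X) (S : Finset ι) (w0 : ι → ℂ) (hw0 : ∀ a, w0 a = 1 ∨ w0 a = -1)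
    (v : V) (hv : v ≠ 0) (h : ∀ a ∈ S, R (trp p a) v = w0 a • v) :
    ∃ (w : ι → ℂ) (v' : V), v' ≠ 0 ∧ (∀ a, w a = 1 ∨ w a = -1) ∧ (∀ a ∈ S, w a = w0 a) ∧ ∀ a, R (trp p a) v' = w a • v' := by
  suffices H : ∀ s : Finset ι, ∃ (w : ι → ℂ) (v' : V), v' ≠ 0 ∧ (∀ a, w a = 1 ∨ w a = -1) ∧ (∀ a ∈ S, w a = w0 a) ∧ (∀ a ∈ S, R (trp p a) v' = w a • v') ∧ ∀ a ∈ s, R (trp p a) v' = w a • v' by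
    obtain ⟨w, v', h1, h2, h3, _, h4⟩ := H univ
    exact ⟨w, v', h1, h2, h3, fun a => h4 a (mem_univ _)⟩
  intro s
  induction s using Finset.induction_on with
  | empty => exact ⟨w0, v, hv, hw0, fun _ _ => rfl, h, by simp⟩
  | insert b s hb ih =>
    obtain ⟨w, u, h1, h2, h3, h4, h5⟩ := ih
    by_cases hbS : b ∈ S
    · refine ⟨w, u, h1, h2, h3, h4, fun a ha => ?_⟩
      rcases mem_insert.1 ha with rfl | ha
      · exact h4 a hbS
      · exact h5 a ha
    · have hcomm : ∀ a, R (trp p a) (R (trp p b) u) = R (trp p b) (R (trp p a) u) := by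
        intro a
        rw [← Module.End.mul_apply, ← map_mul, (trp_commute p a b).eq, map_mul, Module.End.mul_apply]
      have hsq := swap_act_sq R _ (trp_sq p b) u
      obtain ⟨z, hz, hne⟩ : ∃ z : ℂ, (z = 1 ∨ z = -1) ∧ u + z • R (trp p b) u ≠ 0 := by
        by_contra hc
        push Not at hc
        have e1 := hc 1 (Or.inl rfl)
        have e2 := hc (-1) (Or.inr rfl)
        rw [one_smul] at e1
        rw [neg_smul, one_smul] at e2
        have : (2 : ℂ) • u = 0 := by
          rw [two_smul]
          calc u + u = (u + R (trp p b) u) + (u + -R (trp p b) u) := by abel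
            _ = 0 := by rw [e1, e2, add_zero]
        exact h1 ((smul_eq_zero.1 this).resolve_left two_ne_zero)
      have hzz : z * z = 1 := by rcases hz with rfl | rfl <;> norm_num
      have hgen : ∀ a, R (trp p a) u = w a • u → R (trp p a) (u + z • R (trp p b) u) = w a • (u + z • R (trp p b) u) := by
        intro a ha
        rw [map_add, map_smul, hcomm, ha, map_smul, smul_add, smul_comm]
      refine ⟨Function.update w b z, _, hne, ?_, ?_, ?_, ?_⟩
      · intro a
        by_cases hab : a = b
        · subst hab; simpa using hz
        · simpa [hab] using h2 a
      · intro a ha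
        rw [Function.update_of_ne (by rintro rfl; exact hbS ha)]; exact h3 a ha
      · intro a ha
        rw [Function.update_of_ne (by rintro rfl; exact hbS ha)]; exact hgen a (h4 a ha)
      · intro a ha
        by_cases hab : a = b
        · subst hab
          rw [Function.update_self, map_add, map_smul, hsq, smul_add, smul_smul, hzz, one_smul, add_comm]
        · rw [Function.update_of_ne hab]
          exact hgen a (h5 a ((mem_insert.1 ha).resolve_left hab))

lemma dim_ge {ι β : Type} [Fintype β] [Fintype ι] [DecidableEq ι] (p : ι × Bool ↪ X) (w : ι → ℂ) (v : V) (hv : v ≠ 0)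
    (h : ∀ a, R (trp p a) v = w a • v) (g : β → Perm ι) (hg : Function.Injective fun b a => w (g b a)) :
    Fintype.card β ≤ Module.finrank ℂ V := by
  have h1 : ∀ b, ∃ G : Perm X, ∀ a, G (p a) = p ((g b)⁻¹ a.1, a.2) := by
    intro b
    exact exists_perm_embed p ⟨fun a => p ((g b)⁻¹ a.1, a.2), fun a a' h => by
      have := p.injective h
      simp only [Prod.mk.injEq, EmbeddingLike.apply_eq_iff_eq] at this
      exact Prod.ext this.1 this.2⟩
  choose G hG using h1
  have hw : ∀ b a, R (trp p a) (R (G b) v) = w (g b a) • R (G b) v := by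
    intro b a
    have : trp p a * G b = G b * trp p (g b a) := by
      have := trp_conj p p (fun a => (g b)⁻¹ a) (G b) (hG b) (g b a)
      rwa [show (g b)⁻¹ (g b a) = a by simp] at this
    rw [← Module.End.mul_apply, ← map_mul, this, map_mul, Module.End.mul_apply, h, map_smul]
  have hind := Module.End.independent_iInf_maxGenEigenspace_of_forall_mapsTo (fun a => R (trp p a)) (by
    intro i j φ
    exact Module.End.mapsTo_maxGenEigenspace_of_comm (((trp_commute p j i).map R)) φ)
  have hli := iSupIndep.linearIndependent _ (hind.comp hg) (v := fun b => R (G b) v) (by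
    intro b
    simp only [Submodule.mem_iInf, Function.comp]
    intro a
    apply Module.End.mem_maxGenEigenspace _ _ _ |>.2
    exact ⟨1, by simp [hw]⟩) (by
    intro b hb
    apply hv
    have := congrArg (R (G b)⁻¹) hb
    rw [← Module.End.mul_apply, ← map_mul] at this
    simpa using this)
  exact hli.fintype_card_le_finrank
end

end Part6

section Part7
open Finset Equiv
set_option linter.unusedSectionVars false

section
variable {X : Type} [Fintype X] [DecidableEq X] {V : Type} [AddCommGroup V] [Module ℂ V] [FiniteDimensional ℂ V]
variable (R : Perm X →* Module.End ℂ V)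

lemma R_mul_apply (a b : Perm X) (v : V) : R (a * b) v = R a (R b v) := by
  rw [map_mul]; rfl

lemma R_inj (g : Perm X) {v : V} (hv : v ≠ 0) : R g v ≠ 0 := by
  intro h
  apply hv
  have := congrArg (R g⁻¹) h
  rw [← R_mul_apply] at this
  simpa using this

lemma dim_pattern {ι κ : Type} [Fintype ι] [DecidableEq ι] [Fintype κ] (p : ι × Bool ↪ X) (q : κ × Bool ↪ X) (j : κ ↪ ι) (w0 : κ → ℂ)
    (hw0 : ∀ b, w0 b = 1 ∨ w0 b = -1) (v : V) (hv : v ≠ 0) (h : ∀ b, R (trp q b) v = w0 b • v) :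
    ∃ (w : ι → ℂ) (v' : V), v' ≠ 0 ∧ (∀ a, w a = 1 ∨ w a = -1) ∧ (∀ b, w (j b) = w0 b) ∧ ∀ a, R (trp p a) v' = w a • v' := by
  classical
  obtain ⟨g, hg⟩ := exists_perm_embed q ⟨fun a => p (j a.1, a.2), fun a a' h => by
      have := p.injective h
      simp only [Prod.mk.injEq, EmbeddingLike.apply_eq_iff_eq] at this
      exact Prod.ext this.1 this.2⟩
  have hc := trp_conj p q j g hg
  have hex : ∀ b, Function.extend j w0 (fun _ => 1) (j b) = w0 b := fun b => j.injective.extend_apply _ _ _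
  obtain ⟨w, v', h1, h2, h3, h4⟩ := joint_ext R p (univ.map j) (Function.extend j w0 (fun _ => 1)) (by
    intro a
    by_cases ha : ∃ b, j b = a
    · obtain ⟨b, rfl⟩ := ha
      rw [hex]; exact hw0 b
    · rw [Function.extend_apply' _ _ _ ha]; exact Or.inl rfl) (R g v) (R_inj R g hv) (by
    intro a ha
    obtain ⟨b, -, rfl⟩ := mem_map.1 ha
    rw [← R_mul_apply, hc, R_mul_apply, h, map_smul, hex])
  exact ⟨w, v', h1, h2, fun b => by rw [h3 _ (mem_map_of_mem j (mem_univ b)), hex], h4⟩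

lemma swap_family {ι : Type} [DecidableEq ι] (w : ι → ℂ) (hw : ∀ a, w a = 1 ∨ w a = -1) (x y : ι) (hx : w x = -1) (hy : w y = 1) :
    ∃ g : {a // a ≠ y} → Perm ι, Function.Injective fun b a => w (g b a) := by
  classical
  refine ⟨fun a => if w a = -1 then swap a.1 y else swap a.1 x, ?_⟩
  have hne : (1 : ℂ) ≠ -1 := by norm_num
  have hxy : x ≠ y := by rintro rfl; rw [hx] at hy; exact hne hy.symm
  rintro ⟨a, ha⟩ ⟨b, hb⟩ h
  simp only at h
  rw [Subtype.mk.injEq]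
  by_contra hab
  have h1 := congrFun h a
  have h2 := congrFun h b
  have h3 := congrFun h y
  rcases hw a with wa | wa <;> rcases hw b with wb | wb <;>
    simp only [wa, wb, hne, if_true, if_false, swap_apply_left, swap_apply_right] at h1 h2 h3
  · have : a ≠ x := by rintro rfl; rw [hx] at wa; exact hne wa.symm
    rw [swap_apply_of_ne_of_ne hab this, wa, hx] at h1
    exact hne h1.symm
  · rw [swap_apply_of_ne_of_ne (Ne.symm ha) hxy.symm, hy] at h3
    exact hne h3
  · rw [swap_apply_of_ne_of_ne (Ne.symm hb) hxy.symm, hy] at h3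
    exact hne h3.symm
  · rw [swap_apply_of_ne_of_ne hab ha, wa, hy] at h1
    exact hne h1

lemma exists_trp {κ : Type} (t : κ → Perm X) (ht : ∀ k, (t k).IsSwap) (hd : ∀ k l, k ≠ l → (t k).Disjoint (t l)) :
    ∃ q : κ × Bool ↪ X, ∀ k, trp q k = t k := by
  choose x y hxy h using ht
  refine ⟨⟨fun a => if a.2 then y a.1 else x a.1, ?_⟩, fun k => (h k).symm⟩
  have key : ∀ k l, k ≠ l → Disjoint ({x k, y k} : Finset X) {x l, y l} := by
    intro k l hkl
    have := hd k l hkl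
    rw [Perm.disjoint_iff_disjoint_support, h, h, Perm.support_swap (hxy _), Perm.support_swap (hxy _)] at this
    exact this
  rintro ⟨k, b⟩ ⟨l, c⟩ he
  by_cases hkl : k = l
  · subst hkl
    have := hxy k
    have h' := this.symm
    cases b <;> cases c <;> simp_all
  · exfalso
    have := key k l hkl
    simp only [disjoint_insert_left, disjoint_singleton_left, mem_insert, mem_singleton, not_or] at this
    cases b <;> cases c <;> simp_all

def NA : Prop := ∀ (t : Fin 4 → Perm X), (∀ k, (t k).IsSwap) → (∀ k l, k ≠ l → (t k).Disjoint (t l)) → ∀ v : V,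
  R (t 0) v = -v → R (t 1) v = v → R (t 2) v = -v → R (t 3) v = v → v = 0

def NB : Prop := ∀ (t : Fin 2 → Perm X), (∀ k, (t k).IsSwap) → (∀ k l, k ≠ l → (t k).Disjoint (t l)) → ∀ v : V,
  R (t 0) v = -v → R (t 1) v = v → v = 0

lemma dimB (m : ℕ) (hm : 2 ≤ m) (hX : 2 * m ≤ Fintype.card X) (h : ¬ NB R) : m - 1 ≤ Module.finrank ℂ V := by
  unfold NB at h
  push Not at h
  obtain ⟨t, ht, hd, v, h0, h1, hv⟩ := h
  obtain ⟨q, hq⟩ := exists_trp t ht hd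
  obtain ⟨p⟩ : Nonempty (Fin m × Bool ↪ X) := Function.Embedding.nonempty_of_card_le (by simp; omega)
  obtain ⟨w, v', hv', hw, hj, he⟩ := dim_pattern R p q (Fin.castLEEmb hm) ![-1, 1] (by intro b; fin_cases b <;> simp) v hv
    (by intro b; rw [hq]; fin_cases b <;> simp [h0, h1])
  obtain ⟨g, hg⟩ := swap_family w hw _ _ (hj 0) (hj 1)
  have := dim_ge R p w v' hv' he g hg
  simpa [Fintype.card_subtype_compl] using this

lemma dimA (m : ℕ) (hm : 2 ≤ m) (hX : 4 * m ≤ Fintype.card X) (h : ¬ NA R) : (m - 1) ^ 2 ≤ Module.finrank ℂ V := by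
  unfold NA at h
  push Not at h
  obtain ⟨t, ht, hd, v, h0, h1, h2, h3, hv⟩ := h
  obtain ⟨q, hq⟩ := exists_trp t ht hd
  obtain ⟨p⟩ : Nonempty ((Fin m ⊕ Fin m) × Bool ↪ X) := Function.Embedding.nonempty_of_card_le (by simp; omega)
  let j : Fin 4 ↪ Fin m ⊕ Fin m := ⟨![Sum.inl ⟨0, by omega⟩, Sum.inl ⟨1, by omega⟩, Sum.inr ⟨0, by omega⟩, Sum.inr ⟨1, by omega⟩], by
    intro a b; fin_cases a <;> fin_cases b <;> simp⟩
  obtain ⟨w, v', hv', hw, hj, he⟩ := dim_pattern R p q j ![-1, 1, -1, 1] (by intro b; fin_cases b <;> simp) v hv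
    (by intro b; rw [hq]; fin_cases b <;> simp [h0, h1, h2, h3])
  obtain ⟨g, hg⟩ := swap_family (fun a => w (Sum.inl a)) (fun a => hw _) _ _ (hj 0) (hj 1)
  obtain ⟨g', hg'⟩ := swap_family (fun a => w (Sum.inr a)) (fun a => hw _) _ _ (hj 2) (hj 3)
  have := dim_ge R p w v' hv' he (fun b : _ × _ => Equiv.sumCongr (g b.1) (g' b.2)) (by
    rintro ⟨a, a'⟩ ⟨b, b'⟩ hab
    have e1 : a = b := hg (funext fun x => by simpa using congrFun hab (Sum.inl x))
    have e2 : a' = b' := hg' (funext fun x => by simpa using congrFun hab (Sum.inr x))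
    rw [e1, e2])
  simpa [Fintype.card_subtype_compl, sq] using this

lemma fresh (S : Finset X) (h : S.card + 2 ≤ Fintype.card X) : ∃ t : Perm X, t.IsSwap ∧ t.support.card = 2 ∧ Disjoint S t.support := by
  have : 1 < Sᶜ.card := by rw [card_compl]; omega
  obtain ⟨a, ha, b, hb, hab⟩ := one_lt_card.1 this
  refine ⟨swap a b, ⟨a, b, hab, rfl⟩, Perm.card_support_swap hab, ?_⟩
  rw [Perm.support_swap hab, disjoint_insert_right, disjoint_singleton_right]
  exact ⟨mem_compl.1 ha, mem_compl.1 hb⟩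


lemma C1 (hR : NA R) (ε : ℂ) (hε : ε = 1 ∨ ε = -1) (t1 t2 t3 s : Perm X) (h1 : t1.IsSwap) (h2 : t2.IsSwap) (h3 : t3.IsSwap) (hs : s.IsSwap)
    (h12 : t1.Disjoint t2) (h13 : t1.Disjoint t3) (h1s : t1.Disjoint s) (h23 : t2.Disjoint t3) (h2s : t2.Disjoint s) (h3s : t3.Disjoint s)
    (v : V) (e1 : R t1 v = -(ε • v)) (e2 : R t2 v = ε • v) (e3 : R t3 v = ε • v) : R s v = ε • v := by
  have hss : s * s = 1 := by obtain ⟨a, b, -, rfl⟩ := hs; exact swap_mul_self a b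
  have hε2 : ε * ε = 1 := by rcases hε with rfl | rfl <;> norm_num
  have hsv : R s (R s v) = v := swap_act_sq R s hss v
  have comm : ∀ t : Perm X, t.Disjoint s → ∀ v, R t (R s v) = R s (R t v) := by
    intro t ht v
    rw [← R_mul_apply, ht.commute.eq, R_mul_apply]
  have f1 : R t1 (v - ε • R s v) = -(ε • (v - ε • R s v)) := by
    rw [map_sub, map_smul, comm _ h1s, e1, map_neg, map_smul]; module
  have f2 : R t2 (v - ε • R s v) = (ε • (v - ε • R s v)) := by
    rw [map_sub, map_smul, comm _ h2s, e2, map_smul]; module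
  have f3 : R t3 (v - ε • R s v) = (ε • (v - ε • R s v)) := by
    rw [map_sub, map_smul, comm _ h3s, e3, map_smul]; module
  have f4 : R s (v - ε • R s v) = -(ε • (v - ε • R s v)) := by
    rw [map_sub, map_smul, hsv, smul_sub, smul_smul, hε2]; module
  have u0 : v - ε • R s v = 0 := by
    obtain ⟨u, hu⟩ : ∃ u, u = v - ε • R s v := ⟨_, rfl⟩
    rw [← hu] at f1 f2 f3 f4 ⊢
    rcases hε with rfl | rfl
    · refine hR ![t1, t2, s, t3] (by intro k; fin_cases k <;> simpa) ?_ _ ?_ ?_ ?_ ?_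
      · intro k l hkl
        fin_cases k <;> fin_cases l <;> first | exact absurd rfl hkl | simpa | (refine Perm.Disjoint.symm ?_; simpa)
      · simpa using f1
      · simpa using f2
      · simpa using f4
      · simpa using f3
    · refine hR ![t2, t1, t3, s] (by intro k; fin_cases k <;> simpa) ?_ _ ?_ ?_ ?_ ?_
      · intro k l hkl
        fin_cases k <;> fin_cases l <;> first | exact absurd rfl hkl | simpa | (refine Perm.Disjoint.symm ?_; simpa)
      · simpa using f2
      · simpa using f1
      · simpa using f3
      · simpa using f4
  have : v = ε • R s v := sub_eq_zero.1 u0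
  conv_rhs => rw [this]
  rw [smul_smul, hε2, one_smul]

lemma swap_supp {t : Perm X} (ht : t.IsSwap) : t.support.card = 2 := by
  rwa [Perm.card_support_eq_two]

lemma C2 (hX : 12 ≤ Fintype.card X) (hR : NA R) (ε : ℂ) (hε : ε = 1 ∨ ε = -1) (t1 t2 t3 : Perm X) (h1 : t1.IsSwap) (h2 : t2.IsSwap) (h3 : t3.IsSwap)
    (h12 : t1.Disjoint t2) (h13 : t1.Disjoint t3) (h23 : t2.Disjoint t3)
    (v : V) (e1 : R t1 v = -(ε • v)) (e2 : R t2 v = ε • v) (e3 : R t3 v = ε • v) (s : Perm X) (hs : s.IsSwap) (h1s : t1.Disjoint s) : R s v = ε • v := by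
  have c1 := swap_supp h1
  have c2 := swap_supp h2
  have c3 := swap_supp h3
  have cs := swap_supp hs
  have b1 := card_union_le t1.support t2.support
  have b2 := card_union_le (t1.support ∪ t2.support) t3.support
  have b3 := card_union_le (t1.support ∪ t2.support ∪ t3.support) s.support
  obtain ⟨t4, h4, c4, d4⟩ := fresh (t1.support ∪ t2.support ∪ t3.support ∪ s.support) (by omega)
  have b4 := card_union_le (t1.support ∪ t2.support ∪ t3.support ∪ s.support) t4.support
  obtain ⟨t5, h5, c5, d5⟩ := fresh (t1.support ∪ t2.support ∪ t3.support ∪ s.support ∪ t4.support) (by omega)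
  simp only [disjoint_union_left, ← Perm.disjoint_iff_disjoint_support] at d4 d5
  obtain ⟨⟨⟨d14, d24⟩, d34⟩, ds4⟩ := d4
  obtain ⟨⟨⟨⟨d15, d25⟩, d35⟩, ds5⟩, d45⟩ := d5
  have e4 := C1 R hR ε hε t1 t2 t3 t4 h1 h2 h3 h4 h12 h13 d14 h23 d24 d34 v e1 e2 e3
  have e5 := C1 R hR ε hε t1 t2 t3 t5 h1 h2 h3 h5 h12 h13 d15 h23 d25 d35 v e1 e2 e3
  exact C1 R hR ε hε t1 t4 t5 s h1 h4 h5 hs d14 d15 h1s d45 ds4.symm ds5.symm v e1 e4 e5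

lemma exc (hX : 12 ≤ Fintype.card X) (hR : NA R) (hB : ¬ NB R) : ∃ (ε : ℂ) (x y : X) (u : V), (ε = 1 ∨ ε = -1) ∧ x ≠ y ∧ u ≠ 0 ∧
    ∀ a b, a ≠ b → a ≠ x → a ≠ y → b ≠ x → b ≠ y → R (swap a b) u = ε • u := by
  have fin : ∀ (ε : ℂ) (t1 : Perm X) (u : V), (ε = 1 ∨ ε = -1) → t1.IsSwap → u ≠ 0 → (∀ s : Perm X, s.IsSwap → t1.Disjoint s → R s u = ε • u) →
      ∃ (ε : ℂ) (x y : X) (u : V), (ε = 1 ∨ ε = -1) ∧ x ≠ y ∧ u ≠ 0 ∧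
      ∀ a b, a ≠ b → a ≠ x → a ≠ y → b ≠ x → b ≠ y → R (swap a b) u = ε • u := by
    rintro ε t1 u hε ⟨x, y, hxy, rfl⟩ hu h
    refine ⟨ε, x, y, u, hε, hxy, hu, fun a b hab ax ay bx bY => h _ ⟨a, b, hab, rfl⟩ ?_⟩
    rw [Perm.disjoint_iff_disjoint_support, Perm.support_swap hxy, Perm.support_swap hab]
    simp [disjoint_left, ax.symm, ay.symm, bx.symm, bY.symm]
  unfold NB at hB
  push Not at hB
  obtain ⟨t, ht, hd, v, e0, e1, hv⟩ := hB
  have c1 := swap_supp (ht 0)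
  have c2 := swap_supp (ht 1)
  have b1 := card_union_le (t 0).support (t 1).support
  obtain ⟨s, hs, cs, ds⟩ := fresh ((t 0).support ∪ (t 1).support) (by omega)
  simp only [disjoint_union_left, ← Perm.disjoint_iff_disjoint_support] at ds
  have h01 := hd 0 1 (by decide)
  have hss : s * s = 1 := by obtain ⟨a, b, -, rfl⟩ := hs; exact swap_mul_self a b
  have hsv : R s (R s v) = v := swap_act_sq R s hss v
  have comm : ∀ t : Perm X, t.Disjoint s → ∀ v, R t (R s v) = R s (R t v) := by
    intro t ht v
    rw [← R_mul_apply, ht.commute.eq, R_mul_apply]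
  by_cases hp : v + R s v = 0
  · have hm : v - R s v ≠ 0 := by
      intro hm
      apply hv
      have : (2 : ℂ) • v = (v + R s v) + (v - R s v) := by module
      rw [hp, hm, add_zero] at this
      exact (smul_eq_zero.1 this).resolve_left two_ne_zero
    refine fin (-1) (t 1) (v - R s v) (Or.inr rfl) (ht 1) hm (C2 R hX hR (-1) (Or.inr rfl) (t 1) (t 0) s (ht 1) (ht 0) hs h01.symm ds.2 ds.1 _ ?_ ?_ ?_)
    · rw [map_sub, comm _ ds.2, e1]; module
    · rw [map_sub, comm _ ds.1, e0, map_neg]; module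
    · rw [map_sub, hsv]; module
  · refine fin 1 (t 0) (v + R s v) (Or.inl rfl) (ht 0) hp (C2 R hX hR 1 (Or.inl rfl) (t 0) (t 1) s (ht 0) (ht 1) hs h01 ds.1 ds.2 _ ?_ ?_ ?_)
    · rw [map_add, comm _ ds.1, e0, map_neg]; module
    · rw [map_add, comm _ ds.2, e1]; module
    · rw [map_add, hsv]; module

lemma nb_eq (hX : 6 ≤ Fintype.card X) (hB : NB R) (s t : Perm X) (hs : s.IsSwap) (ht : t.IsSwap) : R s = R t := by
  have key : ∀ s t : Perm X, s.IsSwap → t.IsSwap → s.Disjoint t → R s = R t := by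
    intro s t hs ht hd
    have hss : s * s = 1 := by obtain ⟨a, b, -, rfl⟩ := hs; exact swap_mul_self a b
    have htt : t * t = 1 := by obtain ⟨a, b, -, rfl⟩ := ht; exact swap_mul_self a b
    have hst : ∀ v, R s (R t v) = R t (R s v) := by
      intro v
      rw [← R_mul_apply, hd.commute.eq, R_mul_apply]
    have h : ∀ s t : Perm X, s.IsSwap → t.IsSwap → s.Disjoint t → s * s = 1 → t * t = 1 → (∀ v, R s (R t v) = R t (R s v)) → 
        ∀ v, v + R t v - R s v - R s (R t v) = 0 := by
      intro s t hs ht hd hss htt hst v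
      refine hB ![s, t] (by intro k; fin_cases k <;> simpa) ?_ _ ?_ ?_
      · intro k l hkl
        fin_cases k <;> fin_cases l <;> first | exact absurd rfl hkl | simpa | (refine Perm.Disjoint.symm ?_; simpa)
      · simp only [Matrix.cons_val_zero, map_sub, map_add, swap_act_sq R s hss]; module
      · simp only [Matrix.cons_val_one, Matrix.cons_val_fin_one, map_sub, map_add, ← hst, swap_act_sq R t htt]; module
    ext v
    have h1 := h s t hs ht hd hss htt hst v
    have h2 := h t s ht hs hd.symm htt hss (fun v => (hst v).symm) v
    rw [hst] at h1
    have : (2 : ℂ) • (R s v - R t v) = (v + R s v - R t v - R t (R s v)) - (v + R t v - R s v - R t (R s v)) := by module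
    rw [h1, h2, sub_zero] at this
    exact sub_eq_zero.1 ((smul_eq_zero.1 this).resolve_left two_ne_zero)
  have c1 := swap_supp hs
  have c2 := swap_supp ht
  have b1 := card_union_le s.support t.support
  obtain ⟨r, hr, cr, dr⟩ := fresh (s.support ∪ t.support) (by omega)
  simp only [disjoint_union_left, ← Perm.disjoint_iff_disjoint_support] at dr
  rw [key s r hs hr dr.1, key t r ht hr dr.2]

end

end Part7

section Part8
open Finset Equiv
set_option linter.unusedSectionVars false

section
variable {X : Type} [Fintype X] [DecidableEq X] (W : WD (Perm X))

noncomputable def RR (i : Fin W.N) : Perm X →* Module.End ℂ (Fin (W.d i) → ℂ) :=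
  (MonoidHomClass.toMonoidHom (Matrix.toLinAlgEquiv' (R := ℂ) (n := Fin (W.d i)))).comp (W.ρ i)

lemma RR_apply (i : Fin W.N) (g : Perm X) (v : Fin (W.d i) → ℂ) : RR W i g v = (W.ρ i g).mulVec v := rfl

lemma RR_inj (i : Fin W.N) {g h : Perm X} (H : RR W i g = RR W i h) : W.ρ i g = W.ρ i h :=
  (Matrix.toLinAlgEquiv' (R := ℂ) (n := Fin (W.d i))).injective H

lemma dimA' (i : Fin W.N) (m : ℕ) (hm : 2 ≤ m) (hX : 4 * m ≤ Fintype.card X) (h : ¬ NA (RR W i)) : (m - 1) ^ 2 ≤ W.d i := by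
  simpa using dimA (RR W i) m hm hX h

lemma dimB' (i : Fin W.N) (m : ℕ) (hm : 2 ≤ m) (hX : 2 * m ≤ Fintype.card X) (h : ¬ NB (RR W i)) : m - 1 ≤ W.d i := by
  simpa using dimB (RR W i) m hm hX h

noncomputable def sgn (Y : Type) [Fintype Y] [DecidableEq Y] : Perm Y →* ℂ where
  toFun g := ((Perm.sign g : ℤ) : ℂ)
  map_one' := by simp
  map_mul' a b := by simp

lemma sgn_swap {Y : Type} [Fintype Y] [DecidableEq Y] (s : Perm Y) (hs : s.IsSwap) : sgn Y s = -1 := by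
  simp [sgn, hs.sign_eq]

lemma sgn_norm {Y : Type} [Fintype Y] [DecidableEq Y] (s : Perm Y) : ‖sgn Y s‖ = 1 := by
  rcases Int.units_eq_one_or (Perm.sign s) with h | h <;> simp [sgn, h]

/-- a representation without mixed pattern is one dimensional -/
lemma nb_class (hX : 6 ≤ Fintype.card X) (i : Fin W.N) (h : NB (RR W i)) :
    W.d i = 1 ∧ ((∀ g, W.chi i g = 1) ∨ ∀ g, W.chi i g = sgn X g) := by
  obtain ⟨t, ht, -⟩ := fresh (∅ : Finset X) (by simp; omega)
  have heq : ∀ s : Perm X, s.IsSwap → W.ρ i s = W.ρ i t := fun s hs => RR_inj W i (nb_eq (RR W i) hX h s t hs ht)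
  have hcomm : ∀ g, W.ρ i g * W.ρ i t = W.ρ i t * W.ρ i g := by
    intro g
    have h1 : (g * t * g⁻¹).IsSwap := by
      obtain ⟨a, b, hab, rfl⟩ := ht
      exact ⟨g a, g b, by simpa using hab, by rw [Equiv.swap_apply_apply]⟩
    have := heq _ h1
    calc W.ρ i g * W.ρ i t = W.ρ i (g * t * g⁻¹) * W.ρ i g := by rw [← map_mul, ← map_mul, inv_mul_cancel_right]
      _ = _ := by rw [this]
  obtain ⟨z, hz⟩ : ∃ z : ℂ, W.ρ i t = z • 1 := ⟨_, W.scalar_of_comm i _ hcomm⟩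
  have htt : t * t = 1 := by obtain ⟨a, b, -, rfl⟩ := ht; exact swap_mul_self a b
  let x0 : Fin (W.d i) := ⟨0, W.pos i⟩
  have hzz : z * z = 1 := by
    have h1 : W.ρ i t * W.ρ i t = 1 := by rw [← map_mul, htt, map_one]
    rw [hz, smul_mul_smul_comm, one_mul] at h1
    simpa using congrFun (congrFun h1 x0) x0
  have hz1 : z = 1 ∨ z = -1 := mul_self_eq_one_iff.1 hzz
  rcases hz1 with rfl | rfl
  · have hall : ∀ g, W.ρ i g = 1 := by
      intro g
      induction g using Perm.swap_induction_on with
      | one => simp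
      | swap_mul f x y hxy ih => rw [map_mul, ih, heq _ ⟨x, y, hxy, rfl⟩, hz]; simp
    have hd := W.d_eq_one_of_scalar i (fun g => ⟨1, by simp [hall]⟩)
    exact ⟨hd, Or.inl fun g => by simp [WD.chi, hall, hd]⟩
  · have hall : ∀ g, W.ρ i g = sgn X g • 1 := by
      intro g
      induction g using Perm.swap_induction_on with
      | one => simp
      | swap_mul f x y hxy ih => rw [map_mul, ih, heq _ ⟨x, y, hxy, rfl⟩, hz, map_mul, sgn_swap _ ⟨x, y, hxy, rfl⟩]; simp
    have hd := W.d_eq_one_of_scalar i (fun g => ⟨_, hall g⟩)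
    exact ⟨hd, Or.inr fun g => by simp [WD.chi, hall, hd]⟩

lemma JR_swap {r : ℕ} (e : Fin 2 ⊕ Fin r ≃ X) (a b : Fin r) : JR e (swap a b) = swap (e (Sum.inr a)) (e (Sum.inr b)) := by
  change JJ e 1 _ = _
  rw [JJ, show sumCongr (1 : Perm (Fin 2)) (swap a b) = Perm.sumCongr 1 (swap a b) from rfl, Perm.sumCongr_one_swap]
  ext x
  rw [Equiv.permCongr_apply, Equiv.swap_apply_def, Equiv.swap_apply_def]
  simp only [Equiv.symm_apply_eq]
  split_ifs <;> simp

lemma JR_inj {r : ℕ} (e : Fin 2 ⊕ Fin r ≃ X) : Function.Injective (JR e) := JJ_inj e 1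

lemma exc_avg (hX : 12 ≤ Fintype.card X) {r : ℕ} (e : Fin 2 ⊕ Fin r ≃ X) (i : Fin W.N) (hA : NA (RR W i)) (hB : ¬ NB (RR W i)) :
    avgM (W.twR (JR e) 1 i) ≠ 0 ∨ avgM (W.twR (JR e) (sgn (Fin r)) i) ≠ 0 := by
  obtain ⟨ε, x, y, u, hε, hxy, hu, h⟩ := exc (RR W i) hX hA hB
  obtain ⟨g, hg⟩ := exists_perm_embed (⟨![x, y], by intro a b; fin_cases a <;> fin_cases b <;> simp [hxy, hxy.symm]⟩ : Fin 2 ↪ X)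
    ⟨fun a => e (Sum.inl a), fun a b h => by simpa using h⟩
  have g0 : g x = e (Sum.inl 0) := hg 0
  have g1 : g y = e (Sum.inl 1) := hg 1
  have hu' := R_inj (RR W i) g hu
  have hs : ∀ a b : Fin r, a ≠ b → RR W i (JR e (swap a b)) (RR W i g u) = ε • RR W i g u := by
    intro a b hab
    have hk : JR e (swap a b) * g = g * swap (g⁻¹ (e (Sum.inr a))) (g⁻¹ (e (Sum.inr b))) := by
      rw [JR_swap, Equiv.swap_apply_apply]; group
    rw [← R_mul_apply, hk, R_mul_apply, h, map_smul]
    · simpa using hab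
    all_goals
      intro hh
      rw [Perm.inv_eq_iff_eq] at hh
      first | rw [g0] at hh | rw [g1] at hh
      simp at hh
  have fin : ∀ δ : Perm (Fin r) →* ℂ, (∀ a b, a ≠ b → δ (swap a b) * ε = 1) → avgM (W.twR (JR e) δ i) ≠ 0 := by
    intro δ hδ
    refine avgM_vec _ _ hu' ?_
    have key : ∀ k, δ k • RR W i (JR e k) (RR W i g u) = RR W i g u := by
      intro k
      induction k using Perm.swap_induction_on with
      | one => simp
      | swap_mul f x y hxy ih =>
        rw [map_mul, map_mul, R_mul_apply, mul_smul, ← map_smul, ih, hs _ _ hxy, smul_smul, hδ _ _ hxy, one_smul]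
    intro k
    have := key k
    rw [RR_apply, ← Matrix.smul_mulVec] at this
    exact this
  rcases hε with rfl | rfl
  · exact Or.inl (fin 1 (by simp))
  · exact Or.inr (fin _ (fun a b hab => by rw [sgn_swap _ ⟨a, b, hab, rfl⟩]; norm_num))

lemma coef_sgn_le (i : Fin W.N) (hi : ∀ g, W.chi i g = sgn X g) (k : ℕ) (hk : 0 < k) : ‖W.coef (fun π => (Bk k π : ℝ)) i‖ ≤ 1 := by
  have h := sum_Bk_le (X := X) k hk
  unfold WD.coef
  rw [norm_div, Fintype.card_perm, Complex.norm_natCast, div_le_one (by exact_mod_cast Nat.factorial_pos _)]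
  refine (norm_sum_le _ _).trans ?_
  simp only [hi, norm_mul, sgn_norm, mul_one, Complex.norm_real, Real.norm_natCast]
  exact_mod_cast h

lemma coef_sgn_zero (i : Fin W.N) (hi : ∀ g, W.chi i g = sgn X g) (k : ℕ) (hk : 0 < k) (hk2 : k + 2 ≤ Fintype.card X) : W.coef (fun π => (Bk k π : ℝ)) i = 0 := by
  have : NeZero k := ⟨hk.ne'⟩
  obtain ⟨r, hr⟩ := Nat.exists_eq_add_of_le (show k ≤ Fintype.card X by omega)
  have e : ZMod k ⊕ Fin r ≃ X := Fintype.equivOfCardEq (by simp [hr, ZMod.card])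
  simp only [Bk_eq_ES]
  rw [coef_ES W e]
  let a : Fin r := ⟨0, by omega⟩
  let b : Fin r := ⟨1, by omega⟩
  have hab : a ≠ b := by simp [a, b]
  set f : Perm (Fin r) → ℂ := fun s => W.chi i (JJ e (Equiv.addRight 1) s) with hf
  have h1 : ∀ s, f (swap a b * s) = - f s := by
    intro s
    simp only [hf, hi, JJ, sgn, MonoidHom.coe_mk, OneHom.coe_mk, Perm.sign_permCongr, Perm.sign_sumCongr, Perm.sign_mul, Perm.sign_swap hab]
    push_cast; ring
  have h2 : ∑ s, f s = - ∑ s, f s := by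
    conv_lhs => rw [← Equiv.sum_comp (Equiv.mulLeft (swap a b))]
    simp [h1]
  have h3 : ∑ s, f s = 0 := by
    exact self_eq_neg.1 h2
  rw [h3, mul_zero]
end

end Part8

section Part9
open Finset Equiv
set_option linter.unusedSectionVars false

section
variable {X : Type} [Fintype X] [DecidableEq X] (W : WD (Perm X))

noncomputable def ff (π : Perm X) : ℝ := ∑ k ∈ Icc 2 (Fintype.card X), (Bk k π : ℝ) / k

lemma ff_conj (g τ : Perm X) : ff (τ * g * τ⁻¹) = ff g := by simp [ff, Bk_conj]
lemma ff_inv (g : Perm X) : ff g⁻¹ = ff g := by simp [ff, Bk_inv]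

lemma coef_ff (i : Fin W.N) : W.coef ff i = ∑ k ∈ Icc 2 (Fintype.card X), W.coef (fun π => (Bk k π : ℝ)) i / k := by
  unfold WD.coef ff
  push_cast
  simp only [sum_mul]
  rw [sum_comm, sum_div]
  refine sum_congr rfl fun k _ => ?_
  rw [div_right_comm]
  congr 1
  rw [sum_div]
  refine sum_congr rfl fun π _ => by ring

lemma exists_coefs : ∃ (z : ℕ → Fin W.N → ℤ) (a : Fin W.N → ℝ),
    (∀ k, 0 < k → ∀ i, W.coef (fun π => (Bk k π : ℝ)) i = z k i) ∧ (∀ i, W.coef ff i = a i) ∧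
    ∀ i, a i = ∑ k ∈ Icc 2 (Fintype.card X), (z k i : ℝ) / k := by
  have : ∀ k i, ∃ z : ℤ, 0 < k → W.coef (fun π => (Bk k π : ℝ)) i = z := by
    intro k i
    by_cases hk : 0 < k
    · obtain ⟨z, hz⟩ := coef_Bk_int W k hk i
      exact ⟨z, fun _ => hz⟩
    · exact ⟨0, fun h => absurd h hk⟩
  choose z hz using this
  refine ⟨z, fun i => ∑ k ∈ Icc 2 (Fintype.card X), (z k i : ℝ) / k, fun k hk i => hz k i hk, fun i => ?_, fun i => rfl⟩
  rw [coef_ff]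
  push_cast
  refine sum_congr rfl fun k hk => ?_
  rw [hz k i (by have := (mem_Icc.1 hk).1; omega)]

lemma sq_z {z : ℕ → Fin W.N → ℤ} (hz : ∀ k, 0 < k → ∀ i, W.coef (fun π => (Bk k π : ℝ)) i = z k i) (k : ℕ) (hk : 0 < k) :
    ∑ i, (z k i : ℝ) ^ 2 ≤ 1 + k := by
  have h := W.parseval (fun π => (Bk k π : ℝ)) (fun π => (Bk k π : ℝ)) (by simp [Bk_conj]) (by simp [Bk_inv])
  simp only [hz k hk] at h
  have h' : ∑ i, (z k i : ℝ) ^ 2 = (∑ g : Perm X, (Bk k g : ℝ) * Bk k g) / Fintype.card (Perm X) := by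
    simp only [sq]; exact_mod_cast h
  rw [h', Fintype.card_perm, div_le_iff₀ (by exact_mod_cast Nat.factorial_pos _)]
  have := sum_Bk_mul_le (X := X) k k hk hk
  simp only [if_true] at this
  exact_mod_cast this

lemma sq_a {a : Fin W.N → ℝ} (ha : ∀ i, W.coef ff i = a i) (h : ℝ) (hh : h = ∑ k ∈ Icc 2 (Fintype.card X), (1 : ℝ) / k) :
    ∑ i, (a i) ^ 2 ≤ h ^ 2 + h := by
  have hp := W.parseval ff ff (fun g τ => ff_conj g τ) ff_inv
  simp only [ha] at hp
  have h' : ∑ i, (a i) ^ 2 = (∑ g : Perm X, ff g * ff g) / Fintype.card (Perm X) := by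
    simp only [sq]; exact_mod_cast hp
  rw [h', Fintype.card_perm, div_le_iff₀ (by exact_mod_cast Nat.factorial_pos _)]
  have e1 : ∑ g : Perm X, ff g * ff g = ∑ k ∈ Icc 2 (Fintype.card X), ∑ l ∈ Icc 2 (Fintype.card X), (∑ g : Perm X, (Bk k g : ℝ) * Bk l g) / (k * l) := by
    simp only [ff, sum_mul_sum, sum_div]
    rw [sum_comm]
    refine sum_congr rfl fun k _ => ?_
    rw [sum_comm]
    refine sum_congr rfl fun l _ => ?_
    refine sum_congr rfl fun g _ => ?_
    rw [div_mul_div_comm]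
  have e2 : ∀ k ∈ Icc 2 (Fintype.card X), ∀ l ∈ Icc 2 (Fintype.card X), (∑ g : Perm X, (Bk k g : ℝ) * Bk l g) / (k * l) ≤
      (1 / k * (1 / l) + if k = l then 1 / (k : ℝ) else 0) * ((Fintype.card X).factorial : ℝ) := by
    intro k hk l hl
    have hk0 : 0 < k := by have := (mem_Icc.1 hk).1; omega
    have hl0 : 0 < l := by have := (mem_Icc.1 hl).1; omega
    have hk1 : (0 : ℝ) < k := by exact_mod_cast hk0
    have hl1 : (0 : ℝ) < l := by exact_mod_cast hl0
    have := sum_Bk_mul_le (X := X) k l hk0 hl0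
    have hr : ∑ g : Perm X, (Bk k g : ℝ) * Bk l g ≤ (1 + if k = l then (k : ℝ) else 0) * ((Fintype.card X).factorial : ℝ) := by
      exact_mod_cast this
    rw [div_le_iff₀ (by positivity)]
    refine hr.trans (le_of_eq ?_)
    split_ifs with hkl
    · subst hkl; field_simp
    · field_simp; simp
  rw [e1]
  refine (sum_le_sum fun k hk => sum_le_sum fun l hl => e2 k hk l hl).trans (le_of_eq ?_)
  simp only [← sum_mul]
  congr 1
  simp only [sum_add_distrib]
  rw [← sum_mul_sum, ← hh, sq]
  congr 1
  rw [hh]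
  refine sum_congr rfl fun k hk => ?_
  rw [sum_ite_eq, if_pos hk]

lemma ff_triv {i : Fin W.N} (hi : ∀ g, W.chi i g = 1) : W.coef ff i = ((∑ k ∈ Icc 2 (Fintype.card X), (1 : ℝ) / k : ℝ) : ℂ) := by
  rw [W.coef_triv ff hi]
  congr 1
  unfold ff
  rw [sum_comm, sum_div]
  refine sum_congr rfl fun k hk => ?_
  have hk' := mem_Icc.1 hk
  have := sum_Bk (X := X) k (by omega) hk'.2
  have h2 : ∑ π : Perm X, (Bk k π : ℝ) = ((Fintype.card X).factorial : ℝ) := by exact_mod_cast this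
  have h3 : ((Fintype.card X).factorial : ℝ) ≠ 0 := by exact_mod_cast Nat.factorial_ne_zero _
  rw [← sum_div, h2, Fintype.card_perm]
  field_simp

lemma sgn_part {z : ℕ → Fin W.N → ℤ} (hz : ∀ k, 0 < k → ∀ i, W.coef (fun π => (Bk k π : ℝ)) i = z k i) {a : Fin W.N → ℝ}
    (ha : ∀ i, a i = ∑ k ∈ Icc 2 (Fintype.card X), (z k i : ℝ) / k) (hX : 4 ≤ Fintype.card X) (i : Fin W.N) (hi : ∀ g, W.chi i g = sgn X g) :
    |a i| ≤ 4 / Fintype.card X := by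
  set n := Fintype.card X with hn
  have hn' : (4 : ℝ) ≤ n := by exact_mod_cast hX
  rw [ha]
  refine (abs_sum_le_sum_abs _ _).trans ?_
  have hsub : ({n - 1, n} : Finset ℕ) ⊆ Icc 2 n := by
    intro k hk
    simp only [mem_insert, mem_singleton] at hk
    rw [mem_Icc]; omega
  rw [← sum_subset hsub]
  · rw [sum_pair (by omega)]
    have hb : ∀ k, n - 1 ≤ k → |(z k i : ℝ) / k| ≤ 2 / n := by
      intro k hk
      have h1 := coef_sgn_le W i hi k (by omega)
      rw [hz k (by omega), Complex.norm_intCast] at h1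
      have hk' : (n : ℝ) / 2 ≤ k := by
        have : n ≤ k + 1 := by omega
        have : (n : ℝ) ≤ k + 1 := by exact_mod_cast this
        linarith
      rw [abs_div, Nat.abs_cast, div_le_div_iff₀ (by linarith) (by linarith)]
      nlinarith
    have := hb (n - 1) le_rfl
    have := hb n (by omega)
    calc _ ≤ 2 / (n : ℝ) + 2 / n := by linarith
      _ = _ := by ring
  · intro k hk hk'
    simp only [mem_insert, mem_singleton, mem_Icc, not_or] at hk hk'
    have := coef_sgn_zero W i hi k (by omega) (by omega)
    rw [hz k (by omega)] at this
    have : (z k i) = 0 := by exact_mod_cast this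
    simp [this]

lemma A_part {z : ℕ → Fin W.N → ℤ} (hz : ∀ k, 0 < k → ∀ i, W.coef (fun π => (Bk k π : ℝ)) i = z k i) {a : Fin W.N → ℝ}
    (ha : ∀ i, a i = ∑ k ∈ Icc 2 (Fintype.card X), (z k i : ℝ) / k) (S : Finset (Fin W.N)) (D : ℝ) (hD : 0 < D) (hS : ∀ i ∈ S, D ≤ W.d i) :
    ∑ i ∈ S, |a i| / W.d i ≤ 2 * Fintype.card X / D := by
  have h1 : ∀ i ∈ S, |a i| / W.d i ≤ (∑ k ∈ Icc 2 (Fintype.card X), (z k i : ℝ) ^ 2 / k) / D := by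
    intro i hi
    have hh : |a i| ≤ ∑ k ∈ Icc 2 (Fintype.card X), (z k i : ℝ) ^ 2 / k := by
      rw [ha]
      refine (abs_sum_le_sum_abs _ _).trans (sum_le_sum fun k _ => ?_)
      rw [abs_div, Nat.abs_cast]
      gcongr
      have : |z k i| ≤ (z k i) ^ 2 := by
        rw [← sq_abs]
        nlinarith [abs_nonneg (z k i), Int.le_self_sq |z k i|]
      exact_mod_cast this
    exact div_le_div₀ (by positivity) hh hD (hS i hi)
  refine (sum_le_sum h1).trans ?_
  rw [← sum_div]
  gcongr
  rw [sum_comm]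
  calc _ ≤ ∑ k ∈ Icc 2 (Fintype.card X), (2 : ℝ) := by
        refine sum_le_sum fun k hk => ?_
        have hk0 : 0 < k := by have := (mem_Icc.1 hk).1; omega
        have hk1 : (1 : ℝ) ≤ k := by exact_mod_cast hk0
        rw [← sum_div, div_le_iff₀ (by linarith)]
        have h2 := sq_z W hz k hk0
        have h3 : ∑ i ∈ S, (z k i : ℝ) ^ 2 ≤ ∑ i, (z k i : ℝ) ^ 2 := sum_le_sum_of_subset_of_nonneg (subset_univ _) (fun _ _ _ => by positivity)
        linarith
    _ ≤ _ := by
        rw [sum_const, nsmul_eq_mul, Nat.card_Icc, mul_comm]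
        gcongr
        omega

lemma E_part {a : Fin W.N → ℝ} {L : ℝ} (hL : ∑ i, a i ^ 2 ≤ L) (S : Finset (Fin W.N)) (D : ℝ) (hD : 0 < D) (hS : ∀ i ∈ S, D ≤ W.d i)
    (M : ℝ) (hM : S.card * D ≤ M) :
    ∑ i ∈ S, |a i| / W.d i ≤ √(M * L / D ^ 3) := by
  have hL0 : 0 ≤ L := le_trans (sum_nonneg fun _ _ => by positivity) hL
  have h1 : ∑ i ∈ S, |a i| / W.d i ≤ (∑ i ∈ S, |a i|) / D := by
    rw [sum_div]
    exact sum_le_sum fun i hi => div_le_div_of_nonneg_left (abs_nonneg _) hD (hS i hi)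
  refine h1.trans (Real.le_sqrt_of_sq_le ?_)
  have h2 : (∑ i ∈ S, |a i|) ^ 2 ≤ S.card * ∑ i ∈ S, |a i| ^ 2 := sq_sum_le_card_mul_sum_sq
  simp only [sq_abs] at h2
  have h3 : ∑ i ∈ S, a i ^ 2 ≤ L := (sum_le_sum_of_subset_of_nonneg (subset_univ _) (fun _ _ _ => by positivity)).trans hL
  rw [div_pow, div_le_div_iff₀ (by positivity) (by positivity)]
  have h4 : (∑ i ∈ S, |a i|) ^ 2 ≤ S.card * L := h2.trans (by gcongr)
  calc _ ≤ S.card * L * D ^ 3 := by gcongr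
    _ = (S.card * D) * L * D ^ 2 := by ring
    _ ≤ _ := by gcongr
end

end Part9

section Part10
open Finset Equiv
set_option linter.unusedSectionVars false

section

lemma main_bound (n : ℕ) (hn : 16 ≤ n) :
    |(∑ σ : Perm (Fin n), ∑ τ : Perm (Fin n), (numBigCycles (σ * τ * σ⁻¹ * τ⁻¹) : ℝ)) / (n.factorial : ℝ) ^ 2 - ∑ k ∈ Icc 2 n, (1 : ℝ) / k|
      ≤ 132 / n + √(1024 * ((∑ k ∈ Icc 2 n, (1 : ℝ) / k) ^ 2 + ∑ k ∈ Icc 2 n, (1 : ℝ) / k) / n) := by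
  classical
  set h : ℝ := ∑ k ∈ Icc 2 n, (1 : ℝ) / k with hh
  have hh0 : 0 ≤ h := sum_nonneg fun _ _ => by positivity
  obtain ⟨W⟩ := exists_WD (Perm (Fin n))
  obtain ⟨z, a, hz, ha, haz⟩ := exists_coefs W
  have hcard : Fintype.card (Fin n) = n := Fintype.card_fin n
  have hL : ∑ i, a i ^ 2 ≤ h ^ 2 + h := sq_a W ha h (by rw [hcard])
  obtain ⟨i0, hd0, hi0⟩ := W.exists_triv
  have ha0 : a i0 = h := by
    have := ff_triv W hi0
    rw [ha, hcard] at this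
    exact_mod_cast this
  -- main identity
  have hmain : (∑ σ : Perm (Fin n), ∑ τ : Perm (Fin n), (numBigCycles (σ * τ * σ⁻¹ * τ⁻¹) : ℝ)) / (n.factorial : ℝ) ^ 2 = ∑ i, a i / W.d i := by
    have h1 := W.sum_commutator ff ff_inv
    simp only [ha, Fintype.card_perm, hcard] at h1
    have h2 : ∀ π : Perm (Fin n), (numBigCycles π : ℝ) = ff π := fun π => card_cycleType π
    simp only [h2]
    exact_mod_cast h1
  set m := n / 4 with hm
  have hm4 : 4 * m ≤ n := by omega
  have hm2 : 2 ≤ m := by omega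
  set D : ℝ := ((m - 1 : ℕ) : ℝ) with hD
  have hDn : (n : ℝ) / 8 ≤ D := by
    have : n ≤ 8 * (m - 1) := by omega
    have : (n : ℝ) ≤ 8 * D := by rw [hD]; exact_mod_cast this
    linarith
  have hn0 : (16 : ℝ) ≤ n := by exact_mod_cast hn
  have hD0 : 0 < D := by linarith
  -- index classes
  set SA := univ.filter (fun i => ¬ NA (RR W i)) with hSA
  set SE := univ.filter (fun i => NA (RR W i) ∧ ¬ NB (RR W i)) with hSE
  set SS := univ.filter (fun i => i ≠ i0 ∧ NB (RR W i)) with hSS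
  have hcov : univ.erase i0 ⊆ SA ∪ SE ∪ SS := by
    intro i hi
    simp only [mem_erase, mem_univ, and_true] at hi
    simp only [hSA, hSE, hSS, mem_union, mem_filter, mem_univ, true_and]
    tauto
  have hpos : ∀ i, 0 ≤ |a i| / W.d i := fun i => by positivity
  have hsum : ∑ i, a i / W.d i - h = ∑ i ∈ univ.erase i0, a i / W.d i := by
    rw [← Finset.add_sum_erase univ _ (mem_univ i0), ha0, hd0]; simp
  rw [hmain, hsum]
  have b1 : |∑ i ∈ univ.erase i0, a i / W.d i| ≤ ∑ i ∈ SA, |a i| / W.d i + ∑ i ∈ SE, |a i| / W.d i + ∑ i ∈ SS, |a i| / W.d i := by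
    calc _ ≤ ∑ i ∈ univ.erase i0, |a i| / W.d i := by
          refine (abs_sum_le_sum_abs _ _).trans (le_of_eq (sum_congr rfl fun i _ => ?_))
          rw [abs_div, Nat.abs_cast]
      _ ≤ ∑ i ∈ SA ∪ SE ∪ SS, |a i| / W.d i := sum_le_sum_of_subset_of_nonneg hcov fun i _ _ => hpos i
      _ ≤ ∑ i ∈ SA ∪ SE, |a i| / W.d i + ∑ i ∈ SS, |a i| / W.d i := by
          rw [← sum_union_inter]
          exact le_add_of_nonneg_right (sum_nonneg fun i _ => hpos i)
      _ ≤ _ := by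
          gcongr
          rw [← sum_union_inter (s₁ := SA)]
          exact le_add_of_nonneg_right (sum_nonneg fun i _ => hpos i)
  have bA : ∑ i ∈ SA, |a i| / W.d i ≤ 128 / n := by
    refine (A_part W hz haz SA (D ^ 2) (by positivity) ?_).trans ?_
    · intro i hi
      have := dimA' W i m hm2 (by rw [hcard]; exact hm4) (mem_filter.1 hi).2
      rw [hD]; exact_mod_cast this
    · rw [hcard, div_le_div_iff₀ (by positivity) (by linarith)]
      nlinarith
  have bS : ∑ i ∈ SS, |a i| / W.d i ≤ 4 / n := by
    have hc : ∀ i ∈ SS, W.d i = 1 ∧ ∀ g, W.chi i g = sgn (Fin n) g := by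
      intro i hi
      obtain ⟨h1, h2⟩ := (mem_filter.1 hi).2
      obtain ⟨hd, h3⟩ := nb_class W (by rw [hcard]; omega) i h2
      refine ⟨hd, h3.resolve_left fun h4 => h1 (W.chi_inj fun g => by rw [h4, hi0])⟩
    have h1 : SS.card ≤ 1 := card_le_one.2 fun i hi j hj => W.chi_inj fun g => by rw [(hc i hi).2, (hc j hj).2]
    have h2 : ∀ i ∈ SS, |a i| / W.d i ≤ 4 / n := by
      intro i hi
      have := sgn_part W hz haz (by rw [hcard]; omega) i (hc i hi).2
      rw [hcard] at this
      rw [(hc i hi).1]; simpa using this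
    refine (sum_le_card_nsmul _ _ _ h2).trans ?_
    rw [nsmul_eq_mul]
    have h3 : (SS.card : ℝ) ≤ 1 := by exact_mod_cast h1
    exact mul_le_of_le_one_left (by positivity) h3
  have bE : ∑ i ∈ SE, |a i| / W.d i ≤ √(1024 * (h ^ 2 + h) / n) := by
    have hSED : ∀ i ∈ SE, m - 1 ≤ W.d i := fun i hi => dimB' W i m hm2 (by rw [hcard]; omega) (mem_filter.1 hi).2.2
    have e : Fin 2 ⊕ Fin (n - 2) ≃ Fin n := Fintype.equivOfCardEq (by simp; omega)
    have hsub : SE ⊆ SE.filter (fun i => avgM (W.twR (JR e) 1 i) ≠ 0) ∪ SE.filter (fun i => avgM (W.twR (JR e) (sgn (Fin (n - 2))) i) ≠ 0) := by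
      intro i hi
      have := exc_avg W (by rw [hcard]; omega) e i (mem_filter.1 hi).2.1 (mem_filter.1 hi).2.2
      simp only [mem_union, mem_filter]
      tauto
    have hq : ((Fintype.card (Perm (Fin n)) : ℝ) / Fintype.card (Perm (Fin (n - 2)))) ≤ n ^ 2 := by
      rw [Fintype.card_perm, Fintype.card_perm, hcard, Fintype.card_fin, div_le_iff₀ (by exact_mod_cast Nat.factorial_pos _)]
      obtain ⟨k, rfl⟩ : ∃ k, n = k + 2 := ⟨n - 2, by omega⟩
      rw [Nat.add_sub_cancel, Nat.factorial_succ, Nat.factorial_succ]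
      push_cast
      have : (0 : ℝ) ≤ (k.factorial : ℝ) := by positivity
      have hk : (0 : ℝ) ≤ k := by positivity
      nlinarith [mul_nonneg this hk]
    have c1 := W.card_le_of_avg (JR e) (JR_inj e) 1 (SE.filter (fun i => avgM (W.twR (JR e) 1 i) ≠ 0)) (m - 1)
      (fun i hi => hSED i (mem_filter.1 hi).1) (fun i hi => (mem_filter.1 hi).2)
    have c2 := W.card_le_of_avg (JR e) (JR_inj e) (sgn (Fin (n - 2))) (SE.filter (fun i => avgM (W.twR (JR e) (sgn (Fin (n - 2))) i) ≠ 0)) (m - 1)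
      (fun i hi => hSED i (mem_filter.1 hi).1) (fun i hi => (mem_filter.1 hi).2)
    have hM : (SE.card : ℝ) * D ≤ 2 * n ^ 2 := by
      have h1 := (card_le_card hsub).trans (card_union_le _ _)
      have h2 : (SE.card : ℝ) ≤ (SE.filter (fun i => avgM (W.twR (JR e) 1 i) ≠ 0)).card + (SE.filter (fun i => avgM (W.twR (JR e) (sgn (Fin (n - 2))) i) ≠ 0)).card := by
        exact_mod_cast h1
      rw [← hD] at c1 c2
      calc _ ≤ _ := mul_le_mul_of_nonneg_right h2 hD0.le
        _ ≤ _ := by rw [add_mul]; linarith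
    refine (E_part W hL SE D hD0 (fun i hi => by rw [hD]; exact_mod_cast hSED i hi) _ hM).trans ?_
    apply Real.sqrt_le_sqrt
    have hL0 : 0 ≤ h ^ 2 + h := by positivity
    rw [div_le_div_iff₀ (by positivity) (by linarith)]
    have h3 : ((n : ℝ) / 8) ^ 3 ≤ D ^ 3 := by gcongr
    calc _ = 1024 * (h ^ 2 + h) * ((n : ℝ) / 8) ^ 3 := by ring
      _ ≤ _ := by gcongr
  calc _ ≤ _ := b1
    _ ≤ 128 / n + √(1024 * (h ^ 2 + h) / n) + 4 / n := by linarith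
    _ = _ := by ring

lemma harm_eq (n : ℕ) (hn : 1 ≤ n) : ∑ k ∈ Icc 2 n, (1 : ℝ) / k = (harmonic n : ℝ) - 1 := by
  rw [harmonic_eq_sum_Icc]
  push_cast
  rw [← Finset.add_sum_Ioc_eq_sum_Icc hn]
  rw [show Icc 2 n = Ioc 1 n from rfl]
  simp

end


end Part10

/-- The expected number of cone points of a random square-tiled surface:
`E[s_n] = log(n) + γ - 1 + o(1)`. -/
theorem expected_cone_points :
    Filter.Tendsto (fun n : ℕ =>
        (∑ σ : Equiv.Perm (Fin n), ∑ τ : Equiv.Perm (Fin n),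
            (numBigCycles (σ * τ * σ⁻¹ * τ⁻¹) : ℝ)) / (n.factorial : ℝ) ^ 2
          - Real.log n)
      Filter.atTop (nhds (Real.eulerMascheroniConstant - 1)) := by
  have hE : Filter.Tendsto (fun n : ℕ => 132 / (n : ℝ) + √(1024 * (((Real.log n) ^ 2 + Real.log n) / n))) Filter.atTop (nhds 0) := by
    have h1 : Filter.Tendsto (fun n : ℕ => 132 / (n : ℝ)) Filter.atTop (nhds 0) := tendsto_const_div_atTop_nhds_zero_nat 132
    have l2 : Filter.Tendsto (fun x : ℝ => Real.log x ^ 2 / x) Filter.atTop (nhds 0) := by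
      simpa using Real.tendsto_pow_log_div_mul_add_atTop 1 0 2 one_ne_zero
    have l1 : Filter.Tendsto (fun x : ℝ => Real.log x / x) Filter.atTop (nhds 0) := by
      simpa using Real.tendsto_pow_log_div_mul_add_atTop 1 0 1 one_ne_zero
    have l3 : Filter.Tendsto (fun x : ℝ => √(1024 * ((Real.log x ^ 2 + Real.log x) / x))) Filter.atTop (nhds 0) := by
      have := ((l2.add l1).const_mul 1024).sqrt
      simpa [add_div] using this
    have l4 := l3.comp tendsto_natCast_atTop_atTop
    simpa using h1.add l4
  have hdiff : Filter.Tendsto (fun n : ℕ => (∑ σ : Equiv.Perm (Fin n), ∑ τ : Equiv.Perm (Fin n),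
            (numBigCycles (σ * τ * σ⁻¹ * τ⁻¹) : ℝ)) / (n.factorial : ℝ) ^ 2 - ((harmonic n : ℝ) - 1)) Filter.atTop (nhds 0) := by
    refine squeeze_zero_norm' ?_ hE
    filter_upwards [Filter.eventually_ge_atTop 16] with n hn
    have hb := main_bound n hn
    rw [harm_eq n (by omega)] at hb
    rw [Real.norm_eq_abs]
    refine hb.trans ?_
    have hl := harmonic_le_one_add_log n
    have hpos : (0 : ℝ) ≤ (harmonic n : ℝ) - 1 := by
      rw [← harm_eq n (by omega)]; exact Finset.sum_nonneg fun _ _ => by positivity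
    have hu : (harmonic n : ℝ) - 1 ≤ Real.log n := by linarith
    rw [mul_div_assoc]
    gcongr
  have := hdiff.add (Real.tendsto_harmonic_sub_log.sub_const 1)
  rw [zero_add] at this
  refine this.congr fun n => ?_
  ring
end
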